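/- Let N ≥ 3, let p ≥ q > 0 with pq > 1, and let a, b > −2. Assume the quadruple (p,q,a,b) is subcritical and, in the case N ≥ 4, assume additionally that 0 ≤ a − b ≤ (N−2)(p−q). Let (u,v) be a nonnegative solution of the Hénon–Lane–Emden system (HLE) such that either both u and v are polynomially bounded, or ∫_{ℝ^N} (|x|^b u(x)^{q+1} + |x|^a v(x)^{p+1}) dx < ∞. If there exist R₄ > R₁ > 0, s > 0, C₀ > 0 and R* > 0 such that N − sβ < 1 and ∫_{B_{R₄} ∖ B_{R₁}} v_R(x)^s dx ≤ C₀ for every R ≥ R*, then u ≡ 0 and v ≡ 0 on ℝ^N. -/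

import Mathlib

open MeasureTheory Metric Set

noncomputable section

/-- Euclidean space `ℝ^N`. -/
abbrev Euc (N : ℕ) := EuclideanSpace ℝ (Fin N)

/-- The Laplacian of a function `f : ℝ^N → ℝ`, as the sum of the pure second
partial derivatives. -/
def lap {N : ℕ} (f : Euc N → ℝ) (x : Euc N) : ℝ :=
  ∑ i : Fin N, iteratedFDeriv ℝ 2 f x ![EuclideanSpace.single i 1, EuclideanSpace.single i 1]

/-- `(u, v)` is a solution of the Hénon–Lane–Emden system
`-Δu = |x|^a |v|^{p-1} v`, `-Δv = |x|^b |u|^{q-1} u` on `ℝ^N \ {0}`: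
`u, v` are `C²` on `ℝ^N \ {0}`, continuous on `ℝ^N`, and satisfy the equations pointwise. -/
def IsHLESol {N : ℕ} (p q a b : ℝ) (u v : Euc N → ℝ) : Prop :=
  ContDiffOn ℝ 2 u {x : Euc N | x ≠ 0} ∧ ContDiffOn ℝ 2 v {x : Euc N | x ≠ 0} ∧
  Continuous u ∧ Continuous v ∧
  (∀ x : Euc N, x ≠ 0 → -lap u x = ‖x‖ ^ a * (|v x| ^ (p - 1) * v x)) ∧
  (∀ x : Euc N, x ≠ 0 → -lap v x = ‖x‖ ^ b * (|u x| ^ (q - 1) * u x))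

/-- Stability of a (positive) solution of the Hénon–Lane–Emden system on an open set `Ω`:
there exist positive `C²` functions `ξ, ζ` on `Ω` with
`-Δξ ≥ p |x|^a v^{p-1} ζ` and `-Δζ ≥ q |x|^b u^{q-1} ξ` on `Ω`. -/
def HLEStableOn {N : ℕ} (p q a b : ℝ) (u v : Euc N → ℝ) (Ω : Set (Euc N)) : Prop :=
  ∃ ξ ζ : Euc N → ℝ, ContDiffOn ℝ 2 ξ Ω ∧ ContDiffOn ℝ 2 ζ Ω ∧
    (∀ x ∈ Ω, 0 < ξ x) ∧ (∀ x ∈ Ω, 0 < ζ x) ∧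
    (∀ x ∈ Ω, p * ‖x‖ ^ a * v x ^ (p - 1) * ζ x ≤ -lap ξ x) ∧
    (∀ x ∈ Ω, q * ‖x‖ ^ b * u x ^ (q - 1) * ξ x ≤ -lap ζ x)

/-- Stability outside a compact set `K`: stability on every open set whose closure is
compact and contained in `ℝ^N \ K`. -/
def HLEStableOutside {N : ℕ} (p q a b : ℝ) (u v : Euc N → ℝ) (K : Set (Euc N)) : Prop :=
  IsCompact K ∧
    ∀ Ω : Set (Euc N), IsOpen Ω → IsCompact (closure Ω) → closure Ω ⊆ Kᶜ →
      HLEStableOn p q a b u v Ω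

/-- `(u, v)` solves the Lane–Emden system `-Δu = |v|^{p-1} v`, `-Δv = |u|^{q-1} u` on `ℝ^N`. -/
def IsLESol {N : ℕ} (p q : ℝ) (u v : Euc N → ℝ) : Prop :=
  (∀ x : Euc N, -lap u x = |v x| ^ (p - 1) * v x) ∧
  (∀ x : Euc N, -lap v x = |u x| ^ (q - 1) * u x)

/-- Stability of a (positive) solution of the Lane–Emden system on an open set `Ω`. -/
def LEStableOn {N : ℕ} (p q : ℝ) (u v : Euc N → ℝ) (Ω : Set (Euc N)) : Prop :=
  ∃ ξ ζ : Euc N → ℝ, ContDiffOn ℝ 2 ξ Ω ∧ ContDiffOn ℝ 2 ζ Ω ∧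
    (∀ x ∈ Ω, 0 < ξ x) ∧ (∀ x ∈ Ω, 0 < ζ x) ∧
    (∀ x ∈ Ω, p * v x ^ (p - 1) * ζ x ≤ -lap ξ x) ∧
    (∀ x ∈ Ω, q * u x ^ (q - 1) * ξ x ≤ -lap ζ x)

/-- A function on `ℝ^N` is polynomially bounded. -/
def PolyBounded {N : ℕ} (w : Euc N → ℝ) : Prop :=
  ∃ K L R : ℝ, 0 < K ∧ 0 < L ∧ ∀ x : Euc N, R ≤ ‖x‖ → |w x| ≤ K * ‖x‖ ^ L

/-- The polynomial `G` from Theorem 1.4 (iii). -/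
def Gpoly (p q x : ℝ) : ℝ :=
  x ^ 4 - (4 * p * q * (q + 1) / (p + 1)) * x ^ 2 +
    (2 * p * q * (q + 1) * (p + q + 2) / (p + 1) ^ 2) * x -
    p * q * (q + 1) ^ 2 / (p + 1) ^ 2

open scoped ContDiff

/-- The `i`-th partial derivative. -/
def pd {N : ℕ} (i : Fin N) (f : Euc N → ℝ) (x : Euc N) : ℝ :=
  fderiv ℝ f x (EuclideanSpace.single i 1)

section Calculus

variable {N : ℕ} {f g : Euc N → ℝ} {x : Euc N}

lemma ContDiffAt.pd_left {m n : WithTop ℕ∞} (hf : ContDiffAt ℝ n f x) (hmn : m + 1 ≤ n)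
    (i : Fin N) : ContDiffAt ℝ m (pd i f) x :=
  (hf.fderiv_right hmn).clm_apply contDiffAt_const

lemma Filter.EventuallyEq.pd_eq (h : f =ᶠ[nhds x] g) (i : Fin N) : pd i f x = pd i g x := by
  simp [pd, h.fderiv_eq]

lemma Filter.EventuallyEq.pd (h : f =ᶠ[nhds x] g) (i : Fin N) : pd i f =ᶠ[nhds x] pd i g := by
  filter_upwards [h.eventuallyEq_nhds] with y hy using hy.pd_eq i

lemma Filter.EventuallyEq.lap_eq (h : f =ᶠ[nhds x] g) : lap f x = lap g x := by
  simp only [lap]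
  refine Finset.sum_congr rfl fun i _ => ?_
  rw [(h.iteratedFDeriv ℝ 2).eq_of_nhds]

lemma pd_zero (i : Fin N) : pd i (fun _ : Euc N => (0 : ℝ)) x = 0 := by simp [pd]

lemma pd_add (hf : DifferentiableAt ℝ f x) (hg : DifferentiableAt ℝ g x) (i : Fin N) :
    pd i (fun y => f y + g y) x = pd i f x + pd i g x := by
  simp [pd, fderiv_fun_add hf hg]

lemma pd_sub (hf : DifferentiableAt ℝ f x) (hg : DifferentiableAt ℝ g x) (i : Fin N) :
    pd i (fun y => f y - g y) x = pd i f x - pd i g x := by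
  simp [pd, fderiv_fun_sub hf hg]

lemma pd_mul (hf : DifferentiableAt ℝ f x) (hg : DifferentiableAt ℝ g x) (i : Fin N) :
    pd i (fun y => f y * g y) x = f x * pd i g x + g x * pd i f x := by
  simp [pd, fderiv_fun_mul hf hg]

lemma pd_const_mul (c : ℝ) (hf : DifferentiableAt ℝ f x) (i : Fin N) :
    pd i (fun y => c * f y) x = c * pd i f x := by
  simp [pd, fderiv_const_mul hf]

lemma pd_sum {ι : Type*} (s : Finset ι) {F : ι → Euc N → ℝ}
    (hF : ∀ j ∈ s, DifferentiableAt ℝ (F j) x) (i : Fin N) :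
    pd i (fun y => ∑ j ∈ s, F j y) x = ∑ j ∈ s, pd i (F j) x := by
  simp [pd, fderiv_fun_sum hF]

lemma pd_coord (i j : Fin N) : pd i (fun y : Euc N => y j) x = if i = j then 1 else 0 := by
  have : (fun y : Euc N => y j) = (EuclideanSpace.proj j : Euc N →L[ℝ] ℝ) := by ext; simp
  rw [pd, this, ContinuousLinearMap.fderiv]
  simp [eq_comm]

lemma pd_comp_of_hasDerivAt {φ : ℝ → ℝ} {φ' : ℝ} (hφ : HasDerivAt φ φ' (f x))
    (hf : DifferentiableAt ℝ f x) (i : Fin N) : pd i (fun y => φ (f y)) x = φ' * pd i f x := by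
  have := (hφ.comp_hasFDerivAt x hf.hasFDerivAt).fderiv
  rw [pd, show (fun y => φ (f y)) = φ ∘ f from rfl, this]
  simp [pd]

lemma lap_eq_sum_pd (hf : ContDiffAt ℝ 2 f x) : lap f x = ∑ i, pd i (pd i f) x := by
  simp only [lap]
  refine Finset.sum_congr rfl fun i _ => ?_
  have hd : DifferentiableAt ℝ (fderiv ℝ f) x :=
    (hf.fderiv_right (m := 1) (by norm_num)).differentiableAt (by norm_num)
  rw [iteratedFDeriv_two_apply]
  show _ = fderiv ℝ (fun y => fderiv ℝ f y (EuclideanSpace.single i 1)) x _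
  rw [fderiv_clm_apply hd (differentiableAt_const _)]
  simp

lemma pd_comm (hf : ContDiffAt ℝ 2 f x) (i j : Fin N) :
    pd i (pd j f) x = pd j (pd i f) x := by
  have hd : DifferentiableAt ℝ (fderiv ℝ f) x :=
    (hf.fderiv_right (m := 1) (by norm_num)).differentiableAt (by norm_num)
  have key : ∀ i j : Fin N, pd i (pd j f) x =
      fderiv ℝ (fderiv ℝ f) x (EuclideanSpace.single i 1) (EuclideanSpace.single j 1) := by
    intro i j
    show fderiv ℝ (fun y => fderiv ℝ f y (EuclideanSpace.single j 1)) x _ = _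
    rw [fderiv_clm_apply hd (differentiableAt_const _)]
    simp
  rw [key, key]
  exact (hf.isSymmSndFDerivAt (by simp)).eq _ _

lemma lap_mul (hf : ContDiffAt ℝ 2 f x) (hg : ContDiffAt ℝ 2 g x) :
    lap (fun y => f y * g y) x =
      f x * lap g x + 2 * ∑ i, pd i f x * pd i g x + g x * lap f x := by
  rw [lap_eq_sum_pd (hf.mul hg), lap_eq_sum_pd hf, lap_eq_sum_pd hg]
  simp only [Finset.mul_sum, ← Finset.sum_add_distrib]
  refine Finset.sum_congr rfl fun i _ => ?_
  have hf1 : ∀ᶠ y in nhds x, DifferentiableAt ℝ f y :=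
    (hf.eventually (by simp)).mono fun y hy => hy.differentiableAt (by norm_num)
  have hg1 : ∀ᶠ y in nhds x, DifferentiableAt ℝ g y :=
    (hg.eventually (by simp)).mono fun y hy => hy.differentiableAt (by norm_num)
  have e : pd i (fun y => f y * g y) =ᶠ[nhds x]
      fun y => f y * pd i g y + g y * pd i f y := by
    filter_upwards [hf1, hg1] with y h1 h2 using pd_mul h1 h2 i
  have hfd := (hf.differentiableAt (by norm_num))
  have hgd := (hg.differentiableAt (by norm_num))
  have hfp : DifferentiableAt ℝ (pd i f) x :=
    (hf.pd_left (m := 1) (by norm_num) i).differentiableAt (by norm_num)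
  have hgp : DifferentiableAt ℝ (pd i g) x :=
    (hg.pd_left (m := 1) (by norm_num) i).differentiableAt (by norm_num)
  rw [e.pd_eq i, pd_add (f := fun y => f y * pd i g y) (g := fun y => g y * pd i f y)
    (hfd.mul hgp) (hgd.mul hfp), pd_mul hfd hgp, pd_mul hgd hfp]
  ring

lemma lap_pd (hf : ContDiffAt ℝ 3 f x) (i : Fin N) : lap (pd i f) x = pd i (lap f) x := by
  rw [lap_eq_sum_pd (hf.pd_left (m := 2) (by norm_num) i)]
  have e : lap f =ᶠ[nhds x] fun y => ∑ j, pd j (pd j f) y := by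
    filter_upwards [hf.eventually (by simp)] with y hy using lap_eq_sum_pd (hy.of_le (by norm_num))
  rw [e.pd_eq i, pd_sum]
  · refine Finset.sum_congr rfl fun j _ => ?_
    have e2 : pd j (pd i f) =ᶠ[nhds x] pd i (pd j f) := by
      filter_upwards [hf.eventually (by simp)] with y hy
        using pd_comm (hy.of_le (by norm_num)) j i
    rw [e2.pd_eq j, pd_comm (hf.pd_left (m := 2) (by norm_num) j)]
  · intro j _
    exact ((hf.pd_left (m := 2) (by norm_num) j).pd_left (m := 1) (by norm_num) j).differentiableAt
      (by norm_num)

lemma tsupport_pd_subset (i : Fin N) : tsupport (pd i f) ⊆ tsupport f := by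
  intro x hx
  by_contra h
  have : f =ᶠ[nhds x] fun _ => 0 := notMem_tsupport_iff_eventuallyEq.mp h
  refine (notMem_tsupport_iff_eventuallyEq.mpr ?_) hx
  filter_upwards [this.pd i] with y hy
  rw [hy]; exact pd_zero i

lemma continuous_of_contDiffAt_tsupport {F : Euc N → ℝ}
    (h : ∀ x ∈ tsupport F, ContinuousAt F x) : Continuous F := by
  refine continuous_iff_continuousAt.mpr fun x => ?_
  by_cases hx : x ∈ tsupport F
  · exact h x hx
  · exact (continuousAt_const (y := (0 : ℝ))).congr
      (notMem_tsupport_iff_eventuallyEq.mp hx).symm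

lemma contDiff_of_contDiffAt_tsupport {n : WithTop ℕ∞} {F : Euc N → ℝ}
    (h : ∀ x ∈ tsupport F, ContDiffAt ℝ n F x) : ContDiff ℝ n F := by
  refine contDiff_iff_contDiffAt.mpr fun x => ?_
  by_cases hx : x ∈ tsupport F
  · exact h x hx
  · exact (contDiffAt_const (c := (0 : ℝ))).congr_of_eventuallyEq
      (notMem_tsupport_iff_eventuallyEq.mp hx)

/-- Integration by parts of a first derivative against a compactly supported function. -/
lemma integral_mul_pd (hg : ContDiff ℝ 1 g) (hc : HasCompactSupport g)
    (hf : ∀ x ∈ tsupport g, ContDiffAt ℝ 1 f x) (i : Fin N) :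
    ∫ x, f x * pd i g x = - ∫ x, pd i f x * g x := by
  have hi1 : Integrable (fun x => f x * pd i g x) := by
    have hs : tsupport (fun x => f x * pd i g x) ⊆ tsupport g :=
      tsupport_mul_subset_right.trans (tsupport_pd_subset i)
    refine Continuous.integrable_of_hasCompactSupport ?_ (hc.mono' (subset_closure.trans hs))
    exact continuous_of_contDiffAt_tsupport fun x hx => (hf x (hs hx)).continuousAt.mul
      ((hg.contDiffAt (x := x)).pd_left (m := 0) (by norm_num) i).continuousAt
  have hi2 : Integrable (fun x => pd i f x * g x) := by
    have hs : tsupport (fun x => pd i f x * g x) ⊆ tsupport g := tsupport_mul_subset_right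
    refine Continuous.integrable_of_hasCompactSupport ?_ (hc.mono' (subset_closure.trans hs))
    exact continuous_of_contDiffAt_tsupport fun x hx =>
      ((hf x (hs hx)).pd_left (m := 0) (by norm_num) i).continuousAt.mul hg.continuous.continuousAt
  have hi3 : Integrable (fun x => f x * g x) := by
    have hs : tsupport (fun x => f x * g x) ⊆ tsupport g := tsupport_mul_subset_right
    refine Continuous.integrable_of_hasCompactSupport ?_ (hc.mono' (subset_closure.trans hs))
    exact continuous_of_contDiffAt_tsupport fun x hx =>
      (hf x (hs hx)).continuousAt.mul hg.continuous.continuousAt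
  exact integral_mul_fderiv_eq_neg_fderiv_mul_of_integrable hi2 hi1 hi3
    (fun x hx => (hf x hx).differentiableAt (by norm_num))
    (fun x _ => hg.differentiable (by norm_num) x)

/-- Green's second identity against a compactly supported function. -/
lemma integral_mul_lap (hg : ContDiff ℝ 2 g) (hc : HasCompactSupport g)
    (hf : ∀ x ∈ tsupport g, ContDiffAt ℝ 2 f x) :
    ∫ x, f x * lap g x = ∫ x, lap f x * g x := by
  have hpg : ∀ i, ContDiff ℝ 1 (pd i g) := fun i => contDiff_iff_contDiffAt.mpr fun x =>
    hg.contDiffAt.pd_left (by norm_num) i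
  have hcp : ∀ i, HasCompactSupport (pd i g) := fun i =>
    hc.mono' (subset_closure.trans (tsupport_pd_subset i))
  have e1 : ∀ i, ∫ x, f x * pd i (pd i g) x = - ∫ x, pd i f x * pd i g x := fun i =>
    integral_mul_pd (hpg i) (hcp i)
      (fun x hx => (hf x (tsupport_pd_subset i hx)).of_le (by norm_num)) i
  have e2 : ∀ i, ∫ x, pd i f x * pd i g x = - ∫ x, pd i (pd i f) x * g x := fun i =>
    integral_mul_pd (hg.of_le (by norm_num)) hc
      (fun x hx => (hf x hx).pd_left (by norm_num) i) i
  have l1 : ∀ x, f x * lap g x = ∑ i, f x * pd i (pd i g) x := fun x => by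
    rw [lap_eq_sum_pd hg.contDiffAt, Finset.mul_sum]
  have l2 : ∀ x, lap f x * g x = ∑ i, pd i (pd i f) x * g x := fun x => by
    by_cases hx : x ∈ tsupport g
    · rw [lap_eq_sum_pd (hf x hx), Finset.sum_mul]
    · rw [image_eq_zero_of_notMem_tsupport hx]; simp
  simp_rw [l1, l2]
  rw [integral_finsetSum, integral_finsetSum]
  · exact Finset.sum_congr rfl fun i _ => by rw [e1, e2, neg_neg]
  · intro i _
    have hs : tsupport (fun x => pd i (pd i f) x * g x) ⊆ tsupport g := tsupport_mul_subset_right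
    refine Continuous.integrable_of_hasCompactSupport ?_ (hc.mono' (subset_closure.trans hs))
    exact continuous_of_contDiffAt_tsupport fun x hx =>
      (((hf x (hs hx)).pd_left (m := 1) (by norm_num) i).pd_left (m := 0)
        (by norm_num) i).continuousAt.mul hg.continuous.continuousAt
  · intro i _
    have hs : tsupport (fun x => f x * pd i (pd i g) x) ⊆ tsupport g :=
      tsupport_mul_subset_right.trans ((tsupport_pd_subset i).trans (tsupport_pd_subset i))
    refine Continuous.integrable_of_hasCompactSupport ?_ (hc.mono' (subset_closure.trans hs))
    exact continuous_of_contDiffAt_tsupport fun x hx => (hf x (hs hx)).continuousAt.mul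
      (((hpg i).contDiffAt (x := x)).pd_left (m := 0) (by norm_num) i).continuousAt

end Calculus

/-- The primitive of a bump function vanishing at `0`. -/
def bumpInt {c : ℝ} (B : ContDiffBump c) (s : ℝ) : ℝ := ∫ t in (0 : ℝ)..s, B t

/-- The second primitive of a bump function vanishing at `0`. -/
def bumpIntInt {c : ℝ} (B : ContDiffBump c) (s : ℝ) : ℝ := ∫ t in (0 : ℝ)..s, bumpInt B t

section BumpInt

variable {c : ℝ} (B : ContDiffBump c)

lemma hasDerivAt_bumpInt (s : ℝ) : HasDerivAt (bumpInt B) (B s) s :=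
  intervalIntegral.integral_hasDerivAt_right (B.continuous.intervalIntegrable _ _)
    (B.continuous.stronglyMeasurableAtFilter _ _) B.continuous.continuousAt

lemma continuous_bumpInt : Continuous (bumpInt B) :=
  continuous_iff_continuousAt.mpr fun s => (hasDerivAt_bumpInt B s).continuousAt

lemma hasDerivAt_bumpIntInt (s : ℝ) : HasDerivAt (bumpIntInt B) (bumpInt B s) s :=
  intervalIntegral.integral_hasDerivAt_right ((continuous_bumpInt B).intervalIntegrable _ _)
    ((continuous_bumpInt B).stronglyMeasurableAtFilter _ _) (continuous_bumpInt B).continuousAt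

lemma contDiff_bumpInt : ContDiff ℝ ∞ (bumpInt B) := by
  rw [contDiff_infty_iff_deriv]
  refine ⟨fun s => (hasDerivAt_bumpInt B s).differentiableAt, ?_⟩
  rw [show deriv (bumpInt B) = B from funext fun s => (hasDerivAt_bumpInt B s).deriv]
  exact B.contDiff

lemma contDiff_bumpIntInt : ContDiff ℝ ∞ (bumpIntInt B) := by
  rw [contDiff_infty_iff_deriv]
  refine ⟨fun s => (hasDerivAt_bumpIntInt B s).differentiableAt, ?_⟩
  rw [show deriv (bumpIntInt B) = bumpInt B from funext fun s => (hasDerivAt_bumpIntInt B s).deriv]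
  exact contDiff_bumpInt B

lemma monotone_bumpInt : Monotone (bumpInt B) :=
  monotone_of_deriv_nonneg (fun s => (hasDerivAt_bumpInt B s).differentiableAt) fun s => by
    rw [(hasDerivAt_bumpInt B s).deriv]; exact B.nonneg

lemma bump_eq_zero_of_le {s : ℝ} (h : s ≤ c - B.rOut) : B s = 0 := by
  apply B.zero_of_le_dist
  rw [Real.dist_eq]
  exact le_trans (by linarith) (neg_le_abs _)

lemma bump_eq_zero_of_ge {s : ℝ} (h : c + B.rOut ≤ s) : B s = 0 := by
  apply B.zero_of_le_dist
  rw [Real.dist_eq]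
  exact le_trans (by linarith) (le_abs_self _)

lemma bump_eq_one {s : ℝ} (h : c - B.rIn ≤ s) (h' : s ≤ c + B.rIn) : B s = 1 := by
  apply B.one_of_mem_closedBall
  rw [mem_closedBall, Real.dist_eq, abs_le]
  constructor <;> linarith

variable {B}

lemma bumpInt_eq_zero (hc : B.rOut < c) {s : ℝ} (h : s ≤ c - B.rOut) : bumpInt B s = 0 := by
  refine intervalIntegral.integral_zero_ae (ae_of_all _ fun t ht => bump_eq_zero_of_le B ?_)
  rcases le_total 0 s with h0 | h0
  · rw [uIoc_of_le h0] at ht; linarith [ht.2]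
  · rw [uIoc_of_ge h0] at ht; linarith [ht.2]

lemma bumpInt_nonneg (hc : B.rOut < c) (s : ℝ) : 0 ≤ bumpInt B s := by
  rcases le_total s (c - B.rOut) with h | h
  · rw [bumpInt_eq_zero hc h]
  · rw [← bumpInt_eq_zero hc (le_refl (c - B.rOut))]; exact monotone_bumpInt B h

lemma bumpInt_eq_of_ge {s : ℝ} (h : c + B.rOut ≤ s) : bumpInt B s = bumpInt B (c + B.rOut) := by
  have h1 := intervalIntegral.integral_add_adjacent_intervals (μ := volume)
    (B.continuous.intervalIntegrable 0 (c + B.rOut)) (B.continuous.intervalIntegrable _ s)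
  have h2 : ∫ t in (c + B.rOut)..s, B t = 0 := by
    refine intervalIntegral.integral_zero_ae (ae_of_all _ fun t ht => bump_eq_zero_of_ge B ?_)
    rw [uIoc_of_le h] at ht; exact ht.1.le
  rw [h2, add_zero] at h1
  exact h1.symm

lemma bumpInt_le (s : ℝ) : bumpInt B s ≤ bumpInt B (c + B.rOut) := by
  rcases le_total s (c + B.rOut) with h | h
  · exact monotone_bumpInt B h
  · exact (bumpInt_eq_of_ge h).le

lemma bumpInt_pos (hc : B.rOut < c) {s : ℝ} (h : c - B.rIn < s) : 0 < bumpInt B s := by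
  have h0 : c - B.rIn < min s (c + B.rIn) := lt_min h (by linarith [B.rIn_pos])
  have hb := B.rIn_lt_rOut
  have h1 : bumpInt B (min s (c + B.rIn)) - bumpInt B (c - B.rIn) =
      min s (c + B.rIn) - (c - B.rIn) := by
    have h1 := intervalIntegral.integral_add_adjacent_intervals (μ := volume)
      (B.continuous.intervalIntegrable 0 (c - B.rIn))
      (B.continuous.intervalIntegrable _ (min s (c + B.rIn)))
    have h2 : ∫ t in (c - B.rIn)..(min s (c + B.rIn)), B t =
        ∫ t in (c - B.rIn)..(min s (c + B.rIn)), (1 : ℝ) := by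
      refine intervalIntegral.integral_congr fun t ht => ?_
      rw [uIcc_of_le h0.le] at ht
      exact bump_eq_one B ht.1 (ht.2.trans (min_le_right _ _))
    rw [h2, intervalIntegral.integral_const] at h1
    simp only [bumpInt]
    simp at h1
    linarith
  have h3 := bumpInt_nonneg hc (c - B.rIn)
  have h4 := monotone_bumpInt B (min_le_left s (c + B.rIn))
  linarith

lemma bumpIntInt_eq_zero (hc : B.rOut < c) {s : ℝ} (h : s ≤ c - B.rOut) : bumpIntInt B s = 0 := by
  refine intervalIntegral.integral_zero_ae (ae_of_all _ fun t ht => bumpInt_eq_zero hc ?_)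
  rcases le_total 0 s with h0 | h0
  · rw [uIoc_of_le h0] at ht; linarith [ht.2]
  · rw [uIoc_of_ge h0] at ht; linarith [ht.2]

lemma monotone_bumpIntInt (hc : B.rOut < c) : Monotone (bumpIntInt B) :=
  monotone_of_deriv_nonneg (fun s => (hasDerivAt_bumpIntInt B s).differentiableAt) fun s => by
    rw [(hasDerivAt_bumpIntInt B s).deriv]; exact bumpInt_nonneg hc s

lemma bumpIntInt_nonneg (hc : B.rOut < c) (s : ℝ) : 0 ≤ bumpIntInt B s := by
  rcases le_total s (c - B.rOut) with h | h
  · rw [bumpIntInt_eq_zero hc h]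
  · rw [← bumpIntInt_eq_zero hc (le_refl (c - B.rOut))]; exact monotone_bumpIntInt hc h

lemma bumpIntInt_le {s : ℝ} (hs : 0 ≤ s) : bumpIntInt B s ≤ bumpInt B (c + B.rOut) * s := by
  have : ∫ t in (0 : ℝ)..s, bumpInt B t ≤ ∫ t in (0 : ℝ)..s, bumpInt B (c + B.rOut) :=
    intervalIntegral.integral_mono_on hs ((continuous_bumpInt B).intervalIntegrable _ _)
      (by simp) fun t _ => bumpInt_le t
  rw [intervalIntegral.integral_const] at this
  simp at this
  rw [mul_comm]; exact this

lemma bumpIntInt_pos (hc : B.rOut < c) {s : ℝ} (h : c - B.rIn < s) : 0 < bumpIntInt B s := by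
  have h1 := intervalIntegral.integral_add_adjacent_intervals (μ := volume)
      ((continuous_bumpInt B).intervalIntegrable 0 (c - B.rIn))
      ((continuous_bumpInt B).intervalIntegrable _ s)
  have h2 : 0 < ∫ t in (c - B.rIn)..s, bumpInt B t :=
    intervalIntegral.intervalIntegral_pos_of_pos_on
      ((continuous_bumpInt B).intervalIntegrable _ _) (fun t ht => bumpInt_pos hc ht.1) h
  have h3 := bumpIntInt_nonneg hc (c - B.rIn)
  simp only [bumpIntInt] at *
  linarith

end BumpInt

lemma natCast_le_smooth (k : ℕ) : (k : WithTop ℕ∞) ≤ ∞ := WithTop.coe_le_coe.mpr le_top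

/-- The regularized squared distance `|y - x|² + ε²`. -/
def tau {N : ℕ} (ε : ℝ) (x y : Euc N) : ℝ := ‖y - x‖ ^ 2 + ε ^ 2

/-- A smooth truncation of the regularized fundamental solution with pole `x`. -/
def kerK {N : ℕ} {c : ℝ} (B : ContDiffBump c) (ν ε : ℝ) (x y : Euc N) : ℝ :=
  bumpIntInt B (tau ε x y ^ (-ν))

/-- The radial profile of the smooth part of the Laplacian of `kerK`. -/
def kerProfile {c : ℝ} (B : ContDiffBump c) (ν τ : ℝ) : ℝ :=
  4 * ν ^ 2 * τ ^ (-(2 * ν + 2)) * B (τ ^ (-ν))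

/-- The smooth part of the Laplacian of `kerK`. -/
def kerJ {N : ℕ} {c : ℝ} (B : ContDiffBump c) (ν ε : ℝ) (x y : Euc N) : ℝ :=
  ‖y - x‖ ^ 2 * kerProfile B ν (tau ε x y)

/-- The concentrating part of the Laplacian of `kerK`, an approximate identity. -/
def kerM {N : ℕ} {c : ℝ} (B : ContDiffBump c) (ν ε : ℝ) (x y : Euc N) : ℝ :=
  4 * ν * (ν + 1) * ε ^ 2 * tau ε x y ^ (-ν - 2) * bumpInt B (tau ε x y ^ (-ν))

section Kernel

variable {N : ℕ} {c : ℝ} (B : ContDiffBump c) {ν ε : ℝ} {x y : Euc N}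

lemma tau_pos (hε : 0 < ε) (x y : Euc N) : 0 < tau ε x y := by
  unfold tau; positivity

lemma contDiff_normSq_sub (x : Euc N) : ContDiff ℝ ∞ fun y : Euc N => ‖y - x‖ ^ 2 :=
  (contDiff_id.sub contDiff_const).norm_sq ℝ

lemma contDiff_tau (ε : ℝ) (x : Euc N) : ContDiff ℝ ∞ (tau ε x) :=
  (contDiff_normSq_sub x).add contDiff_const

lemma contDiff_tau_rpow (hε : 0 < ε) (x : Euc N) (r : ℝ) :
    ContDiff ℝ ∞ fun y => tau ε x y ^ r :=
  (contDiff_tau ε x).rpow_const_of_ne fun y => (tau_pos hε x y).ne'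

lemma contDiff_kerK (hε : 0 < ε) (x : Euc N) : ContDiff ℝ ∞ (kerK B ν ε x) :=
  (contDiff_bumpIntInt B).comp (contDiff_tau_rpow hε x _)

lemma contDiff_kerM (hε : 0 < ε) (x : Euc N) : ContDiff ℝ ∞ (kerM B ν ε x) :=
  (contDiff_const.mul (contDiff_tau_rpow hε x _)).mul
    ((contDiff_bumpInt B).comp (contDiff_tau_rpow hε x _))

lemma contDiff_kerJ (hε : 0 < ε) (x : Euc N) : ContDiff ℝ ∞ (kerJ B ν ε x) :=
  (contDiff_normSq_sub x).mul ((contDiff_const.mul (contDiff_tau_rpow hε x _)).mul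
    (B.contDiff.comp (contDiff_tau_rpow hε x _)))

lemma pd_normSq_sub (i : Fin N) : pd i (fun y => ‖y - x‖ ^ 2) y = 2 * (y i - x i) := by
  have h : (fun y : Euc N => ‖y - x‖ ^ 2) = fun y : Euc N => ∑ j, (y j - x j) * (y j - x j) := by
    funext z
    rw [EuclideanSpace.norm_sq_eq]
    refine Finset.sum_congr rfl fun j _ => ?_
    simp [sq]
  have hd : ∀ j : Fin N, DifferentiableAt ℝ (fun y : Euc N => y j - x j) y := fun j => by
    fun_prop
  rw [h, pd_sum (F := fun j (y : Euc N) => (y j - x j) * (y j - x j)) _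
    fun j _ => (hd j).mul (hd j)]
  have : ∀ j : Fin N, pd i (fun y : Euc N => (y j - x j) * (y j - x j)) y
      = if i = j then 2 * (y i - x i) else 0 := by
    intro j
    rw [pd_mul (hd j) (hd j), pd_sub (by fun_prop) (by fun_prop), pd_coord]
    have : pd i (fun _ : Euc N => x j) y = 0 := by simp [pd]
    rw [this]
    split_ifs with hij
    · subst hij; ring
    · ring
  simp [this]

lemma pd_tau (i : Fin N) : pd i (tau ε x) y = 2 * (y i - x i) := by
  rw [← pd_normSq_sub]
  unfold tau
  rw [pd_add (((contDiff_normSq_sub x).differentiable (by simp)) y) (by fun_prop)]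
  simp [pd]

lemma sum_sub_sq (x y : Euc N) : ∑ i, (y i - x i) ^ 2 = ‖y - x‖ ^ 2 := by
  rw [EuclideanSpace.norm_sq_eq]; simp

lemma abs_sub_le_norm (x y : Euc N) (i : Fin N) : |y i - x i| ≤ ‖y - x‖ := by
  simpa using PiLp.norm_apply_le (y - x) i

lemma lap_radial {k k' : ℝ → ℝ} {k'' : ℝ} (hk : ∀ᶠ t in nhds (tau ε x y), HasDerivAt k (k' t) t)
    (hk' : HasDerivAt k' k'' (tau ε x y)) (hc : ContDiffAt ℝ 2 (fun y => k (tau ε x y)) y) :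
    lap (fun y => k (tau ε x y)) y = 2 * N * k' (tau ε x y) + 4 * ‖y - x‖ ^ 2 * k'' := by
  have hdt : ∀ z, DifferentiableAt ℝ (tau ε x) z := fun z =>
    (contDiff_tau ε x).differentiable (by simp) z
  have key : ∀ i : Fin N, pd i (pd i fun y => k (tau ε x y)) y
      = 2 * k' (tau ε x y) + 4 * (y i - x i) ^ 2 * k'' := by
    intro i
    have e : pd i (fun y => k (tau ε x y)) =ᶠ[nhds y]
        fun z => k' (tau ε x z) * (2 * (z i - x i)) := by
      have := (hdt y).continuousAt.eventually hk
      filter_upwards [this] with z hz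
      rw [pd_comp_of_hasDerivAt hz (hdt z), pd_tau]
    have hd' : DifferentiableAt ℝ (fun z => k' (tau ε x z)) y :=
      hk'.differentiableAt.comp y (hdt y)
    rw [e.pd_eq i, pd_mul hd' (by fun_prop),
      pd_comp_of_hasDerivAt hk' (hdt y), pd_tau, pd_const_mul _ (by fun_prop),
      pd_sub (by fun_prop) (by fun_prop), pd_coord]
    have : pd i (fun _ : Euc N => x i) y = 0 := by simp [pd]
    rw [this]
    simp
    ring
  rw [lap_eq_sum_pd hc, Finset.sum_congr rfl fun i _ => key i, Finset.sum_add_distrib,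
    ← Finset.sum_mul, ← Finset.sum_mul, ← Finset.mul_sum Finset.univ _ (4 : ℝ), sum_sub_sq,
    Finset.sum_const, Finset.card_univ, Fintype.card_fin, nsmul_eq_mul]
  ring

lemma lap_kerK (hN : (N : ℝ) = 2 * ν + 2) (hε : 0 < ε) :
    lap (kerK B ν ε x) y = kerJ B ν ε x y - kerM B ν ε x y := by
  have hτ := tau_pos hε x y
  have hk : ∀ t : ℝ, 0 < t → HasDerivAt (fun t => bumpIntInt B (t ^ (-ν)))
      (bumpInt B (t ^ (-ν)) * (-ν * t ^ (-ν - 1))) t := fun t ht =>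
    (hasDerivAt_bumpIntInt B _).comp t (Real.hasDerivAt_rpow_const (Or.inl ht.ne'))
  have hk' := ((hasDerivAt_bumpInt B (tau ε x y ^ (-ν))).comp (tau ε x y)
    (Real.hasDerivAt_rpow_const (p := -ν) (Or.inl hτ.ne'))).mul
      ((Real.hasDerivAt_rpow_const (p := -ν - 1) (Or.inl hτ.ne')).const_mul (-ν))
  have := lap_radial (ε := ε) (x := x) (y := y) (k := fun t => bumpIntInt B (t ^ (-ν)))
    (k' := fun t => bumpInt B (t ^ (-ν)) * (-ν * t ^ (-ν - 1)))
    (by filter_upwards [lt_mem_nhds hτ] with t ht using hk t ht) hk'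
    ((contDiff_kerK B hε x).contDiffAt.of_le (natCast_le_smooth 2))
  have e1 : tau ε x y ^ (-ν - 1) = tau ε x y ^ (-ν - 2) * tau ε x y := by
    rw [← Real.rpow_add_one hτ.ne']; ring_nf
  have e2 : tau ε x y ^ (-(2 * ν + 2)) = tau ε x y ^ (-ν - 1) * tau ε x y ^ (-ν - 1) := by
    rw [← Real.rpow_add hτ]; ring_nf
  have e3 : ‖y - x‖ ^ 2 = tau ε x y - ε ^ 2 := by unfold tau; ring
  unfold kerK kerJ kerM kerProfile
  rw [this, e2, e3, hN, show -ν - 1 - 1 = -ν - 2 by ring]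
  simp only [Function.comp]
  rw [e1]
  ring

lemma contDiffOn_kerProfile : ContDiffOn ℝ ∞ (kerProfile B ν) (Ioi 0) := by
  have h : ∀ r : ℝ, ContDiffOn ℝ ∞ (fun t : ℝ => t ^ r) (Ioi 0) := fun r =>
    contDiffOn_id.rpow_const_of_ne fun t ht => (mem_Ioi.mp ht).ne'
  exact (contDiffOn_const.mul (h _)).mul (B.contDiff.comp_contDiffOn (h _))

lemma kerProfile_nonneg {τ : ℝ} (h : 0 ≤ τ) : 0 ≤ kerProfile B ν τ :=
  mul_nonneg (by positivity) B.nonneg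

lemma rpow_neg_le_of_le {τ τ' r : ℝ} (h : 0 < τ) (hr : 0 ≤ r) (hτ : τ ≤ τ') :
    τ' ^ (-r) ≤ τ ^ (-r) :=
  Real.rpow_le_rpow_of_nonpos h hτ (by linarith)

lemma exists_bound_kerProfile (hν : 0 < ν) (hc : B.rOut < c) : ∃ C τ₁ : ℝ, 0 < C ∧ 0 < τ₁ ∧
    (∀ τ, 0 < τ → |kerProfile B ν τ| ≤ C ∧ |deriv (kerProfile B ν) τ| ≤ C) ∧
    (∀ τ, τ₁ < τ → kerProfile B ν τ = 0 ∧ deriv (kerProfile B ν) τ = 0) := by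
  have hc1 : 0 < c - B.rOut := by linarith
  have hc2 : 0 < c + B.rOut := by linarith [B.rOut_pos]
  set τ₁ := (c - B.rOut) ^ (-ν⁻¹) with hτ₁
  set τ₀ := (c + B.rOut) ^ (-ν⁻¹) with hτ₀
  have h0 : 0 < τ₀ := by positivity
  have h1 : 0 < τ₁ := by positivity
  have p1 : τ₁ ^ (-ν) = c - B.rOut := by
    rw [hτ₁, ← Real.rpow_mul hc1.le]; field_simp; simp
  have p0 : τ₀ ^ (-ν) = c + B.rOut := by
    rw [hτ₀, ← Real.rpow_mul hc2.le]; field_simp; simp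
  have z1 : ∀ τ, τ₁ ≤ τ → kerProfile B ν τ = 0 := fun τ h => by
    have := rpow_neg_le_of_le h1 hν.le h
    simp [kerProfile, bump_eq_zero_of_le B (p1 ▸ this)]
  have z0 : ∀ τ, 0 < τ → τ ≤ τ₀ → kerProfile B ν τ = 0 := fun τ hp h => by
    have := rpow_neg_le_of_le hp hν.le h
    simp [kerProfile, bump_eq_zero_of_ge B (p0 ▸ this)]
  have y1 : ∀ τ, τ₁ < τ → deriv (kerProfile B ν) τ = 0 := fun τ h => by
    have : kerProfile B ν =ᶠ[nhds τ] fun _ => 0 := by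
      filter_upwards [lt_mem_nhds h] with t ht using z1 t ht.le
    rw [this.deriv_eq]; simp
  have y0 : ∀ τ, 0 < τ → τ < τ₀ → deriv (kerProfile B ν) τ = 0 := fun τ hp h => by
    have : kerProfile B ν =ᶠ[nhds τ] fun _ => 0 := by
      filter_upwards [lt_mem_nhds hp, gt_mem_nhds h] with t ht ht' using z0 t ht ht'.le
    rw [this.deriv_eq]; simp
  have hsub : Icc τ₀ τ₁ ⊆ Ioi 0 := fun t ht => h0.trans_le ht.1
  obtain ⟨C₁, hC₁⟩ := isCompact_Icc.exists_bound_of_continuousOn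
    ((contDiffOn_kerProfile (ν := ν) B).continuousOn.mono hsub)
  obtain ⟨C₂, hC₂⟩ := isCompact_Icc.exists_bound_of_continuousOn
    (((contDiffOn_kerProfile (ν := ν) B).continuousOn_deriv_of_isOpen isOpen_Ioi
      (by simp)).mono hsub)
  refine ⟨max 1 (max C₁ C₂), τ₁, by positivity, h1, fun τ hτ => ?_,
    fun τ h => ⟨z1 τ h.le, y1 τ h⟩⟩
  have hp : (0 : ℝ) ≤ max 1 (max C₁ C₂) := by positivity
  rcases lt_or_ge τ τ₀ with h | h
  · simp [z0 τ hτ h.le, y0 τ hτ h]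
  rcases lt_or_ge τ₁ τ with h' | h'
  · simp [z1 τ h'.le, y1 τ h']
  · exact ⟨(hC₁ τ ⟨h, h'⟩).trans (by simp), (hC₂ τ ⟨h, h'⟩).trans (by simp)⟩

end Kernel

section KernelBounds

variable {N : ℕ} {c : ℝ} (B : ContDiffBump c) {ν ε ρ : ℝ} {x y : Euc N}

lemma tau_rpow_le (hν : 0 < ν) (hρ : 0 < ρ) (h : ρ ≤ ‖y - x‖) :
    tau ε x y ^ (-ν) ≤ (ρ ^ 2) ^ (-ν) := by
  refine rpow_neg_le_of_le (by positivity) hν.le ?_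
  unfold tau
  nlinarith [sq_nonneg ε]

lemma ker_eq_zero (hc : B.rOut < c) (hν : 0 < ν) (hρ : 0 < ρ)
    (hρc : (ρ ^ 2) ^ (-ν) ≤ c - B.rOut) (h : ρ ≤ ‖y - x‖) :
    kerK B ν ε x y = 0 ∧ kerJ B ν ε x y = 0 ∧ kerM B ν ε x y = 0 := by
  have h1 := (tau_rpow_le (ε := ε) hν hρ h).trans hρc
  simp [kerK, kerJ, kerM, kerProfile, bumpIntInt_eq_zero hc h1, bumpInt_eq_zero hc h1,
    bump_eq_zero_of_le B h1]

lemma tsupport_subset_closedBall {F : Euc N → ℝ} (h : ∀ y, ρ ≤ ‖y - x‖ → F y = 0) :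
    tsupport F ⊆ closedBall x ρ := by
  refine closure_minimal (fun y hy => ?_) isClosed_closedBall
  rw [mem_closedBall, dist_eq_norm]
  by_contra hlt
  exact hy (h y (not_le.mp hlt).le)

lemma kerK_nonneg (hc : B.rOut < c) : 0 ≤ kerK B ν ε x y := bumpIntInt_nonneg hc _

lemma kerJ_nonneg : 0 ≤ kerJ B ν ε x y :=
  mul_nonneg (by positivity) (kerProfile_nonneg B (by unfold tau; positivity))

lemma kerM_nonneg (hc : B.rOut < c) (hν : 0 < ν) : 0 ≤ kerM B ν ε x y :=
  mul_nonneg (mul_nonneg (by positivity) (Real.rpow_nonneg (by unfold tau; positivity) _))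
    (bumpInt_nonneg hc _)

lemma bumpInt_top_pos (hc : B.rOut < c) : 0 < bumpInt B (c + B.rOut) :=
  bumpInt_pos hc (by linarith [B.rOut_pos, B.rIn_pos])

lemma kerK_le (hc : B.rOut < c) (hν : 0 < ν) (hN : (N : ℝ) = 2 * ν + 2) (hy : y ≠ x) :
    kerK B ν ε x y ≤ bumpInt B (c + B.rOut) * ‖y - x‖ ^ (-((N : ℝ) - 2)) := by
  have hp : 0 < ‖y - x‖ := norm_pos_iff.mpr (sub_ne_zero.mpr hy)
  refine (bumpIntInt_le (Real.rpow_nonneg (by unfold tau; positivity) _)).trans ?_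
  refine mul_le_mul_of_nonneg_left ?_ (bumpInt_nonneg hc _)
  refine (tau_rpow_le hν hp le_rfl).trans (le_of_eq ?_)
  rw [← Real.rpow_natCast, ← Real.rpow_mul hp.le, hN]
  congr 1; push_cast; ring

lemma pd_kerK (hε : 0 < ε) (i : Fin N) : pd i (kerK B ν ε x) y =
    bumpInt B (tau ε x y ^ (-ν)) * (-ν * tau ε x y ^ (-ν - 1)) * (2 * (y i - x i)) := by
  rw [← pd_tau (ε := ε)]
  exact pd_comp_of_hasDerivAt (φ := fun t => bumpIntInt B (t ^ (-ν)))
    ((hasDerivAt_bumpIntInt B _).comp _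
      (Real.hasDerivAt_rpow_const (p := -ν) (Or.inl (tau_pos hε x y).ne')))
    ((contDiff_tau ε x).differentiable (by simp) y) i

lemma abs_pd_kerK_le (hc : B.rOut < c) (hν : 0 < ν) (hN : (N : ℝ) = 2 * ν + 2) (hε : 0 < ε)
    (hy : y ≠ x) (i : Fin N) : |pd i (kerK B ν ε x) y| ≤
      2 * ν * bumpInt B (c + B.rOut) * ‖y - x‖ ^ (-((N : ℝ) - 1)) := by
  have hp : 0 < ‖y - x‖ := norm_pos_iff.mpr (sub_ne_zero.mpr hy)
  have h1 : tau ε x y ^ (-ν - 1) ≤ ‖y - x‖ ^ (-(N : ℝ)) := by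
    have := tau_rpow_le (ε := ε) (x := x) (y := y) (ν := ν + 1) (by linarith) hp le_rfl
    rw [show -ν - 1 = -(ν + 1) by ring]
    refine this.trans (le_of_eq ?_)
    rw [← Real.rpow_natCast, ← Real.rpow_mul hp.le, hN]
    congr 1; push_cast; ring
  have h2 : ‖y - x‖ ^ (-((N : ℝ) - 1)) = ‖y - x‖ ^ (-(N : ℝ)) * ‖y - x‖ := by
    rw [← Real.rpow_add_one hp.ne']; ring_nf
  rw [pd_kerK B hε, abs_mul, abs_mul, abs_mul, abs_mul, abs_neg, abs_of_pos hν, abs_two,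
    abs_of_nonneg (bumpInt_nonneg hc (tau ε x y ^ (-ν))),
    abs_of_nonneg (Real.rpow_nonneg (tau_pos hε x y).le _), h2]
  have h3 := abs_sub_le_norm x y i
  have h4 := bumpInt_le (B := B) (tau ε x y ^ (-ν))
  have h5 := bumpInt_nonneg hc (tau ε x y ^ (-ν))
  have h6 := Real.rpow_nonneg (tau_pos hε x y).le (-ν - 1)
  have h7 := h5.trans h4
  calc _ = bumpInt B (tau ε x y ^ (-ν)) * tau ε x y ^ (-ν - 1) * |y i - x i| * (2 * ν) := by ring
    _ ≤ bumpInt B (c + B.rOut) * ‖y - x‖ ^ (-(N : ℝ)) * ‖y - x‖ * (2 * ν) := by gcongr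
    _ = _ := by ring

lemma hasDerivAt_kerProfile {τ : ℝ} (h : 0 < τ) :
    HasDerivAt (kerProfile B ν) (deriv (kerProfile B ν) τ) τ :=
  (((contDiffOn_kerProfile B).contDiffAt (Ioi_mem_nhds h)).differentiableAt (by simp)).hasDerivAt

lemma exists_bound_kerJ (hν : 0 < ν) (hc : B.rOut < c) : ∃ C : ℝ, 0 < C ∧
    ∀ ε, 0 < ε → ∀ (x y : Euc N), |kerJ B ν ε x y| ≤ C ∧ ∀ i, |pd i (kerJ B ν ε x) y| ≤ C := by
  obtain ⟨C, τ₁, hC, hτ, hb, hz⟩ := exists_bound_kerProfile B hν hc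
  refine ⟨2 * (1 + τ₁) ^ 2 * C, by positivity, fun ε hε x y => ?_⟩
  have hd : DifferentiableAt ℝ (fun z => kerProfile B ν (tau ε x z)) y :=
    (hasDerivAt_kerProfile B (tau_pos hε x y)).differentiableAt.comp y
      ((contDiff_tau ε x).differentiable (by simp) y)
  have hpd : ∀ i, pd i (kerJ B ν ε x) y = ‖y - x‖ ^ 2 * (deriv (kerProfile B ν) (tau ε x y) *
      (2 * (y i - x i))) + kerProfile B ν (tau ε x y) * (2 * (y i - x i)) := by
    intro i
    have := pd_mul (((contDiff_normSq_sub x).differentiable (by simp)) y) hd i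
    rw [pd_normSq_sub, pd_comp_of_hasDerivAt (hasDerivAt_kerProfile B (tau_pos hε x y))
      ((contDiff_tau ε x).differentiable (by simp) y), pd_tau] at this
    exact this
  rcases lt_or_ge τ₁ (tau ε x y) with h | h
  · obtain ⟨h1, h2⟩ := hz _ h
    have h0 : 0 ≤ 2 * (1 + τ₁) ^ 2 * C := by positivity
    simp [kerJ, hpd, h1, h2, h0]
  · obtain ⟨h1, h2⟩ := hb _ (tau_pos hε x y)
    have hn : ‖y - x‖ ^ 2 ≤ τ₁ := le_trans (by unfold tau; nlinarith [sq_nonneg ε]) h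
    have hn1 : ‖y - x‖ ≤ 1 + τ₁ := by nlinarith [sq_nonneg (‖y - x‖ - 1)]
    constructor
    · rw [kerJ, abs_mul, abs_of_nonneg (by positivity)]
      calc _ ≤ τ₁ * C := by gcongr
        _ ≤ _ := by nlinarith [mul_pos hτ hC]
    · intro i
      have h3 := (abs_sub_le_norm x y i).trans hn1
      rw [hpd]
      refine (abs_add_le _ _).trans ?_
      rw [abs_mul, abs_mul, abs_mul, abs_mul, abs_mul, abs_two, abs_of_nonneg (sq_nonneg ‖y - x‖)]
      calc _ ≤ τ₁ * (C * (2 * (1 + τ₁))) + C * (2 * (1 + τ₁)) := by gcongr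
        _ = _ := by ring

lemma kerM_scaled (hN : (N : ℝ) = 2 * ν + 2) (hε : 0 < ε) (x z : Euc N) :
    ε ^ N * kerM B ν ε x (x + ε • z) = 4 * ν * (ν + 1) * (1 + ‖z‖ ^ 2) ^ (-ν - 2) *
      bumpInt B ((ε ^ 2 * (1 + ‖z‖ ^ 2)) ^ (-ν)) := by
  have ht : tau ε x (x + ε • z) = ε ^ 2 * (1 + ‖z‖ ^ 2) := by
    simp [tau, norm_smul, mul_pow]; ring
  rw [kerM, ht, Real.mul_rpow (x := ε ^ 2) (z := -ν - 2) (by positivity) (by positivity)]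
  have : ε ^ N * ε ^ 2 * (ε ^ 2) ^ (-ν - 2) = 1 := by
    rw [← Real.rpow_natCast, ← Real.rpow_natCast ε 2, ← Real.rpow_mul hε.le, ← Real.rpow_add hε,
      ← Real.rpow_add hε, hN, ← Real.rpow_zero ε]
    congr 1; push_cast; ring
  linear_combination (4 * ν * (ν + 1) * (1 + ‖z‖ ^ 2) ^ (-ν - 2) *
      bumpInt B ((ε ^ 2 * (1 + ‖z‖ ^ 2)) ^ (-ν))) * this

lemma integrable_profileM (hN : (N : ℝ) = 2 * ν + 2) :
    Integrable fun z : Euc N => 4 * ν * (ν + 1) * (1 + ‖z‖ ^ 2) ^ (-ν - 2) := by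
  refine Integrable.const_mul ?_ _
  have := integrable_rpow_neg_one_add_norm_sq (E := Euc N) (μ := volume) (r := 2 * (ν + 2))
    (by simp [hN]; linarith)
  refine this.congr (Filter.Eventually.of_forall fun z => ?_)
  simp only
  congr 1; ring

/-- The mass of the limit of the approximate identity `kerM`. -/
def kerMass (N : ℕ) {c : ℝ} (B : ContDiffBump c) (ν : ℝ) : ℝ :=
  ∫ z : Euc N, 4 * ν * (ν + 1) * (1 + ‖z‖ ^ 2) ^ (-ν - 2) * bumpInt B (c + B.rOut)

lemma kerMass_pos (hc : B.rOut < c) (hν : 0 < ν) (hN : (N : ℝ) = 2 * ν + 2) :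
    0 < kerMass N B ν := by
  have hpos : ∀ z : Euc N, 0 < 4 * ν * (ν + 1) * (1 + ‖z‖ ^ 2) ^ (-ν - 2) *
      bumpInt B (c + B.rOut) := fun z => by
    have := bumpInt_top_pos B hc
    positivity
  rw [kerMass, integral_pos_iff_support_of_nonneg (fun z => (hpos z).le)
    ((integrable_profileM hN).mul_const _)]
  have : Function.support (fun z : Euc N => 4 * ν * (ν + 1) * (1 + ‖z‖ ^ 2) ^ (-ν - 2) *
      bumpInt B (c + B.rOut)) = univ := by
    ext z; simpa using (hpos z).ne'
  rw [this]
  exact isOpen_univ.measure_pos _ univ_nonempty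

lemma tendsto_integral_kerM (hc : B.rOut < c) (hν : 0 < ν) (hN : (N : ℝ) = 2 * ν + 2)
    {w : Euc N → ℝ} {C : ℝ} (hw : ∀ y, |w y| ≤ C) (hm : Measurable w)
    (hx : ContinuousAt w x) :
    Filter.Tendsto (fun ε => ∫ y, kerM B ν ε x y * w y) (nhdsWithin 0 (Ioi 0))
      (nhds (kerMass N B ν * w x)) := by
  have hC : 0 ≤ C := (abs_nonneg _).trans (hw 0)
  have e1 : ∀ ε : ℝ, 0 < ε → ∫ y, kerM B ν ε x y * w y =
      ∫ z : Euc N, 4 * ν * (ν + 1) * (1 + ‖z‖ ^ 2) ^ (-ν - 2) *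
        bumpInt B ((ε ^ 2 * (1 + ‖z‖ ^ 2)) ^ (-ν)) * w (x + ε • z) := by
    intro ε hε
    have h1 := integral_add_left_eq_self (μ := (volume : Measure (Euc N)))
      (fun y => kerM B ν ε x y * w y) x
    have h2 := Measure.integral_comp_smul_of_nonneg (μ := (volume : Measure (Euc N)))
      (fun z => kerM B ν ε x (x + z) * w (x + z)) ε (hR := hε.le)
    have h3 : ∫ z, kerM B ν ε x (x + z) * w (x + z) =
        ε ^ N * ∫ z, kerM B ν ε x (x + ε • z) * w (x + ε • z) := by
      rw [h2]
      simp only [finrank_euclideanSpace, Fintype.card_fin, smul_eq_mul]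
      rw [mul_inv_cancel_left₀ (by positivity)]
    rw [← h1, h3, ← integral_const_mul]
    refine integral_congr_ae (Filter.Eventually.of_forall fun z => ?_)
    simp only
    rw [← mul_assoc, kerM_scaled B hN hε]
  have e2 : Filter.Tendsto (fun ε : ℝ => ∫ z : Euc N, 4 * ν * (ν + 1) * (1 + ‖z‖ ^ 2) ^ (-ν - 2) *
        bumpInt B ((ε ^ 2 * (1 + ‖z‖ ^ 2)) ^ (-ν)) * w (x + ε • z)) (nhdsWithin 0 (Ioi 0))
      (nhds (∫ z : Euc N, 4 * ν * (ν + 1) * (1 + ‖z‖ ^ 2) ^ (-ν - 2) *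
        bumpInt B (c + B.rOut) * w x)) := by
    refine tendsto_integral_filter_of_dominated_convergence
      (fun z => 4 * ν * (ν + 1) * (1 + ‖z‖ ^ 2) ^ (-ν - 2) * (bumpInt B (c + B.rOut) * C))
      ?_ ?_ ((integrable_profileM hN).mul_const _) ?_
    · refine Filter.Eventually.of_forall fun ε => Measurable.aestronglyMeasurable ?_
      have := (continuous_bumpInt B).measurable
      fun_prop
    · filter_upwards [self_mem_nhdsWithin] with ε hε
      refine Filter.Eventually.of_forall fun z => ?_
      have := bumpInt_nonneg hc ((ε ^ 2 * (1 + ‖z‖ ^ 2)) ^ (-ν))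
      rw [Real.norm_eq_abs, abs_mul, abs_of_nonneg (by positivity), mul_assoc]
      gcongr
      · exact bumpInt_nonneg hc _
      · exact bumpInt_le _
      · exact hw _
    · refine Filter.Eventually.of_forall fun z => ?_
      have h1 : Filter.Tendsto (fun ε : ℝ => x + ε • z) (nhdsWithin 0 (Ioi 0)) (nhds x) := by
        have : Continuous fun ε : ℝ => x + ε • z := by fun_prop
        simpa using (this.tendsto 0).mono_left nhdsWithin_le_nhds
      refine Filter.Tendsto.mul (Filter.Tendsto.mul tendsto_const_nhds ?_) (hx.tendsto.comp h1)
      refine tendsto_const_nhds.congr' ?_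
      have h2 : Filter.Tendsto (fun ε : ℝ => ε ^ 2 * (1 + ‖z‖ ^ 2)) (nhdsWithin 0 (Ioi 0))
          (nhdsWithin 0 (Ioi 0)) := by
        refine tendsto_nhdsWithin_of_tendsto_nhds_of_eventually_within _ ?_ ?_
        · have : Continuous fun ε : ℝ => ε ^ 2 * (1 + ‖z‖ ^ 2) := by fun_prop
          simpa using (this.tendsto 0).mono_left nhdsWithin_le_nhds
        · filter_upwards [self_mem_nhdsWithin] with ε hε
          have : 0 < ε := hε
          exact mem_Ioi.mpr (by positivity)
      have h3 := (tendsto_rpow_neg_nhdsGT_zero (y := -ν) (by linarith)).comp h2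
      filter_upwards [h3.eventually_ge_atTop (c + B.rOut)] with ε hε
      exact (bumpInt_eq_of_ge hε).symm
  rw [integral_mul_const] at e2
  refine e2.congr' ?_
  filter_upwards [self_mem_nhdsWithin] with ε hε using (e1 ε hε).symm

end KernelBounds

open scoped ENNReal NNReal

section Representation

variable {N : ℕ} {c : ℝ} (B : ContDiffBump c) {ν ε ρ : ℝ} {x y : Euc N} {U : Euc N → ℝ}

lemma integrable_mul_of_tsupport {f g : Euc N → ℝ} (hg : Continuous g) (hc : HasCompactSupport g)
    (hf : ∀ x ∈ tsupport g, ContinuousAt f x) : Integrable fun x => f x * g x := by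
  have hs : tsupport (fun x => f x * g x) ⊆ tsupport g :=
    closure_mono fun x hx => by
      simp only [Function.mem_support] at hx ⊢
      exact right_ne_zero_of_mul hx
  exact (continuous_of_contDiffAt_tsupport fun x hx =>
    (hf x (hs hx)).mul hg.continuousAt).integrable_of_hasCompactSupport (hc.mono' (by
      exact subset_closure.trans hs))

lemma hasCompactSupport_of_eq_zero {F : Euc N → ℝ} (h : ∀ y, ρ ≤ ‖y - x‖ → F y = 0) :
    HasCompactSupport F :=
  (isCompact_closedBall x ρ).of_isClosed_subset (isClosed_tsupport F)
    (tsupport_subset_closedBall h)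

lemma pd_eq_zero_of_eq_zero {F : Euc N → ℝ} {ρ' : ℝ} (hρ : ρ < ρ')
    (h : ∀ y, ρ ≤ ‖y - x‖ → F y = 0) (hy : ρ' ≤ ‖y - x‖) (i : Fin N) : pd i F y = 0 := by
  have : F =ᶠ[nhds y] fun _ => 0 := by
    have hcont : Continuous fun z : Euc N => ‖z - x‖ := by fun_prop
    filter_upwards [hcont.continuousAt.eventually (lt_mem_nhds (hρ.trans_le hy))] with z hz
      using h z hz.le
  rw [this.pd_eq i, pd_zero]

lemma integral_kerM_mul (hc : B.rOut < c) (hν : 0 < ν) (hN : (N : ℝ) = 2 * ν + 2) (hε : 0 < ε)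
    (hρ : 0 < ρ) (hρc : (ρ ^ 2) ^ (-ν) ≤ c - B.rOut)
    (hU : ∀ y ∈ closedBall x ρ, ContDiffAt ℝ 2 U y) :
    ∫ y, U y * kerM B ν ε x y =
      (∫ y, U y * kerJ B ν ε x y) - ∫ y, lap U y * kerK B ν ε x y := by
  have z := fun y => ker_eq_zero (ε := ε) (x := x) (y := y) B hc hν hρ hρc
  have zK := fun y h => (z y h).1
  have zJ := fun y h => (z y h).2.1
  have zM := fun y h => (z y h).2.2
  have h := integral_mul_lap (f := U) ((contDiff_kerK (ν := ν) B hε x).of_le (natCast_le_smooth 2))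
    (hasCompactSupport_of_eq_zero zK) fun y hy => hU y (tsupport_subset_closedBall zK hy)
  have hJ := integrable_mul_of_tsupport (f := U) (contDiff_kerJ (ν := ν) B hε x).continuous
    (hasCompactSupport_of_eq_zero zJ)
    fun y hy => (hU y (tsupport_subset_closedBall zJ hy)).continuousAt
  have hM := integrable_mul_of_tsupport (f := U) (contDiff_kerM (ν := ν) B hε x).continuous
    (hasCompactSupport_of_eq_zero zM)
    fun y hy => (hU y (tsupport_subset_closedBall zM hy)).continuousAt
  rw [← h]
  simp_rw [lap_kerK B hN hε, mul_sub]
  rw [integral_sub hJ hM]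
  ring

lemma integral_kerM_mul_pd (hc : B.rOut < c) (hν : 0 < ν) (hN : (N : ℝ) = 2 * ν + 2) (hε : 0 < ε)
    (hρ : 0 < ρ) (hρc : (ρ ^ 2) ^ (-ν) ≤ c - B.rOut)
    (hU : ∀ y ∈ closedBall x ρ, ContDiffAt ℝ 2 U y) (i : Fin N) :
    ∫ y, pd i U y * kerM B ν ε x y =
      - (∫ y, U y * pd i (kerJ B ν ε x) y) + ∫ y, lap U y * pd i (kerK B ν ε x) y := by
  have z := fun y => ker_eq_zero (ε := ε) (x := x) (y := y) B hc hν hρ hρc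
  have zK := fun y h => (z y h).1
  have zJ := fun y h => (z y h).2.1
  have zM := fun y h => (z y h).2.2
  have cK := hasCompactSupport_of_eq_zero zK
  have cJ := hasCompactSupport_of_eq_zero zJ
  have cM := hasCompactSupport_of_eq_zero zM
  have sK := contDiff_kerK (ν := ν) B hε x
  have sJ := contDiff_kerJ (ν := ν) B hε x
  have sM := contDiff_kerM (ν := ν) B hε x
  have cpd : ∀ F : Euc N → ℝ, HasCompactSupport F → HasCompactSupport (pd i F) := fun F hF =>
    hF.of_isClosed_subset (isClosed_tsupport _) (tsupport_pd_subset i)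
  have spd : ∀ F : Euc N → ℝ, ContDiff ℝ ∞ F → ContDiff ℝ ∞ (pd i F) := fun F hF =>
    contDiff_iff_contDiffAt.mpr fun y => hF.contDiffAt.pd_left (by simp) i
  have h1 := integral_mul_lap (f := U) ((spd _ sK).of_le (natCast_le_smooth 2)) (cpd _ cK)
    fun y hy => hU y (tsupport_subset_closedBall zK (tsupport_pd_subset i hy))
  have h2 := integral_mul_pd (f := U) (sM.of_le (natCast_le_smooth 1)) cM
    (fun y hy => (hU y (tsupport_subset_closedBall zM hy)).of_le (by norm_num)) i
  have hJ := integrable_mul_of_tsupport (f := U) (spd _ sJ).continuous (cpd _ cJ)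
    fun y hy => (hU y (tsupport_subset_closedBall zJ (tsupport_pd_subset i hy))).continuousAt
  have hM := integrable_mul_of_tsupport (f := U) (spd _ sM).continuous (cpd _ cM)
    fun y hy => (hU y (tsupport_subset_closedBall zM (tsupport_pd_subset i hy))).continuousAt
  have e : ∀ y, lap (pd i (kerK B ν ε x)) y =
      pd i (kerJ B ν ε x) y - pd i (kerM B ν ε x) y := by
    intro y
    rw [lap_pd (sK.contDiffAt.of_le (natCast_le_smooth 3)),
      ← pd_sub (sJ.differentiable (by simp) y) (sM.differentiable (by simp) y)]
    congr 1
    funext w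
    exact lap_kerK B hN hε
  simp_rw [e, mul_sub] at h1
  rw [integral_sub hJ hM] at h1
  rw [← h1, h2]
  ring

lemma measurable_indicator_of_continuousOn {w : Euc N → ℝ} {S : Set (Euc N)}
    (hw : ContinuousOn w S) (hS : MeasurableSet S) : Measurable (S.indicator w) := by
  classical
  rw [← piecewise_eq_indicator]
  exact hw.measurable_piecewise continuousOn_const hS

lemma tendsto_integral_kerM_of_continuousOn (hc : B.rOut < c) (hν : 0 < ν)
    (hN : (N : ℝ) = 2 * ν + 2) (hρ : 0 < ρ) (hρc : (ρ ^ 2) ^ (-ν) ≤ c - B.rOut)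
    {w : Euc N → ℝ} (hw : ContinuousOn w (closedBall x ρ)) :
    Filter.Tendsto (fun ε => ∫ y, w y * kerM B ν ε x y) (nhdsWithin 0 (Ioi 0))
      (nhds (kerMass N B ν * w x)) := by
  obtain ⟨C, hC⟩ := (isCompact_closedBall x ρ).exists_bound_of_continuousOn hw
  have hC0 : 0 ≤ C := (norm_nonneg _).trans (hC x (mem_closedBall_self hρ.le))
  have hx : ContinuousAt ((closedBall x ρ).indicator w) x := by
    refine (hw.continuousAt (closedBall_mem_nhds x hρ)).congr ?_
    filter_upwards [closedBall_mem_nhds x hρ] with y hy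
    rw [indicator_of_mem hy]
  have := tendsto_integral_kerM B hc hν hN (w := (closedBall x ρ).indicator w) (C := C)
    (fun y => by
      by_cases hy : y ∈ closedBall x ρ
      · rw [indicator_of_mem hy]; exact hC y hy
      · rw [indicator_of_notMem hy]; simpa using hC0)
    (measurable_indicator_of_continuousOn hw measurableSet_closedBall) hx
  rw [indicator_of_mem (mem_closedBall_self hρ.le)] at this
  refine this.congr fun ε => integral_congr_ae (Filter.Eventually.of_forall fun y => ?_)
  by_cases hy : y ∈ closedBall x ρ
  · simp only [indicator_of_mem hy]; ring
  · have h : ρ ≤ ‖y - x‖ := by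
      rw [mem_closedBall, dist_eq_norm] at hy; exact (not_le.mp hy).le
    simp [(ker_eq_zero (ε := ε) B hc hν hρ hρc h).2.2]

lemma enorm_integral_mul_le {f k : Euc N → ℝ} {C : ℝ≥0} {g : Euc N → ℝ≥0∞}
    (hk0 : ∀ y, ρ ≤ ‖y - x‖ → k y = 0)
    (hk : ∀ y, y ≠ x → ‖k y‖ₑ ≤ C * g y) (hx : 0 < N) :
    ‖∫ y, f y * k y‖ₑ ≤ C * ∫⁻ y in ball x ρ, g y * ‖f y‖ₑ := by
  have : Nontrivial (Euc N) := by
    have : Nonempty (Fin N) := ⟨⟨0, hx⟩⟩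
    infer_instance
  refine (enorm_integral_le_lintegral_enorm _).trans ?_
  rw [← lintegral_const_mul' _ _ ENNReal.coe_ne_top, ← lintegral_indicator measurableSet_ball]
  refine lintegral_mono_ae ?_
  have : ∀ᵐ y : Euc N, y ≠ x := by
    simp [ae_iff]
  filter_upwards [this] with y hy
  by_cases h : y ∈ ball x ρ
  · rw [indicator_of_mem h, enorm_mul, ← mul_assoc, mul_comm]
    gcongr
    exact hk y hy
  · rw [indicator_of_notMem h, hk0 y (by simpa [dist_eq_norm] using h)]
    simp

lemma enorm_rpow_neg {r : ℝ} {z : Euc N} (hz : z ≠ 0) :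
    ENNReal.ofReal (‖z‖ ^ r) = ‖z‖ₑ ^ r := by
  rw [← ofReal_norm, ENNReal.ofReal_rpow_of_pos (norm_pos_iff.mpr hz)]

theorem exists_potential_upper (hN : 3 ≤ N) (hρ : 0 < ρ) :
    ∃ C : ℝ≥0, ∀ (x : Euc N) (U : Euc N → ℝ), (∀ y ∈ closedBall x ρ, ContDiffAt ℝ 2 U y) →
      ‖U x‖ₑ ≤ C * ((∫⁻ y in ball x ρ, ‖y - x‖ₑ ^ (-((N : ℝ) - 2)) * ‖lap U y‖ₑ) +
        ∫⁻ y in ball x ρ, ‖U y‖ₑ) ∧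
      ∀ i, ‖pd i U x‖ₑ ≤ C * ((∫⁻ y in ball x ρ, ‖y - x‖ₑ ^ (-((N : ℝ) - 1)) * ‖lap U y‖ₑ) +
        ∫⁻ y in ball x ρ, ‖U y‖ₑ) := by
  have hN' : (3 : ℝ) ≤ N := by exact_mod_cast hN
  set ν : ℝ := ((N : ℝ) - 2) / 2 with hν'
  have hν : 0 < ν := by rw [hν']; linarith
  have hNν : (N : ℝ) = 2 * ν + 2 := by rw [hν']; ring
  have hρ2 : 0 < ρ / 2 := half_pos hρ
  set A := ((ρ / 2) ^ 2) ^ (-ν) with hA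
  have hA0 : 0 < A := by positivity
  let B : ContDiffBump (2 * A) := ⟨A / 2, A, by positivity, by linarith⟩
  have hc : B.rOut < 2 * A := by change A < 2 * A; linarith
  have hρc : ((ρ / 2) ^ 2) ^ (-ν) ≤ 2 * A - B.rOut := by change A ≤ 2 * A - A; linarith
  obtain ⟨CJ, hCJ, hJ⟩ := exists_bound_kerJ (N := N) B hν hc
  set T := bumpInt B (2 * A + B.rOut)
  have hT : 0 < T := bumpInt_top_pos B hc
  set κ := kerMass N B ν with hκ
  have hκ0 : 0 < κ := kerMass_pos B hc hν hNν
  set D : ℝ≥0 := (T + 2 * ν * T + CJ).toNNReal with hD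
  have hDr : ∀ r : ℝ, r ≤ T + 2 * ν * T + CJ → ENNReal.ofReal r ≤ D := fun r hr => by
    rw [hD]; exact ENNReal.ofReal_le_ofReal hr
  have hTν : 0 < ν * T := by positivity
  have z := fun (x : Euc N) ε y (h : ρ ≤ ‖y - x‖) =>
    ker_eq_zero (ε := ε) (x := x) (y := y) B hc hν hρ2 hρc (by linarith)
  have hsub : ∀ x : Euc N, closedBall x (ρ / 2) ⊆ closedBall x ρ := fun x =>
    closedBall_subset_closedBall (by linarith)
  have lim : ∀ (x : Euc N) (w : Euc N → ℝ), ContinuousOn w (closedBall x ρ) → ∀ R : ℝ≥0∞,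
      (∀ ε, 0 < ε → ‖∫ y, w y * kerM B ν ε x y‖ₑ ≤ D * R) →
      ‖w x‖ₑ ≤ ((D / κ.toNNReal : ℝ≥0) : ℝ≥0∞) * R := by
    intro x w hw R h
    have h1 := (tendsto_integral_kerM_of_continuousOn B hc hν hNν hρ2 hρc (hw.mono (hsub x))).enorm
    have h2 : ‖κ * w x‖ₑ ≤ D * R := le_of_tendsto h1 (by
      filter_upwards [self_mem_nhdsWithin] with ε hε using h ε hε)
    rw [enorm_mul, Real.enorm_of_nonneg hκ0.le] at h2
    have hk : (κ.toNNReal : ℝ≥0∞) ≠ 0 := by simpa using hκ0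
    rw [ENNReal.coe_div (by simpa using hκ0), ENNReal.div_eq_inv_mul, mul_assoc]
    calc ‖w x‖ₑ = (κ.toNNReal : ℝ≥0∞)⁻¹ * (κ.toNNReal * ‖w x‖ₑ) := by
          rw [← mul_assoc, ENNReal.inv_mul_cancel hk ENNReal.coe_ne_top, one_mul]
      _ ≤ (κ.toNNReal : ℝ≥0∞)⁻¹ * (D * R) := mul_le_mul_right h2 _
  refine ⟨D / κ.toNNReal, fun x U hU => ⟨?_, fun i => ?_⟩⟩
  · refine lim x U (fun y hy => (hU y hy).continuousAt.continuousWithinAt) _ fun ε hε => ?_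
    rw [integral_kerM_mul B hc hν hNν hε hρ2 hρc fun y hy => hU y (hsub x hy), add_comm, mul_add]
    refine (enorm_sub_le).trans (add_le_add ?_ ?_)
    · have := enorm_integral_mul_le (f := U) (k := kerJ B ν ε x) (C := D) (g := fun _ => 1)
        (fun y h => (z x ε y h).2.1) (fun y _ => ?_) (by omega)
      · simpa using this
      · rw [mul_one, ← ofReal_norm]
        exact hDr _ (((hJ ε hε x y).1).trans (by linarith))
    · refine enorm_integral_mul_le (fun y h => (z x ε y h).1) (fun y hy => ?_) (by omega)
      rw [← enorm_rpow_neg (sub_ne_zero.mpr hy), Real.enorm_of_nonneg (kerK_nonneg B hc)]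
      refine (ENNReal.ofReal_le_ofReal (kerK_le B hc hν hNν hy)).trans ?_
      rw [ENNReal.ofReal_mul hT.le]
      gcongr
      exact hDr _ (by linarith)
  · refine lim x (pd i U) (fun y hy => ((hU y hy).pd_left (m := 1)
      (by norm_num) i).continuousAt.continuousWithinAt) _ fun ε hε => ?_
    rw [integral_kerM_mul_pd B hc hν hNν hε hρ2 hρc fun y hy => hU y (hsub x hy), add_comm (lintegral _ _), mul_add]
    refine (enorm_add_le _ _).trans (add_le_add ?_ ?_)
    · rw [enorm_neg]
      have := enorm_integral_mul_le (ρ := ρ) (x := x) (f := U) (k := pd i (kerJ B ν ε x)) (C := D)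
        (g := fun _ => 1)
        (fun y h => pd_eq_zero_of_eq_zero (ρ := ρ / 2) (by linarith) (fun y h => (ker_eq_zero B hc hν hρ2 hρc
          h).2.1) h i) (fun y _ => ?_) (by omega)
      · simpa using this
      · rw [mul_one, ← ofReal_norm]
        exact hDr _ (((hJ ε hε x y).2 i).trans (by linarith))
    · refine enorm_integral_mul_le (fun y h => pd_eq_zero_of_eq_zero (ρ := ρ / 2) (by linarith) (fun y h =>
        (ker_eq_zero B hc hν hρ2 hρc h).1) h i) (fun y hy => ?_) (by omega)
      rw [← enorm_rpow_neg (sub_ne_zero.mpr hy), ← ofReal_norm]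
      refine (ENNReal.ofReal_le_ofReal (abs_pd_kerK_le B hc hν hNν hε hy i)).trans ?_
      rw [ENNReal.ofReal_mul (by positivity)]
      gcongr
      exact hDr _ (by linarith)

end Representation

section Dilation

variable {N : ℕ} {f : Euc N → ℝ} {x : Euc N}

lemma pd_comp_smul (c : ℝ) (i : Fin N) :
    pd i (fun y => f (c • y)) x = c * pd i f (c • x) := by
  simp [pd, fderiv_comp_smul]

lemma contDiffAt_comp_smul {n : WithTop ℕ∞} {c : ℝ} (hf : ContDiffAt ℝ n f (c • x)) :
    ContDiffAt ℝ n (fun y => f (c • y)) x :=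
  ContDiffAt.comp (g := f) x hf (contDiff_const_smul c).contDiffAt

lemma lap_const_mul (c : ℝ) (hf : ContDiffAt ℝ 2 f x) :
    lap (fun y => c * f y) x = c * lap f x := by
  rw [lap_eq_sum_pd (contDiffAt_const.mul hf), lap_eq_sum_pd hf, Finset.mul_sum]
  refine Finset.sum_congr rfl fun i _ => ?_
  have : pd i (fun y => c * f y) =ᶠ[nhds x] fun y => c * pd i f y := by
    filter_upwards [hf.eventually (by simp)] with y hy
      using pd_const_mul c (hy.differentiableAt (by simp)) i
  rw [this.pd_eq i, pd_const_mul c ((hf.pd_left (m := 1) (by norm_num) i).differentiableAt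
    (by simp))]

lemma lap_comp_smul (c : ℝ) (hf : ContDiffAt ℝ 2 f (c • x)) :
    lap (fun y => f (c • y)) x = c ^ 2 * lap f (c • x) := by
  rw [lap_eq_sum_pd (contDiffAt_comp_smul hf), lap_eq_sum_pd hf, Finset.mul_sum]
  refine Finset.sum_congr rfl fun i _ => ?_
  have e : pd i (fun y => f (c • y)) = fun y => c * pd i f (c • y) := by
    funext y; exact pd_comp_smul c i
  rw [e, pd_const_mul c, pd_comp_smul]
  · ring
  · exact (contDiffAt_comp_smul (hf.pd_left (m := 1) (by norm_num) i)).differentiableAt (by simp)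

end Dilation

/-- A smooth function vanishing on the ball of radius `δ` and equal to `1` outside the ball of
radius `2δ`. -/
def cutoff (N : ℕ) (δ : ℝ) (y : Euc N) : ℝ :=
  1 - (⟨1, 2, one_pos, one_lt_two⟩ : ContDiffBump (0 : Euc N)) (δ⁻¹ • y)

section Cutoff

variable {N : ℕ} {δ : ℝ} {y : Euc N}

lemma contDiff_cutoff (δ : ℝ) : ContDiff ℝ ∞ (cutoff N δ) :=
  contDiff_const.sub ((ContDiffBump.contDiff _).comp (contDiff_const_smul δ⁻¹))

lemma cutoff_nonneg : 0 ≤ cutoff N δ y := sub_nonneg.mpr (ContDiffBump.le_one _)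

lemma cutoff_le_one : cutoff N δ y ≤ 1 := by
  have := (⟨1, 2, one_pos, one_lt_two⟩ : ContDiffBump (0 : Euc N)).nonneg (x := δ⁻¹ • y)
  rw [cutoff]; linarith

lemma cutoff_eq_zero (hδ : 0 < δ) (h : ‖y‖ ≤ δ) : cutoff N δ y = 0 := by
  rw [cutoff, ContDiffBump.one_of_mem_closedBall, sub_self]
  rw [mem_closedBall_zero_iff, norm_smul, norm_inv, Real.norm_of_nonneg hδ.le]
  change δ⁻¹ * ‖y‖ ≤ 1
  rw [inv_mul_le_iff₀ hδ, mul_one]; exact h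

lemma cutoff_eq_one (hδ : 0 < δ) (h : 2 * δ ≤ ‖y‖) : cutoff N δ y = 1 := by
  rw [cutoff, ContDiffBump.zero_of_le_dist, sub_zero]
  rw [dist_zero_right, norm_smul, norm_inv, Real.norm_of_nonneg hδ.le]
  change 2 ≤ δ⁻¹ * ‖y‖
  rw [le_inv_mul_iff₀ hδ, mul_comm]; exact h

lemma cutoff_eventuallyEq_one (hδ : 0 < δ) (h : 2 * δ < ‖y‖) :
    cutoff N δ =ᶠ[nhds y] fun _ => 1 := by
  filter_upwards [continuous_norm.continuousAt.eventually (lt_mem_nhds h)] with z hz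
    using cutoff_eq_one hδ hz.le

lemma tsupport_cutoff_subset (hδ : 0 < δ) : tsupport (cutoff N δ) ⊆ {y | δ ≤ ‖y‖} :=
  closure_minimal (fun y hy => by
    by_contra h
    exact hy (cutoff_eq_zero hδ (not_le.mp h).le)) (isClosed_le continuous_const continuous_norm)

lemma pd_cutoff_eq_zero (hδ : 0 < δ) (h : 2 * δ < ‖y‖) (i : Fin N) :
    pd i (cutoff N δ) y = 0 := by
  rw [(cutoff_eventuallyEq_one hδ h).pd_eq i]; simp [pd]

lemma lap_cutoff_eq_zero (hδ : 0 < δ) (h : 2 * δ < ‖y‖) : lap (cutoff N δ) y = 0 := by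
  rw [(cutoff_eventuallyEq_one hδ h).lap_eq, lap_eq_sum_pd contDiffAt_const]
  refine Finset.sum_eq_zero fun i _ => ?_
  have : pd i (fun _ : Euc N => (1 : ℝ)) = fun _ => 0 := by funext z; simp [pd]
  rw [this, pd_zero]

lemma exists_bound_cutoff (N : ℕ) : ∃ C : ℝ, 0 < C ∧ ∀ δ, 0 < δ → ∀ y : Euc N,
    (∀ i, |pd i (cutoff N δ) y| ≤ C * δ⁻¹) ∧ |lap (cutoff N δ) y| ≤ C * δ⁻¹ ^ 2 := by
  set χ : ContDiffBump (0 : Euc N) := ⟨1, 2, one_pos, one_lt_two⟩ with hχ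
  have hs : ContDiff ℝ ∞ (fun y => 1 - χ y) := contDiff_const.sub χ.contDiff
  have hcut : ∀ δ, cutoff N δ = fun y => (fun z => 1 - χ z) (δ⁻¹ • y) := fun δ => rfl
  have hpd : ∀ i, ContDiff ℝ ∞ (pd i fun y => 1 - χ y) := fun i =>
    contDiff_iff_contDiffAt.mpr fun y => hs.contDiffAt.pd_left (by simp) i
  have hbound : ∀ i, ∃ C, ∀ y, |pd i (fun y => 1 - χ y) y| ≤ C ∧
      |pd i (pd i (fun y => 1 - χ y)) y| ≤ C := by
    intro i
    have key : pd i (fun y => 1 - χ y) = fun y => - pd i χ y := by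
      funext y
      rw [pd_sub (by fun_prop) (χ.contDiff.differentiable (n := 1) (by simp) y)]
      simp [pd]
    have c1 : HasCompactSupport (pd i fun y => 1 - χ y) := by
      rw [key]
      exact HasCompactSupport.comp_left (g := fun t : ℝ => -t)
        (f := pd i χ) (χ.hasCompactSupport.of_isClosed_subset (isClosed_tsupport _)
        (tsupport_pd_subset i)) neg_zero
    have c2 : HasCompactSupport (pd i (pd i fun y => 1 - χ y)) :=
      c1.of_isClosed_subset (isClosed_tsupport _) (tsupport_pd_subset i)
    obtain ⟨C1, h1⟩ := c1.exists_bound_of_continuous (hpd i).continuous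
    obtain ⟨C2, h2⟩ := c2.exists_bound_of_continuous
      (contDiff_iff_contDiffAt.mpr fun y => (hpd i).contDiffAt.pd_left (m := ∞)
        (by simp) i).continuous
    exact ⟨max C1 C2, fun y => ⟨(h1 y).trans (le_max_left _ _), (h2 y).trans (le_max_right _ _)⟩⟩
  choose C hC using hbound
  have hC0 : ∀ i, 0 ≤ C i := fun i => (abs_nonneg _).trans (hC i 0).1
  have hle : ∀ i, C i ≤ ∑ j, C j := fun i => Finset.single_le_sum (fun j _ => hC0 j)
    (Finset.mem_univ i)
  have hS := Finset.sum_nonneg fun i (_ : i ∈ Finset.univ) => hC0 i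
  refine ⟨(∑ i, C i) + 1, by linarith, fun δ hδ y => ⟨fun i => ?_, ?_⟩⟩
  · rw [hcut, pd_comp_smul (f := fun z => 1 - χ z), abs_mul, abs_of_pos (inv_pos.mpr hδ), mul_comm]
    gcongr
    linarith [(hC i (δ⁻¹ • y)).1, hle i]
  · rw [hcut, lap_comp_smul (f := fun z => 1 - χ z) _ (hs.contDiffAt.of_le (natCast_le_smooth 2)), abs_mul,
      abs_of_nonneg (by positivity), mul_comm, lap_eq_sum_pd
        (hs.contDiffAt.of_le (natCast_le_smooth 2))]
    gcongr
    exact (Finset.abs_sum_le_sum_abs _ _).trans ((Finset.sum_le_sum fun i _ =>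
      (hC i (δ⁻¹ • y)).2).trans (by linarith))

end Cutoff

section Lower

variable {N : ℕ} {c : ℝ} (B : ContDiffBump c) {ν ε ρ : ℝ} {x y : Euc N} {U : Euc N → ℝ}

lemma tendsto_cutoff_error {K : Euc N → ℝ} (hN3 : 3 ≤ N) (hK : ContDiff ℝ 1 K)
    (hKc : HasCompactSupport K) (hU : Continuous U) :
    Filter.Tendsto (fun δ => ∫ y, U y * (K y * lap (cutoff N δ) y +
      2 * ∑ i, pd i K y * pd i (cutoff N δ) y)) (nhdsWithin 0 (Ioi 0)) (nhds 0) := by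
  obtain ⟨C, hC0, hC⟩ := exists_bound_cutoff N
  obtain ⟨A, hA⟩ := hKc.exists_bound_of_continuous hK.continuous
  have hpd : ∀ i, ∃ A, ∀ y, |pd i K y| ≤ A := fun i =>
    HasCompactSupport.exists_bound_of_continuous (f := pd i K)
      (hKc.of_isClosed_subset (isClosed_tsupport _) (tsupport_pd_subset i))
      (contDiff_iff_contDiffAt.mpr fun y => hK.contDiffAt.pd_left (m := 0) (by simp) i).continuous
  choose A' hA' using hpd
  obtain ⟨D, hD⟩ := (isCompact_closedBall (0 : Euc N) 2).exists_bound_of_continuousOn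
    hU.continuousOn
  have hD0 : 0 ≤ D := (norm_nonneg _).trans (hD 0 (mem_closedBall_self (by norm_num)))
  have hA0 : 0 ≤ A := (norm_nonneg _).trans (hA 0)
  have hA'0 : 0 ≤ ∑ i, A' i := Finset.sum_nonneg fun i _ => (abs_nonneg _).trans (hA' i 0)
  set V := volume.real (ball (0 : Euc N) 1)
  set M := D * (A * C + 2 * ((∑ i, A' i) * C)) with hM
  have hM0 : 0 ≤ M := by positivity
  have bound : ∀ δ, 0 < δ → δ ≤ 1 → ‖∫ y, U y * (K y * lap (cutoff N δ) y +
      2 * ∑ i, pd i K y * pd i (cutoff N δ) y)‖ ≤ M * 2 ^ N * V * δ := by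
    intro δ hδ hδ1
    have hi : (1 : ℝ) ≤ δ⁻¹ := (one_le_inv₀ hδ).mpr hδ1
    have hi2 : δ⁻¹ ≤ δ⁻¹ ^ 2 := by nlinarith
    rw [← setIntegral_eq_integral_of_forall_compl_eq_zero (s := closedBall 0 (2 * δ))]
    · refine (norm_setIntegral_le_of_norm_le_const measure_closedBall_lt_top
        (C := M * δ⁻¹ ^ 2) fun y hy => ?_).trans ?_
      · rw [norm_mul, hM, mul_assoc]
        refine mul_le_mul (hD y (closedBall_subset_closedBall (by linarith) hy)) ?_
          (norm_nonneg _) hD0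
        refine (norm_add_le _ _).trans ?_
        rw [add_mul]
        refine add_le_add ?_ ?_
        · rw [norm_mul, mul_assoc]
          exact mul_le_mul (hA y) (hC δ hδ y).2 (norm_nonneg _) hA0
        · rw [norm_mul, Real.norm_of_nonneg (by norm_num : (0 : ℝ) ≤ 2), mul_assoc,
            Finset.sum_mul, Finset.sum_mul]
          refine mul_le_mul_of_nonneg_left ?_ (by norm_num)
          refine (norm_sum_le _ _).trans (Finset.sum_le_sum fun i _ => ?_)
          rw [norm_mul, mul_assoc]
          refine mul_le_mul (hA' i y) (((hC δ hδ y).1 i).trans ?_) (norm_nonneg _)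
            ((abs_nonneg _).trans (hA' i 0))
          gcongr
      · rw [Measure.addHaar_real_closedBall _ _ (by positivity), finrank_euclideanSpace_fin,
          mul_pow]
        have : δ⁻¹ ^ 2 * δ ^ N ≤ δ := by
          obtain ⟨k, rfl⟩ : ∃ k, N = k + 3 := ⟨N - 3, by omega⟩
          have e : δ⁻¹ ^ 2 * δ ^ (k + 3) = δ ^ k * δ := by
            rw [pow_add]; field_simp
          rw [e]
          exact mul_le_of_le_one_left hδ.le (pow_le_one₀ hδ.le hδ1)
        calc M * δ⁻¹ ^ 2 * (2 ^ N * δ ^ N * V) = M * 2 ^ N * V * (δ⁻¹ ^ 2 * δ ^ N) := by ring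
          _ ≤ M * 2 ^ N * V * δ := mul_le_mul_of_nonneg_left this (by positivity)
    · intro y hy
      have hy' : 2 * δ < ‖y‖ := by simpa using hy
      simp [lap_cutoff_eq_zero hδ hy', pd_cutoff_eq_zero hδ hy']
  have h0 : Filter.Tendsto (fun δ => M * 2 ^ N * V * δ) (nhdsWithin 0 (Ioi 0)) (nhds 0) := by
    have : Filter.Tendsto (fun δ : ℝ => M * 2 ^ N * V * δ) (nhds 0) (nhds (M * 2 ^ N * V * 0)) :=
      (continuous_const.mul continuous_id).continuousAt
    rw [mul_zero] at this
    exact this.mono_left nhdsWithin_le_nhds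
  refine squeeze_zero_norm' ?_ h0
  filter_upwards [Ioo_mem_nhdsGT (zero_lt_one' ℝ)] with δ hδ using bound δ hδ.1 hδ.2.le

lemma integral_kerK_cutoff (hc : B.rOut < c) (hν : 0 < ν) (hN : (N : ℝ) = 2 * ν + 2) (hε : 0 < ε)
    (hρ : 0 < ρ) (hρc : (ρ ^ 2) ^ (-ν) ≤ c - B.rOut) {δ : ℝ} (hδ : 0 < δ)
    (hUc : Continuous U) (hU : ∀ y, y ≠ 0 → ContDiffAt ℝ 2 U y) :
    Integrable (fun y => lap U y * (kerK B ν ε x y * cutoff N δ y)) ∧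
    Integrable (fun y => U y * (cutoff N δ y * kerJ B ν ε x y)) ∧
    Integrable (fun y => U y * (cutoff N δ y * kerM B ν ε x y)) ∧
    ∫ y, lap U y * (kerK B ν ε x y * cutoff N δ y) =
      (∫ y, U y * (cutoff N δ y * kerJ B ν ε x y)) - (∫ y, U y * (cutoff N δ y * kerM B ν ε x y))
      + ∫ y, U y * (kerK B ν ε x y * lap (cutoff N δ) y +
      2 * ∑ i, pd i (kerK B ν ε x) y * pd i (cutoff N δ) y) := by
  have z := fun y => ker_eq_zero (ε := ε) (x := x) (y := y) B hc hν hρ hρc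
  have sK := contDiff_kerK (ν := ν) B hε x
  have sJ := contDiff_kerJ (ν := ν) B hε x
  have sM := contDiff_kerM (ν := ν) B hε x
  have sη := contDiff_cutoff (N := N) δ
  have cK := hasCompactSupport_of_eq_zero fun y h => (z y h).1
  have cJ := hasCompactSupport_of_eq_zero fun y h => (z y h).2.1
  have cM := hasCompactSupport_of_eq_zero fun y h => (z y h).2.2
  have hne : ∀ y ∈ tsupport (fun y => kerK B ν ε x y * cutoff N δ y), y ≠ 0 := by
    intro y hy h0
    have h1 : y ∈ tsupport (cutoff N δ) := closure_mono (fun w hw => by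
      simp only [Function.mem_support] at hw ⊢; exact right_ne_zero_of_mul hw) hy
    have h2 : δ ≤ ‖y‖ := tsupport_cutoff_subset hδ h1
    rw [h0, norm_zero] at h2; linarith
  have cKη : HasCompactSupport (fun y => kerK B ν ε x y * cutoff N δ y) := cK.mul_right
  have h := integral_mul_lap (f := U) ((sK.mul sη).of_le (natCast_le_smooth 2)) cKη
    fun y hy => hU y (hne y hy)
  have iK := integrable_mul_of_tsupport (f := lap U) (sK.mul sη).continuous cKη
    fun y hy => by
      have e : lap U =ᶠ[nhds y] fun z => ∑ i, pd i (pd i U) z := by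
        filter_upwards [(hU y (hne y hy)).eventually (by simp)] with w hw using lap_eq_sum_pd hw
      refine ContinuousAt.congr ?_ e.symm
      refine tendsto_finsetSum _ fun i _ => ?_
      exact (((hU y (hne y hy)).pd_left (m := 1) (by norm_num) i).pd_left (m := 0) (by norm_num)
        i).continuousAt
  have iJ := integrable_mul_of_tsupport (f := U) (sη.mul sJ).continuous cJ.mul_left
    fun y _ => hUc.continuousAt
  have iM := integrable_mul_of_tsupport (f := U) (sη.mul sM).continuous cM.mul_left
    fun y _ => hUc.continuousAt
  refine ⟨iK, iJ, iM, ?_⟩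
  have e : ∀ y, lap (fun y => kerK B ν ε x y * cutoff N δ y) y =
      (cutoff N δ y * kerJ B ν ε x y - cutoff N δ y * kerM B ν ε x y) +
      (kerK B ν ε x y * lap (cutoff N δ) y +
      2 * ∑ i, pd i (kerK B ν ε x) y * pd i (cutoff N δ) y) := fun y => by
    rw [lap_mul (sK.contDiffAt.of_le (natCast_le_smooth 2))
      (sη.contDiffAt.of_le (natCast_le_smooth 2)), lap_kerK B hN hε]
    ring
  have el : ∀ y, lap (cutoff N δ) y = ∑ i, pd i (pd i (cutoff N δ)) y := fun y =>
    lap_eq_sum_pd (sη.contDiffAt.of_le (natCast_le_smooth 2))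
  have spd : ∀ F : Euc N → ℝ, ContDiff ℝ ∞ F → ∀ i, ContDiff ℝ ∞ (pd i F) := fun F hF i =>
    contDiff_iff_contDiffAt.mpr fun y => hF.contDiffAt.pd_left (by simp) i
  have cl : Continuous (lap (cutoff N δ)) := by
    rw [show lap (cutoff N δ) = fun y => ∑ i, pd i (pd i (cutoff N δ)) y from funext el]
    exact continuous_finsetSum _ fun i _ => (spd _ (spd _ sη i) i).continuous
  have iE : Integrable fun y => U y * (kerK B ν ε x y * lap (cutoff N δ) y +
      2 * ∑ i, pd i (kerK B ν ε x) y * pd i (cutoff N δ) y) := by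
    refine integrable_mul_of_tsupport (f := U) ?_ ?_ fun y _ => hUc.continuousAt
    · exact (sK.continuous.mul cl).add (continuous_const.mul (continuous_finsetSum _ fun i _ =>
        (spd _ sK i).continuous.mul (spd _ sη i).continuous))
    · refine hasCompactSupport_of_eq_zero (x := x) (ρ := ρ + 1) fun y hy => ?_
      rw [(z y (by linarith)).1]
      simp [fun i => pd_eq_zero_of_eq_zero (ρ := ρ) (by linarith : ρ < ρ + 1)
        (fun y h => (z y h).1) hy i]
  rw [← h]
  simp_rw [e, mul_add, mul_sub]
  simp_rw [mul_add] at iE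
  have iJM : Integrable fun y => U y * (cutoff N δ y * kerJ B ν ε x y) -
      U y * (cutoff N δ y * kerM B ν ε x y) := iJ.sub iM
  rw [integral_add iJM iE, integral_sub iJ iM]

lemma lintegral_kerK_add_le (hN3 : 3 ≤ N) (hc : B.rOut < c) (hν : 0 < ν)
    (hN : (N : ℝ) = 2 * ν + 2) (hε : 0 < ε)
    (hρ : 0 < ρ) (hρc : (ρ ^ 2) ^ (-ν) ≤ c - B.rOut)
    (hUc : Continuous U) (hU0 : ∀ y, 0 ≤ U y) (hU : ∀ y, y ≠ 0 → ContDiffAt ℝ 2 U y)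
    (hl : ∀ y, y ≠ 0 → lap U y ≤ 0) :
    ∫⁻ y, ENNReal.ofReal (-lap U y * kerK B ν ε x y + U y * kerJ B ν ε x y) ≤
      ENNReal.ofReal (∫ y, U y * kerM B ν ε x y) := by
  have : Nontrivial (Euc N) := by
    have : Nonempty (Fin N) := ⟨⟨0, by omega⟩⟩
    infer_instance
  have z := fun y => ker_eq_zero (ε := ε) (x := x) (y := y) B hc hν hρ hρc
  have sK := contDiff_kerK (ν := ν) B hε x
  have sM := contDiff_kerM (ν := ν) B hε x
  have cK := hasCompactSupport_of_eq_zero fun y h => (z y h).1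
  have cM := hasCompactSupport_of_eq_zero fun y h => (z y h).2.2
  set δ : ℕ → ℝ := fun n => 1 / ((n : ℝ) + 1) with hδ
  have hδ0 : ∀ n, 0 < δ n := fun n => by positivity
  have hδt : Filter.Tendsto δ Filter.atTop (nhds 0) := tendsto_one_div_add_atTop_nhds_zero_nat
  have hδt' : Filter.Tendsto δ Filter.atTop (nhdsWithin 0 (Ioi 0)) :=
    tendsto_nhdsWithin_iff.mpr ⟨hδt, Filter.Eventually.of_forall hδ0⟩
  set F : ℕ → Euc N → ℝ := fun n y => -(lap U y * (kerK B ν ε x y * cutoff N (δ n) y)) +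
    U y * (cutoff N (δ n) y * kerJ B ν ε x y) with hF
  have hmain := fun n => integral_kerK_cutoff B (x := x) hc hν hN hε hρ hρc (hδ0 n) hUc hU
  have hFi : ∀ n, Integrable (F n) := fun n => (hmain n).1.neg.add (hmain n).2.1
  have hne : ∀ᵐ y : Euc N, y ≠ 0 := by simp [ae_iff]
  have hF0 : ∀ n, 0 ≤ᵐ[volume] F n := fun n => by
    filter_upwards [hne] with y hy
    have h1 := mul_nonneg (neg_nonneg.mpr (hl y hy))
      (mul_nonneg (kerK_nonneg (ν := ν) (ε := ε) (x := x) (y := y) B hc)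
        (cutoff_nonneg (δ := δ n) (y := y)))
    have h2 := mul_nonneg (hU0 y) (mul_nonneg (cutoff_nonneg (δ := δ n) (y := y))
      (kerJ_nonneg (ν := ν) (ε := ε) (x := x) (y := y) B))
    simp only [hF, Pi.zero_apply]
    linarith
  set E : ℕ → ℝ := fun n => ∫ y, U y * (kerK B ν ε x y * lap (cutoff N (δ n)) y +
      2 * ∑ i, pd i (kerK B ν ε x) y * pd i (cutoff N (δ n)) y) with hE
  have hEt : Filter.Tendsto E Filter.atTop (nhds 0) :=
    (tendsto_cutoff_error hN3 (sK.of_le (natCast_le_smooth 1)) cK hUc).comp hδt'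
  have iM := integrable_mul_of_tsupport (f := U) sM.continuous cM fun y _ => hUc.continuousAt
  have hint : ∀ n, ∫ y, F n y ≤ (∫ y, U y * kerM B ν ε x y) - E n := fun n => by
    obtain ⟨i1, i2, i3, h⟩ := hmain n
    have i1' : Integrable fun y => -(lap U y * (kerK B ν ε x y * cutoff N (δ n) y)) := i1.neg
    simp only [hF]
    rw [integral_add i1' i2, integral_neg, h]
    have : ∫ y, U y * (cutoff N (δ n) y * kerM B ν ε x y) ≤ ∫ y, U y * kerM B ν ε x y := by
      refine integral_mono i3 iM fun y => ?_
      exact mul_le_mul_of_nonneg_left (mul_le_of_le_one_left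
        (kerM_nonneg B hc hν) cutoff_le_one) (hU0 y)
    linarith
  calc ∫⁻ y, ENNReal.ofReal (-lap U y * kerK B ν ε x y + U y * kerJ B ν ε x y)
      ≤ ∫⁻ y, Filter.liminf (fun n => ENNReal.ofReal (F n y)) Filter.atTop := by
        refine lintegral_mono_ae ?_
        filter_upwards [hne] with y hy
        refine le_of_eq (Filter.Tendsto.liminf_eq ?_).symm
        refine tendsto_const_nhds.congr' ?_
        have hy0 : 0 < ‖y‖ / 2 := by positivity
        filter_upwards [hδt.eventually (gt_mem_nhds hy0)] with n hn
        simp only [hF]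
        rw [cutoff_eq_one (hδ0 n) (by linarith)]
        congr 1; ring
    _ ≤ Filter.liminf (fun n => ∫⁻ y, ENNReal.ofReal (F n y)) Filter.atTop :=
        lintegral_liminf_le' fun n => (hFi n).aemeasurable.ennreal_ofReal
    _ ≤ Filter.liminf (fun n => ENNReal.ofReal ((∫ y, U y * kerM B ν ε x y) - E n))
          Filter.atTop := by
        refine Filter.liminf_le_liminf (Filter.Eventually.of_forall fun n => ?_)
        rw [← ofReal_integral_eq_lintegral_ofReal (hFi n) (hF0 n)]
        exact ENNReal.ofReal_le_ofReal (hint n)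
    _ = ENNReal.ofReal (∫ y, U y * kerM B ν ε x y) := by
        refine Filter.Tendsto.liminf_eq ?_
        have := (tendsto_const_nhds (x := ∫ y, U y * kerM B ν ε x y)).sub hEt
        rw [sub_zero] at this
        exact (ENNReal.continuous_ofReal.tendsto _).comp this

end Lower

section Lower

variable {N : ℕ}

theorem exists_potential_lower (hN : 3 ≤ N) {Λ : ℝ} (hΛ : 1 ≤ Λ) :
    ∃ C : ℝ≥0, ∀ (x : Euc N) (U : Euc N → ℝ), Continuous U → (∀ y, 0 ≤ U y) →
      (∀ y, y ≠ 0 → ContDiffAt ℝ 2 U y) → (∀ y, y ≠ 0 → lap U y ≤ 0) →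
      (∫⁻ y in closedBall x Λ, ‖lap U y‖ₑ) ≤ C * ‖U x‖ₑ ∧
      (∫⁻ y in closedBall x Λ \ ball x (1 / 4), ‖U y‖ₑ) ≤ C * ‖U x‖ₑ := by
  have : Nontrivial (Euc N) := by
    have : Nonempty (Fin N) := ⟨⟨0, by omega⟩⟩
    infer_instance
  have hN' : (3 : ℝ) ≤ N := by exact_mod_cast hN
  set ν : ℝ := ((N : ℝ) - 2) / 2 with hν'
  have hν : 0 < ν := by rw [hν']; linarith
  have hNν : (N : ℝ) = 2 * ν + 2 := by rw [hν']; ring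
  set A := (Λ ^ 2 + 1) ^ (-ν) with hA
  set A' := ((1 / 16 : ℝ)) ^ (-ν) with hA'
  have hA0 : 0 < A := by positivity
  have hAA : A ≤ A' := rpow_neg_le_of_le (by norm_num) hν.le (by nlinarith)
  let B : ContDiffBump A' := ⟨A' - A / 2, A' - A / 4, by linarith, by linarith⟩
  have hc : B.rOut < A' := by change A' - A / 4 < A'; linarith
  set ρ := (A / 4) ^ (-(2 * ν)⁻¹) with hρ'
  have hρ : 0 < ρ := by positivity
  have hρc : (ρ ^ 2) ^ (-ν) ≤ A' - B.rOut := by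
    change _ ≤ A' - (A' - A / 4)
    rw [← Real.rpow_natCast, ← Real.rpow_mul hρ.le, hρ', ← Real.rpow_mul (by positivity)]
    have : -(2 * ν)⁻¹ * (((2 : ℕ) : ℝ) * -ν) = 1 := by
      push_cast; field_simp
    rw [this, Real.rpow_one]
    linarith
  set k0 := bumpIntInt B A with hk0'
  have hk0 : 0 < k0 := bumpIntInt_pos hc (by change A' - (A' - A / 2) < A; linarith)
  set j0 := (1 / 4) ^ 2 * (4 * ν ^ 2 * (Λ ^ 2 + 1) ^ (-(2 * ν + 2))) with hj0'
  have hj0 : 0 < j0 := by positivity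
  set m := min k0 j0 with hm
  have hm0 : 0 < m := lt_min hk0 hj0
  have hK : ∀ (x y : Euc N) ε, 0 < ε → ε ≤ 1 → ‖y - x‖ ≤ Λ → m ≤ kerK B ν ε x y := by
    intro x y ε hε hε1 hy
    refine (min_le_left _ _).trans (monotone_bumpIntInt hc ?_)
    refine rpow_neg_le_of_le (tau_pos hε x y) hν.le ?_
    rw [tau]
    nlinarith [norm_nonneg (y - x)]
  have hJ : ∀ (x y : Euc N) ε, 0 < ε → ε ≤ 1 → ‖y - x‖ ≤ Λ → 1 / 4 ≤ ‖y - x‖ →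
      m ≤ kerJ B ν ε x y := by
    intro x y ε hε hε1 hy hy'
    refine (min_le_right _ _).trans ?_
    have hτ : tau ε x y ≤ Λ ^ 2 + 1 := by
      rw [tau]; nlinarith [norm_nonneg (y - x)]
    have hτ' : 1 / 16 ≤ tau ε x y := by
      rw [tau]; nlinarith
    have hB : B (tau ε x y ^ (-ν)) = 1 := by
      refine bump_eq_one B ?_ ?_
      · change A' - (A' - A / 2) ≤ _
        have : A ≤ tau ε x y ^ (-ν) := rpow_neg_le_of_le (tau_pos hε x y) hν.le hτ
        linarith
      · change _ ≤ A' + (A' - A / 2)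
        have : tau ε x y ^ (-ν) ≤ A' := rpow_neg_le_of_le (by norm_num) hν.le hτ'
        linarith
    rw [kerJ, kerProfile, hB, mul_one]
    have := rpow_neg_le_of_le (r := 2 * ν + 2) (tau_pos hε x y) (by positivity) hτ
    rw [hj0']
    gcongr
  set κ := kerMass N B ν
  have hκ0 : 0 < κ := kerMass_pos B hc hν hNν
  refine ⟨(κ / m).toNNReal, fun x U hUc hU0 hU hl => ?_⟩
  have hne : ∀ᵐ y : Euc N, y ≠ 0 := by simp [ae_iff]
  have lim : ∀ I : ℝ≥0∞, (∀ ε, 0 < ε → ε ≤ 1 → ENNReal.ofReal m * I ≤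
      ∫⁻ y, ENNReal.ofReal (-lap U y * kerK B ν ε x y + U y * kerJ B ν ε x y)) →
      I ≤ (κ / m).toNNReal * ‖U x‖ₑ := by
    intro I hI
    have h1 := tendsto_integral_kerM_of_continuousOn B (x := x) hc hν hNν hρ hρc
      (hUc.continuousOn (s := closedBall x ρ))
    have h2 : ENNReal.ofReal m * I ≤ ENNReal.ofReal (κ * U x) :=
      ge_of_tendsto ((ENNReal.continuous_ofReal.tendsto _).comp h1) (by
        filter_upwards [Ioo_mem_nhdsGT (zero_lt_one' ℝ)] with ε hε
        exact (hI ε hε.1 hε.2.le).trans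
          (lintegral_kerK_add_le B hN hc hν hNν hε.1 hρ hρc hUc hU0 hU hl))
    have hm1 : ENNReal.ofReal m ≠ 0 := by simpa using hm0
    calc I = (ENNReal.ofReal m)⁻¹ * (ENNReal.ofReal m * I) := by
          rw [← mul_assoc, ENNReal.inv_mul_cancel hm1 ENNReal.ofReal_ne_top, one_mul]
      _ ≤ (ENNReal.ofReal m)⁻¹ * ENNReal.ofReal (κ * U x) := mul_le_mul_right h2 _
      _ = (κ / m).toNNReal * ‖U x‖ₑ := by
          rw [← ENNReal.ofReal_inv_of_pos hm0, ← ENNReal.ofReal_mul (by positivity),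
            ENNReal.ofNNReal_toNNReal, Real.enorm_of_nonneg (hU0 x),
            ← ENNReal.ofReal_mul (by positivity)]
          congr 1; ring
  have key : ∀ (S : Set (Euc N)) (w : Euc N → ℝ), MeasurableSet S → (∀ ε, 0 < ε → ε ≤ 1 →
      ∀ y ∈ S, y ≠ 0 → m * |w y| ≤ -lap U y * kerK B ν ε x y + U y * kerJ B ν ε x y) →
      ∫⁻ y in S, ‖w y‖ₑ ≤ (κ / m).toNNReal * ‖U x‖ₑ := by
    intro S w hS h
    refine lim _ fun ε hε hε1 => ?_
    rw [← lintegral_const_mul' _ _ ENNReal.ofReal_ne_top]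
    refine le_trans ?_ (setLIntegral_le_lintegral S _)
    refine lintegral_mono_ae ?_
    filter_upwards [ae_restrict_of_ae hne, ae_restrict_mem hS] with y hy hyS
    rw [Real.enorm_eq_ofReal_abs, ← ENNReal.ofReal_mul hm0.le]
    exact ENNReal.ofReal_le_ofReal (h ε hε hε1 y hyS hy)
  refine ⟨key _ _ measurableSet_closedBall fun ε hε hε1 y hy hy0 => ?_,
    key _ _ (measurableSet_closedBall.diff measurableSet_ball) fun ε hε hε1 y hy hy0 => ?_⟩
  · have h1 := hK x y ε hε hε1 (by simpa [dist_eq_norm] using hy)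
    have h2 := mul_nonneg (hU0 y) (kerJ_nonneg (ν := ν) (ε := ε) (x := x) (y := y) B)
    rw [abs_of_nonpos (hl y hy0)]
    nlinarith [hl y hy0]
  · have h1 := hJ x y ε hε hε1 (by simpa [dist_eq_norm] using hy.1)
      (by simpa [dist_eq_norm] using hy.2)
    have h2 := mul_nonneg (neg_nonneg.mpr (hl y hy0))
      (kerK_nonneg (ν := ν) (ε := ε) (x := x) (y := y) B hc)
    rw [abs_of_nonneg (hU0 y)]
    nlinarith [hU0 y]

end Lower

/-- Nonnegative solutions of the Hénon–Lane–Emden system, in unbundled form. -/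
structure IsNNSol {N : ℕ} (p q a b : ℝ) (u v : Euc N → ℝ) : Prop where
  contDiffAt_fst : ∀ x, x ≠ 0 → ContDiffAt ℝ 2 u x
  contDiffAt_snd : ∀ x, x ≠ 0 → ContDiffAt ℝ 2 v x
  continuous_fst : Continuous u
  continuous_snd : Continuous v
  nonneg_fst : ∀ x, 0 ≤ u x
  nonneg_snd : ∀ x, 0 ≤ v x
  lap_fst : ∀ x, x ≠ 0 → lap u x = -(‖x‖ ^ a * v x ^ p)
  lap_snd : ∀ x, x ≠ 0 → lap v x = -(‖x‖ ^ b * u x ^ q)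

/-- The closed annulus of radii `1/2` and `Λ`. -/
def shell (N : ℕ) (Λ : ℝ) : Set (Euc N) := closedBall 0 Λ \ ball 0 (1 / 2)

section APriori

variable {N : ℕ} {p q a b : ℝ} {u v : Euc N → ℝ}

lemma abs_rpow_sub_one_mul_self {t : ℝ} (hp : 0 < p) (ht : 0 ≤ t) :
    |t| ^ (p - 1) * t = t ^ p := by
  rcases ht.eq_or_lt with rfl | h
  · simp [Real.zero_rpow hp.ne']
  · rw [abs_of_pos h, ← Real.rpow_add_one h.ne']; simp

lemma IsHLESol.isNNSol (h : IsHLESol p q a b u v) (hp : 0 < p) (hq : 0 < q)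
    (hu : ∀ x, 0 ≤ u x) (hv : ∀ x, 0 ≤ v x) : IsNNSol p q a b u v where
  contDiffAt_fst x hx := h.1.contDiffAt (isOpen_ne.mem_nhds hx)
  contDiffAt_snd x hx := h.2.1.contDiffAt (isOpen_ne.mem_nhds hx)
  continuous_fst := h.2.2.1
  continuous_snd := h.2.2.2.1
  nonneg_fst := hu
  nonneg_snd := hv
  lap_fst x hx := by rw [← abs_rpow_sub_one_mul_self hp (hv x), ← h.2.2.2.2.1 x hx, neg_neg]
  lap_snd x hx := by rw [← abs_rpow_sub_one_mul_self hq (hu x), ← h.2.2.2.2.2 x hx, neg_neg]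

namespace IsNNSol

variable (h : IsNNSol p q a b u v)

lemma symm (h : IsNNSol p q a b u v) : IsNNSol q p b a v u :=
  ⟨h.contDiffAt_snd, h.contDiffAt_fst, h.continuous_snd, h.continuous_fst, h.nonneg_snd,
    h.nonneg_fst, h.lap_snd, h.lap_fst⟩

lemma lap_fst_nonpos (h : IsNNSol p q a b u v) {x : Euc N} (hx : x ≠ 0) : lap u x ≤ 0 := by
  rw [h.lap_fst x hx, neg_nonpos]
  exact mul_nonneg (by positivity) (Real.rpow_nonneg (h.nonneg_snd x) p)

lemma enorm_lap_fst (h : IsNNSol p q a b u v) (hp : 0 < p) {x : Euc N} (hx : x ≠ 0) :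
    ‖lap u x‖ₑ = ENNReal.ofReal (‖x‖ ^ a) * ‖v x‖ₑ ^ p := by
  rw [h.lap_fst x hx, enorm_neg, Real.enorm_of_nonneg (mul_nonneg (by positivity)
    (Real.rpow_nonneg (h.nonneg_snd x) p)), ENNReal.ofReal_mul (by positivity),
    Real.enorm_of_nonneg (h.nonneg_snd x), ENNReal.ofReal_rpow_of_nonneg (h.nonneg_snd x) hp.le]

end IsNNSol

lemma rpow_mem_Icc_of_mem_Icc {r₁ r₂ r : ℝ} (h1 : 0 < r₁) (h : r ∈ Icc r₁ r₂) (a : ℝ) :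
    min (r₁ ^ a) (r₂ ^ a) ≤ r ^ a ∧ r ^ a ≤ max (r₁ ^ a) (r₂ ^ a) := by
  have hr := h1.trans_le h.1
  rcases le_total 0 a with ha | ha
  · exact ⟨(min_le_left _ _).trans (Real.rpow_le_rpow h1.le h.1 ha),
      le_max_of_le_right (Real.rpow_le_rpow hr.le h.2 ha)⟩
  · exact ⟨(min_le_right _ _).trans (Real.rpow_le_rpow_of_nonpos hr h.2 ha),
      le_max_of_le_left (Real.rpow_le_rpow_of_nonpos h1 h.1 ha)⟩

lemma exists_le_enorm_lap (hN : 3 ≤ N) (hp : 0 < p) (a : ℝ) : ∃ c : ℝ≥0, 0 < c ∧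
    ∀ (q b : ℝ) (u v : Euc N → ℝ), IsNNSol p q a b u v → ∀ m : ℝ≥0∞,
      (∀ y ∈ closedBall (0 : Euc N) (1 / 8), m ≤ ‖v y‖ₑ) →
      ∀ x ∈ closedBall (0 : Euc N) (1 / 8), c * m ^ p ≤ ‖u x‖ₑ := by
  obtain ⟨C, hC⟩ := exists_potential_lower hN (le_refl 1)
  set e : Euc N := EuclideanSpace.single ⟨0, by omega⟩ (3 / 32) with he
  have hen : ‖e‖ = 3 / 32 := by rw [he, PiLp.norm_single]; norm_num
  set κ := min ((1 / 16 : ℝ) ^ a) ((1 / 8) ^ a) with hκ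
  have hκ0 : 0 < κ := by positivity
  set μ := (volume (ball e (1 / 32))).toNNReal with hμ
  have hμe : (μ : ℝ≥0∞) = volume (ball e (1 / 32)) :=
    ENNReal.coe_toNNReal measure_ball_lt_top.ne
  have hμ0 : 0 < μ := by
    rw [← ENNReal.coe_pos, hμe]; exact measure_ball_pos _ _ (by norm_num)
  refine ⟨(C + 1)⁻¹ * (κ.toNNReal * μ), by positivity, fun q b u v h m hm x hx => ?_⟩
  have h1 := (hC x u h.continuous_fst h.nonneg_fst h.contDiffAt_fst
    fun y hy => h.lap_fst_nonpos hy).1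
  have hx' : ‖x‖ ≤ 1 / 8 := by simpa using hx
  have h2 : (κ.toNNReal * μ : ℝ≥0∞) * m ^ p ≤ ∫⁻ y in closedBall x 1, ‖lap u y‖ₑ := by
    have hb : ∀ y ∈ ball e (1 / 32), 1 / 16 ≤ ‖y‖ ∧ ‖y‖ ≤ 1 / 8 := fun y hy => by
      rw [mem_ball, dist_eq_norm] at hy
      have h1 := abs_norm_sub_norm_le y e
      rw [hen, abs_le] at h1
      constructor <;> linarith
    calc (κ.toNNReal * μ : ℝ≥0∞) * m ^ p = ∫⁻ y in ball e (1 / 32), κ.toNNReal * m ^ p := by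
          rw [setLIntegral_const, hμe]; ring
      _ ≤ ∫⁻ y in ball e (1 / 32), ‖lap u y‖ₑ := by
          refine setLIntegral_mono' measurableSet_ball fun y hy => ?_
          have hy0 : y ≠ 0 := by
            rintro rfl; have := (hb 0 hy).1; rw [norm_zero] at this; norm_num at this
          rw [h.enorm_lap_fst hp hy0]
          gcongr
          · exact ENNReal.ofReal_le_ofReal
              (rpow_mem_Icc_of_mem_Icc (by norm_num) (hb y hy) a).1
          · exact hm y (by simpa using (hb y hy).2)
      _ ≤ ∫⁻ y in closedBall x 1, ‖lap u y‖ₑ := by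
          refine lintegral_mono_set fun y hy => ?_
          rw [mem_closedBall, dist_eq_norm]
          linarith [norm_sub_le y x, (hb y hy).2]
  have hC1 : ((C + 1 : ℝ≥0) : ℝ≥0∞) ≠ 0 := by simp
  calc (((C + 1)⁻¹ * (κ.toNNReal * μ) : ℝ≥0) : ℝ≥0∞) * m ^ p
      = ((C + 1 : ℝ≥0) : ℝ≥0∞)⁻¹ * ((κ.toNNReal * μ : ℝ≥0∞) * m ^ p) := by
        rw [ENNReal.coe_mul, ENNReal.coe_inv (by positivity), ENNReal.coe_mul, mul_assoc]
    _ ≤ ((C + 1 : ℝ≥0) : ℝ≥0∞)⁻¹ * (C * ‖u x‖ₑ) := mul_le_mul_right (h2.trans h1) _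
    _ ≤ ((C + 1 : ℝ≥0) : ℝ≥0∞)⁻¹ * ((C + 1 : ℝ≥0) * ‖u x‖ₑ) := by
        gcongr; simp
    _ = ‖u x‖ₑ := by
        rw [← mul_assoc, ENNReal.inv_mul_cancel hC1 ENNReal.coe_ne_top, one_mul]

lemma le_of_mul_rpow_le {c m m' : ℝ} (hc : 0 < c) (hp : 0 < p) (hpq : 1 < p * q)
    (hm : 0 ≤ m) (h1 : c * m' ^ p ≤ m) (h2 : c * m ^ q ≤ m') :
    m ≤ (c ^ (-(1 + p))) ^ (p * q - 1)⁻¹ := by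
  rcases hm.eq_or_lt with rfl | h0
  · positivity
  have h3 : c * (c * m ^ q) ^ p ≤ m :=
    (mul_le_mul_of_nonneg_left (Real.rpow_le_rpow (by positivity) h2 hp.le) hc.le).trans h1
  have h4 : c * (c * m ^ q) ^ p = c ^ (1 + p) * m ^ (p * q) := by
    rw [Real.mul_rpow hc.le (by positivity), ← Real.rpow_mul hm, Real.rpow_add hc, Real.rpow_one,
      mul_comm q p, mul_assoc]
  rw [h4] at h3
  rw [Real.le_rpow_inv_iff_of_pos hm (by positivity) (by linarith), Real.rpow_neg hc.le,
    Real.rpow_sub_one h0.ne', div_le_iff₀ h0, ← div_eq_inv_mul, le_div_iff₀ (by positivity)]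
  linarith

theorem exists_apriori_bound (hN : 3 ≤ N) (hp : 0 < p) (hq : 0 < q) (hpq : 1 < p * q) (a b : ℝ)
    (Λ : ℝ) : ∃ C : ℝ≥0, ∀ u v : Euc N → ℝ, IsNNSol p q a b u v →
      (∫⁻ y in shell N Λ, ‖u y‖ₑ ≤ C) ∧ (∫⁻ y in shell N Λ, ‖v y‖ₑ ^ p ≤ C) := by
  obtain ⟨C, hC⟩ := exists_potential_lower hN (le_add_of_nonneg_left (abs_nonneg Λ) : 1 ≤ |Λ| + 1)
  obtain ⟨c₁, hc₁, h₁⟩ := exists_le_enorm_lap hN hp a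
  obtain ⟨c₂, hc₂, h₂⟩ := exists_le_enorm_lap hN hq b
  set c := min c₁ c₂
  have hc : 0 < c := lt_min hc₁ hc₂
  set M : ℝ := ((c : ℝ) ^ (-(1 + p))) ^ (p * q - 1)⁻¹ with hM
  set κ := min ((1 / 2 : ℝ) ^ a) (Λ ^ a)
  refine ⟨C * M.toNNReal + κ.toNNReal⁻¹ * (C * M.toNNReal), fun u v h => ?_⟩
  have hne : (closedBall (0 : Euc N) (1 / 8)).Nonempty := ⟨0, by simp⟩
  obtain ⟨xu, hxu, hmu⟩ := (isCompact_closedBall (0 : Euc N) (1 / 8)).exists_isMinOn hne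
    h.continuous_fst.continuousOn
  obtain ⟨xv, hxv, hmv⟩ := (isCompact_closedBall (0 : Euc N) (1 / 8)).exists_isMinOn hne
    h.continuous_snd.continuousOn
  have hu0 := h.nonneg_fst
  have hv0 := h.nonneg_snd
  have e1 : (c : ℝ) * v xv ^ p ≤ u xu := by
    have := h₁ q b u v h ‖v xv‖ₑ (fun y hy => by
      rw [Real.enorm_of_nonneg (hv0 _), Real.enorm_of_nonneg (hv0 _)]
      exact ENNReal.ofReal_le_ofReal (hmv hy)) xu hxu
    have := (mul_le_mul_left (ENNReal.coe_le_coe.mpr (min_le_left c₁ c₂)) _).trans this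
    rw [Real.enorm_of_nonneg (hv0 _), Real.enorm_of_nonneg (hu0 _),
      ENNReal.ofReal_rpow_of_nonneg (hv0 _) hp.le, ← ENNReal.ofReal_coe_nnreal,
      ← ENNReal.ofReal_mul (by positivity)] at this
    exact (ENNReal.ofReal_le_ofReal_iff (hu0 _)).mp this
  have e2 : (c : ℝ) * u xu ^ q ≤ v xv := by
    have := h₂ p a v u h.symm ‖u xu‖ₑ (fun y hy => by
      rw [Real.enorm_of_nonneg (hu0 _), Real.enorm_of_nonneg (hu0 _)]
      exact ENNReal.ofReal_le_ofReal (hmu hy)) xv hxv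
    have := (mul_le_mul_left (ENNReal.coe_le_coe.mpr (min_le_right c₁ c₂)) _).trans this
    rw [Real.enorm_of_nonneg (hv0 _), Real.enorm_of_nonneg (hu0 _),
      ENNReal.ofReal_rpow_of_nonneg (hu0 _) hq.le, ← ENNReal.ofReal_coe_nnreal,
      ← ENNReal.ofReal_mul (by positivity)] at this
    exact (ENNReal.ofReal_le_ofReal_iff (hv0 _)).mp this
  have e3 : ‖u xu‖ₑ ≤ M.toNNReal := by
    rw [Real.enorm_of_nonneg (hu0 _)]
    exact ENNReal.ofReal_le_ofReal (le_of_mul_rpow_le (NNReal.coe_pos.mpr hc) hp hpq (hu0 _) e1 e2)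
  obtain ⟨i1, i2⟩ := hC xu u h.continuous_fst hu0 h.contDiffAt_fst fun y hy => h.lap_fst_nonpos hy
  have hxu' : ‖xu‖ ≤ 1 / 8 := by simpa using hxu
  have hD : ∀ y ∈ shell N Λ, 1 / 2 ≤ ‖y‖ ∧ ‖y‖ ≤ Λ := fun y hy =>
    ⟨by simpa using hy.2, by simpa using hy.1⟩
  have s1 : shell N Λ ⊆ closedBall xu (|Λ| + 1) := fun y hy => by
    rw [mem_closedBall, dist_eq_norm]
    linarith [norm_sub_le y xu, (hD y hy).2, le_abs_self Λ]
  have s2 : shell N Λ ⊆ closedBall xu (|Λ| + 1) \ ball xu (1 / 4) := fun y hy =>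
    ⟨s1 hy, by
      rw [mem_ball, dist_eq_norm, not_lt]
      linarith [norm_sub_norm_le y xu, (hD y hy).1]⟩
  have hS : MeasurableSet (shell N Λ) := measurableSet_closedBall.diff measurableSet_ball
  constructor
  · refine (lintegral_mono_set s2).trans (i2.trans ?_)
    rw [ENNReal.coe_add, ENNReal.coe_mul]
    exact le_add_right (by gcongr)
  · rcases (shell N Λ).eq_empty_or_nonempty with hemp | ⟨y₀, hy₀⟩
    · rw [hemp]; simp
    have hΛ : 1 / 2 ≤ Λ := (hD y₀ hy₀).1.trans (hD y₀ hy₀).2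
    have hκ0 : 0 < κ := lt_min (by positivity) (Real.rpow_pos_of_pos (by linarith) _)
    have hκ1 : (κ.toNNReal : ℝ≥0∞) ≠ 0 := by simpa using hκ0
    have : κ.toNNReal * ∫⁻ y in shell N Λ, ‖v y‖ₑ ^ p ≤ C * M.toNNReal := by
      rw [← lintegral_const_mul' _ _ ENNReal.coe_ne_top]
      refine le_trans ?_ ((lintegral_mono_set s1).trans (i1.trans (mul_le_mul_right e3 _)))
      refine setLIntegral_mono' hS fun y hy => ?_
      have hy0 : y ≠ 0 := by
        rintro rfl; have := (hD 0 hy).1; rw [norm_zero] at this; norm_num at this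
      rw [h.enorm_lap_fst hp hy0]
      gcongr
      exact ENNReal.ofReal_le_ofReal (rpow_mem_Icc_of_mem_Icc (by norm_num) (hD y hy) a).1
    calc ∫⁻ y in shell N Λ, ‖v y‖ₑ ^ p
        = (κ.toNNReal : ℝ≥0∞)⁻¹ * (κ.toNNReal * ∫⁻ y in shell N Λ, ‖v y‖ₑ ^ p) := by
          rw [← mul_assoc, ENNReal.inv_mul_cancel hκ1 ENNReal.coe_ne_top, one_mul]
      _ ≤ (κ.toNNReal : ℝ≥0∞)⁻¹ * (C * M.toNNReal) := mul_le_mul_right this _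
      _ ≤ _ := by
          rw [ENNReal.coe_add, ENNReal.coe_mul, ENNReal.coe_mul, ENNReal.coe_inv
            (by simpa using hκ0), ENNReal.coe_mul]
          exact le_add_self

end APriori

/-- The power singularity `‖x‖^(-s)` truncated to the ball of radius `ρ`. -/
def sing {E : Type*} [NormedAddCommGroup E] (ρ s : ℝ) : E → ℝ≥0∞ :=
  (ball 0 ρ).indicator fun x => ‖x‖ₑ ^ (-s)

/-- The point of `ℝ^(n+1)` with `i`-th coordinate `t` and remaining coordinates `x`. -/
def ins {n : ℕ} (i : Fin (n + 1)) (t : ℝ) (x : Fin n → ℝ) : Euc (n + 1) :=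
  WithLp.toLp 2 (i.insertNth t x : Fin (n + 1) → ℝ)

section Sing

variable {E : Type*} [NormedAddCommGroup E] {ρ s : ℝ}

lemma sing_rpow {θ : ℝ} (hθ : 0 < θ) (x : E) : sing ρ s x ^ θ = sing ρ (s * θ) x := by
  by_cases hx : x ∈ ball 0 ρ
  · rw [sing, sing, indicator_of_mem hx, indicator_of_mem hx, ← ENNReal.rpow_mul, neg_mul]
  · rw [sing, sing, indicator_of_notMem hx, indicator_of_notMem hx, ENNReal.zero_rpow_of_pos hθ]

lemma sing_neg (x : E) : sing ρ s (-x) = sing ρ s x := by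
  simp [sing, indicator]

variable [MeasurableSpace E] [BorelSpace E]

lemma measurable_sing : Measurable (sing ρ s : E → ℝ≥0∞) :=
  (measurable_enorm.pow_const _).indicator measurableSet_ball

lemma lintegral_sing_lt_top [NormedSpace ℝ E] [FiniteDimensional ℝ E] (μ : Measure E)
    [μ.IsAddHaarMeasure] (hd : 1 ≤ Module.finrank ℝ E) (hs : s < Module.finrank ℝ E) :
    ∫⁻ x, sing ρ s x ∂μ < ⊤ := by
  have : Nontrivial E := Module.nontrivial_of_finrank_pos (R := ℝ) (by omega)
  have h := (integrableOn_ball_of_norm_le_rpow (μ := μ) hd (f := fun x : E => ‖x‖ ^ (-s))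
    (C := 1) (r := ρ) hs (Filter.Eventually.of_forall fun x => by
      rw [one_mul, Real.norm_of_nonneg (by positivity)])
    (measurable_norm.pow_const _).aestronglyMeasurable).2
  rw [sing, lintegral_indicator measurableSet_ball]
  refine lt_of_le_of_lt (lintegral_mono_ae ?_) h
  have hne : ∀ᵐ x ∂μ, x ≠ 0 := by simp [ae_iff]
  filter_upwards [ae_restrict_of_ae hne] with x hx
  rw [Real.enorm_of_nonneg (by positivity), ← ofReal_norm,
    ENNReal.ofReal_rpow_of_pos (norm_pos_iff.mpr hx)]

end Sing

section Young

variable {X Y : Type*} [MeasurableSpace X] [MeasurableSpace Y]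

lemma lintegral_kernel_mul_le {τ : Measure Y} {k f : Y → ℝ≥0∞} (hk : Measurable k)
    (hf : Measurable f) {κ z : ℝ} (hz : 0 < z) (hzκ : z ≤ κ) (hκ : κ ≤ 1) :
    ∫⁻ y, k y ^ (1 + z - κ) * f y ^ κ ∂τ ≤
      (∫⁻ y, k y * f y ∂τ) ^ z * (∫⁻ y, k y ∂τ) ^ (1 - κ) * (∫⁻ y, f y ∂τ) ^ (κ - z) := by
  have h := ENNReal.lintegral_prod_norm_pow_le (μ := τ) (Finset.univ : Finset (Fin 3))
    (f := ![fun y => k y * f y, k, f]) (p := ![z, 1 - κ, κ - z])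
    (by
      intro i _
      fin_cases i
      · exact (hk.mul hf).aemeasurable
      · exact hk.aemeasurable
      · exact hf.aemeasurable)
    (by simp [Fin.sum_univ_three]; ring)
    (by
      intro i _
      fin_cases i
      · exact hz.le
      · simpa using hκ
      · simpa using hzκ)
  simp only [Fin.prod_univ_three] at h
  change ∫⁻ y, (k y * f y) ^ z * k y ^ (1 - κ) * f y ^ (κ - z) ∂τ ≤ _ at h
  refine le_trans (lintegral_mono fun y => le_of_eq ?_) h
  rw [ENNReal.mul_rpow_of_nonneg _ _ hz.le, mul_right_comm (k y ^ z),
    ← ENNReal.rpow_add_of_nonneg _ _ hz.le (by linarith), mul_assoc,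
    ← ENNReal.rpow_add_of_nonneg _ _ hz.le (by linarith)]
  congr 2 <;> ring

/-- A Young-type inequality for integral operators whose kernel has bounded marginals. -/
theorem lintegral_kernel_rpow_le {μ : Measure X} {τ : Measure Y} [SFinite μ] [SFinite τ]
    {K : X → Y → ℝ≥0∞} (hK : Measurable (Function.uncurry K)) {f : Y → ℝ≥0∞} (hf : Measurable f)
    {κ z : ℝ} (hz : 0 < z) (hzκ : z ≤ κ) (hκ : κ ≤ 1) {A : ℝ≥0∞}
    (h1 : ∀ x, ∫⁻ y, K x y ∂τ ≤ A) (h2 : ∀ y, ∫⁻ x, K x y ∂μ ≤ A) :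
    ∫⁻ x, (∫⁻ y, K x y ^ (1 + z - κ) * f y ^ κ ∂τ) ^ (1 / z) ∂μ ≤
      A ^ ((1 + z - κ) / z) * (∫⁻ y, f y ∂τ) ^ (κ / z) := by
  set F := ∫⁻ y, f y ∂τ with hF
  have hz' : 0 ≤ 1 / z := by positivity
  have e1 : 0 ≤ (1 - κ) / z := div_nonneg (by linarith) hz.le
  have e2 : 0 ≤ (κ - z) / z := div_nonneg (by linarith) hz.le
  have hmeas : Measurable fun p : X × Y => K p.1 p.2 * f p.2 := hK.mul (hf.comp measurable_snd)
  calc ∫⁻ x, (∫⁻ y, K x y ^ (1 + z - κ) * f y ^ κ ∂τ) ^ (1 / z) ∂μ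
      ≤ ∫⁻ x, (∫⁻ y, K x y * f y ∂τ) * (A ^ ((1 - κ) / z) * F ^ ((κ - z) / z)) ∂μ := by
        refine lintegral_mono fun x => ?_
        refine (ENNReal.rpow_le_rpow (lintegral_kernel_mul_le hK.of_uncurry_left hf hz hzκ hκ)
          hz').trans ?_
        rw [ENNReal.mul_rpow_of_nonneg _ _ hz', ENNReal.mul_rpow_of_nonneg _ _ hz',
          ← ENNReal.rpow_mul, ← ENNReal.rpow_mul, ← ENNReal.rpow_mul, mul_one_div_cancel hz.ne',
          ENNReal.rpow_one, mul_one_div, mul_one_div, mul_assoc]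
        gcongr
        exact h1 x
    _ = (∫⁻ y, (∫⁻ x, K x y ∂μ) * f y ∂τ) * (A ^ ((1 - κ) / z) * F ^ ((κ - z) / z)) := by
        rw [lintegral_mul_const _ hmeas.lintegral_prod_right', lintegral_lintegral_swap
          hmeas.aemeasurable]
        congr 1
        refine lintegral_congr fun y => ?_
        exact lintegral_mul_const (f y) (hK.of_uncurry_right (y := y))
    _ ≤ (A * F) * (A ^ ((1 - κ) / z) * F ^ ((κ - z) / z)) := by
        gcongr
        rw [hF, ← lintegral_const_mul _ hf]
        exact lintegral_mono fun y => mul_le_mul_left (h2 y) _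
    _ = A ^ ((1 + z - κ) / z) * F ^ (κ / z) := by
        have a1 : (1 + z - κ) / z = 1 + (1 - κ) / z := by field_simp; ring
        have a2 : κ / z = 1 + (κ - z) / z := by field_simp; ring
        rw [a1, a2, ENNReal.rpow_add_of_nonneg _ _ zero_le_one e1,
          ENNReal.rpow_add_of_nonneg _ _ zero_le_one e2, ENNReal.rpow_one, ENNReal.rpow_one]
        ring

end Young

section Slice

variable {n : ℕ} {i : Fin (n + 1)} {t : ℝ} {x : Fin n → ℝ}

@[simp] lemma ins_same : ins i t x i = t := by simp [ins]

@[simp] lemma ins_succAbove (j : Fin n) : ins i t x (i.succAbove j) = x j := by simp [ins]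

lemma lintegral_ins (i : Fin (n + 1)) (g : Euc (n + 1) → ℝ≥0∞) :
    ∫⁻ y, g y = ∫⁻ p : ℝ × (Fin n → ℝ), g (ins i p.1 p.2) := by
  have h1 := (PiLp.volume_preserving_toLp (Fin (n + 1))).lintegral_comp_emb
    (MeasurableEquiv.toLp 2 (Fin (n + 1) → ℝ)).measurableEmbedding g
  have h2 := (volume_preserving_piFinSuccAbove (fun _ : Fin (n + 1) => ℝ) i).symm.lintegral_comp_emb
    (MeasurableEquiv.piFinSuccAbove (fun _ : Fin (n + 1) => ℝ) i).symm.measurableEmbedding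
    (fun y => g (WithLp.toLp 2 y))
  rw [← h1, ← h2]
  rfl

lemma measurable_ins (i : Fin (n + 1)) :
    Measurable fun p : ℝ × (Fin n → ℝ) => ins i p.1 p.2 :=
  (MeasurableEquiv.toLp 2 (Fin (n + 1) → ℝ)).measurable.comp
    (MeasurableEquiv.piFinSuccAbove (fun _ : Fin (n + 1) => ℝ) i).symm.measurable

lemma enorm_sub_le_ins (i : Fin (n + 1)) (s t : ℝ) (x y : Fin n → ℝ) :
    ‖s - t‖ₑ ≤ ‖ins i s y - ins i t x‖ₑ ∧ ‖y - x‖ₑ ≤ ‖ins i s y - ins i t x‖ₑ := by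
  have h := fun j => PiLp.norm_apply_le (ins i s y - ins i t x) j
  constructor
  · rw [enorm_le_iff_norm_le]
    simpa using h i
  · rw [enorm_le_iff_norm_le, pi_norm_le_iff_of_nonneg (norm_nonneg _)]
    intro j
    simpa using h (i.succAbove j)

lemma enorm_rpow_neg_le_of_le {a b : ℝ≥0∞} {r : ℝ} (hr : 0 ≤ r) (h : a ≤ b) :
    b ^ (-r) ≤ a ^ (-r) := by
  rw [ENNReal.rpow_neg, ENNReal.rpow_neg]
  exact ENNReal.inv_le_inv.mpr (ENNReal.rpow_le_rpow h hr)

lemma sing_ins_le {ρ m r : ℝ} (hr : 0 ≤ r) (hr' : r ≤ m) (i : Fin (n + 1)) (s t : ℝ)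
    (x y : Fin n → ℝ) :
    sing ρ m (ins i s y - ins i t x) ≤ sing ρ r (s - t) * sing ρ (m - r) (y - x) := by
  by_cases h : ins i s y - ins i t x ∈ ball 0 ρ
  · obtain ⟨h1, h2⟩ := enorm_sub_le_ins i s t x y
    have h1' := enorm_le_iff_norm_le.mp h1
    have h2' := enorm_le_iff_norm_le.mp h2
    rw [mem_ball_zero_iff] at h
    rw [sing, sing, sing, indicator_of_mem (by simpa using h), indicator_of_mem
      (mem_ball_zero_iff.mpr (h1'.trans_lt h)), indicator_of_mem
      (mem_ball_zero_iff.mpr (h2'.trans_lt h))]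
    rcases eq_or_ne (ins i s y - ins i t x) 0 with h0 | h0
    · have : s - t = 0 := by
        have := h1'; rw [h0, norm_zero] at this; exact norm_le_zero_iff.mp this
      have h3 : y - x = 0 := by
        have := h2'; rw [h0, norm_zero] at this; exact norm_le_zero_iff.mp this
      rw [h0, this, h3, enorm_zero, enorm_zero, enorm_zero]
      rcases hr.eq_or_lt with rfl | hr0
      · simp
      rw [ENNReal.zero_rpow_of_neg (by linarith : -r < 0)]
      rcases hr'.eq_or_lt with rfl | hr1
      · simp
      · rw [ENNReal.zero_rpow_of_neg (by linarith : -(m - r) < 0)]; simp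
    · rw [show -m = -r + -(m - r) by ring, ENNReal.rpow_add _ _ (by simpa using h0) enorm_ne_top]
      exact mul_le_mul' (enorm_rpow_neg_le_of_le hr h1)
        (enorm_rpow_neg_le_of_le (by linarith) h2)
  · rw [sing, indicator_of_notMem h]; exact zero_le

lemma setLIntegral_ball_eq_sing {N : ℕ} {ρ m : ℝ} (x : Euc N) (h : Euc N → ℝ≥0∞) :
    ∫⁻ y in ball x ρ, ‖y - x‖ₑ ^ (-m) * h y = ∫⁻ y, sing ρ m (y - x) * h y := by
  rw [← lintegral_indicator measurableSet_ball]
  refine lintegral_congr fun y => ?_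
  by_cases hy : y ∈ ball x ρ
  · rw [indicator_of_mem hy, sing, indicator_of_mem (by simpa [dist_eq_norm] using hy)]
  · rw [indicator_of_notMem hy, sing, indicator_of_notMem (by simpa [dist_eq_norm] using hy),
      zero_mul]

theorem exists_slice_bound (hn : 1 ≤ n) (ρ : ℝ) {m d κ z : ℝ} (hd : 0 < d) (hd1 : d ≤ 1)
    (hz : 0 < z) (hzκ : z ≤ κ) (hκ : κ ≤ 1) (hm0 : 0 ≤ m - (1 - d))
    (hm : m - (1 - d) < n * (1 + z - κ)) : ∃ C : ℝ≥0,
    ∀ f : Euc (n + 1) → ℝ≥0∞, Measurable f → ∀ i t,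
      ∫⁻ x, (∫⁻ y in ball (ins i t x) ρ, ‖y - ins i t x‖ₑ ^ (-m) * f y ^ κ) ^ (1 / z) ≤
        C * (∫⁻ y, sing ρ (1 - d) (y i - t) * f y) ^ (κ / z) := by
  set θ := 1 + z - κ with hθ
  have hθ0 : 0 < θ := by rw [hθ]; linarith
  set r := (m - (1 - d)) / θ with hr
  set A₁ := ∫⁻ t : ℝ, sing ρ (1 - d) t with hA₁
  set A₂ := ∫⁻ w : Fin n → ℝ, sing ρ r w with hA₂
  have hA₁t : A₁ < ⊤ := lintegral_sing_lt_top volume (by simp) (by simp; linarith)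
  have hA₂t : A₂ < ⊤ := lintegral_sing_lt_top volume (by simpa using hn) (by
    rw [hr, div_lt_iff₀ hθ0]; simpa using hm)
  set A := A₁ * A₂ + A₂ with hA
  have hAt : A < ⊤ := ENNReal.add_lt_top.mpr ⟨ENNReal.mul_lt_top hA₁t hA₂t, hA₂t⟩
  have hAt' : A ^ (θ / z) ≠ ⊤ := ENNReal.rpow_ne_top_of_nonneg (by positivity) hAt.ne
  refine ⟨(A ^ (θ / z)).toNNReal, fun f hf i t => ?_⟩
  rw [ENNReal.coe_toNNReal hAt']
  have hw : Measurable fun p : ℝ × (Fin n → ℝ) => sing ρ (1 - d) (p.1 - t) :=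
    measurable_sing.comp (measurable_fst.sub_const t)
  set τ : Measure (ℝ × (Fin n → ℝ)) := volume.withDensity fun p => sing ρ (1 - d) (p.1 - t)
    with hτ
  have hτi : ∀ g : ℝ × (Fin n → ℝ) → ℝ≥0∞, Measurable g →
      ∫⁻ p, g p ∂τ = ∫⁻ p, sing ρ (1 - d) (p.1 - t) * g p := fun g hg => by
    rw [hτ, lintegral_withDensity_eq_lintegral_mul _ hw hg]; rfl
  set K : (Fin n → ℝ) → ℝ × (Fin n → ℝ) → ℝ≥0∞ := fun x p => sing ρ r (p.2 - x) with hK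
  have hKm : Measurable (Function.uncurry K) :=
    measurable_sing.comp ((measurable_snd.comp measurable_snd).sub measurable_fst)
  have hKx : ∀ x, Measurable (K x) := fun x => hKm.of_uncurry_left
  have hfm := hf.comp (measurable_ins i)
  have main := lintegral_kernel_rpow_le (μ := (volume : Measure (Fin n → ℝ))) (τ := τ) (A := A)
    hKm hfm hz hzκ hκ (fun x => ?_) (fun p => ?_)
  · refine le_trans (lintegral_mono fun x => ?_) (main.trans (le_of_eq ?_))
    · refine ENNReal.rpow_le_rpow ?_ (by positivity)
      change _ ≤ ∫⁻ p, K x p ^ (1 + z - κ) * f (ins i p.1 p.2) ^ κ ∂τ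
      rw [setLIntegral_ball_eq_sing (ins i t x) fun y => f y ^ κ, lintegral_ins i, hτi _
        (show Measurable fun p : ℝ × (Fin n → ℝ) =>
          K x p ^ (1 + z - κ) * f (ins i p.1 p.2) ^ κ from
          ((hKx x).pow_const _).mul (hfm.pow_const _))]
      refine lintegral_mono fun p => ?_
      rw [← mul_assoc]
      refine mul_le_mul_left ((sing_ins_le (by linarith : 0 ≤ 1 - d) (by linarith) i p.1 t x
        p.2).trans (le_of_eq ?_)) _
      rw [hK, sing_rpow hθ0, hr, div_mul_cancel₀ _ hθ0.ne']
    · rw [hτi _ hfm, lintegral_ins i fun y => sing ρ (1 - d) (y i - t) * f y]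
      simp [hθ]
  · rw [hτi _ (hKx x), Measure.volume_eq_prod, lintegral_prod_mul
      (f := fun s => sing ρ (1 - d) (s - t)) (g := fun y => sing ρ r (y - x))
      (measurable_sing.comp (measurable_id.sub_const t)).aemeasurable
      (measurable_sing.comp (measurable_id.sub_const x)).aemeasurable,
      lintegral_sub_right_eq_self (fun s => sing ρ (1 - d) s) t,
      lintegral_sub_right_eq_self (fun s => sing ρ r s) x]
    exact le_self_add
  · have : ∫⁻ x, K x p = A₂ := by
      rw [hA₂, ← lintegral_sub_right_eq_self (fun s => sing ρ r s) p.2]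
      refine lintegral_congr fun x => ?_
      rw [hK, ← sing_neg]; simp
    rw [this]; exact le_add_self

lemma lintegral_slice_weight {ρ d : ℝ} {f : Euc (n + 1) → ℝ≥0∞}
    (hf : Measurable f) (i : Fin (n + 1)) :
    ∫⁻ t : ℝ, ∫⁻ y, sing ρ (1 - d) (y i - t) * f y =
      (∫⁻ t : ℝ, sing ρ (1 - d) t) * ∫⁻ y, f y := by
  have hc : Measurable fun y : Euc (n + 1) => y i := by fun_prop
  rw [lintegral_lintegral_swap]
  · rw [← lintegral_const_mul _ hf]
    refine lintegral_congr fun y => ?_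
    have hm : Measurable fun x : ℝ => sing ρ (1 - d) (y i - x) :=
      measurable_sing.comp (measurable_const.sub measurable_id)
    rw [lintegral_mul_const _ hm]
    congr 1
    exact lintegral_sub_left_eq_self (fun s => sing ρ (1 - d) s) (y i)
  · exact ((measurable_sing.comp ((hc.comp measurable_snd).sub measurable_fst)).mul
      (hf.comp measurable_snd)).aemeasurable

end Slice

/-- The admissibility conditions on the auxiliary exponents of the feedback estimate. -/
structure IsAdmissible (n : ℕ) (p q s σ μ z l d : ℝ) : Prop where
  σ_pos : 0 < σ
  μ_nonneg : 0 ≤ μ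
  μ_le : μ ≤ 1
  le_κ : 1 / (q + 1) ≤ p / σ
  κ_le : p / σ ≤ 1
  σ_le : σ ≤ (1 - μ) * s + μ * (p + 1)
  d_pos : 0 < d
  d_le : d ≤ 1
  slice_fst : (n - 1 : ℝ) - (1 - d) < n * (1 + 1 / (q + 1) - p / σ)
  slice_grad : (n : ℝ) - (1 - d) < n * (1 - (p / σ - 1 / (q + 1)) / 2)
  z_pos : 0 < z
  z_le : z ≤ q / (q + 1)
  slice_snd : (n - 1 : ℝ) - (1 - d) < n * (1 + z - q / (q + 1))
  l_nonneg : 0 ≤ l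
  l_le : l ≤ 1
  p_le : p + 1 ≤ (1 - l) * s + l / z
  cost_fst : p / σ * μ * (q + 1) < 1
  cost_snd : l * (q / (q + 1)) / z < 1

lemma exists_d {n q κ z y : ℝ} (h1 : n * (κ - 1 / (q + 1)) < 2) (h2 : n * (y - z) < 2) :
    ∃ d : ℝ, 0 < d ∧ d ≤ 1 ∧ (n - 1) - (1 - d) < n * (1 + 1 / (q + 1) - κ) ∧
      n - (1 - d) < n * (1 - (κ - 1 / (q + 1)) / 2) ∧ (n - 1) - (1 - d) < n * (1 + z - y) := by
  set d := min 1 (min ((2 - n * (κ - 1 / (q + 1))) / 4) ((2 - n * (y - z)) / 2))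
  have hd1 : d ≤ (2 - n * (κ - 1 / (q + 1))) / 4 := (min_le_right _ _).trans (min_le_left _ _)
  have hd2 : d ≤ (2 - n * (y - z)) / 2 := (min_le_right _ _).trans (min_le_right _ _)
  refine ⟨d, lt_min one_pos (lt_min (by linarith) (by linarith)), min_le_left _ _, ?_, ?_, ?_⟩
  · linarith [mul_sub n κ (1 / (q + 1)), mul_sub n (1 + 1 / (q + 1)) κ,
      mul_add n 1 (1 / (q + 1))]
  · linarith [mul_sub n 1 ((κ - 1 / (q + 1)) / 2), mul_div_assoc n (κ - 1 / (q + 1)) 2]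
  · linarith [mul_sub n y z, mul_sub n (1 + z) y, mul_add n 1 z]

set_option maxHeartbeats 1000000 in
theorem exists_isAdmissible {n : ℕ} {p q s : ℝ} (hn : 2 ≤ n) (hp : 0 < p) (hq : 0 < q)
    (hpq : 1 < p * q) (hs : p ≤ s) (hns : n < s * (2 * (q + 1) / (p * q - 1))) :
    ∃ σ μ z l d, IsAdmissible n p q s σ μ z l d := by
  have hn0 : (0 : ℝ) < n := by positivity
  have hs0 : 0 < s := hp.trans_le hs
  have hk : (p * q - 1) / (s * (q + 1)) < 2 / n := by
    rw [div_lt_div_iff₀ (by positivity) hn0]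
    rw [← mul_div_assoc, lt_div_iff₀ (by linarith)] at hns
    linarith
  have hκn : ∀ {κ : ℝ}, κ < 1 / (q + 1) + 2 / n → n * (κ - 1 / (q + 1)) < 2 := fun h => by
    have : _ - 1 / (q + 1) < 2 / n := sub_lt_iff_lt_add'.mpr h
    rwa [lt_div_iff₀ hn0, mul_comm] at this
  rcases lt_or_ge s (p + 1) with hsp | hsp
  · have h0 : (s + p * q - 1) / (s * (q + 1)) < min (p / s) (1 / (q + 1) + 2 / n) := by
      refine lt_min ?_ ?_
      · rw [div_lt_div_iff₀ (by positivity) hs0]; nlinarith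
      · have : (s + p * q - 1) / (s * (q + 1)) = 1 / (q + 1) + (p * q - 1) / (s * (q + 1)) := by
          field_simp; ring
        linarith
    obtain ⟨κ, hκ0, hκ⟩ := exists_between h0
    have hκs := lt_min_iff.mp hκ
    have hκ1 : s + p * q - 1 < κ * (s * (q + 1)) := by rwa [div_lt_iff₀ (by positivity)] at hκ0
    have hκ2 : κ * s < p := by rw [← lt_div_iff₀ hs0]; exact hκs.1
    have hκpos : 0 < κ := by
      refine lt_trans (div_pos ?_ (by positivity)) hκ0
      linarith
    have hκ3 : p < κ * (p + 1) := by
      by_contra! hc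
      nlinarith [mul_pos hs0 (by linarith : 0 < q + 1), mul_pos (sub_pos.mpr hpq)
        (sub_pos.mpr hsp), mul_le_mul_of_nonneg_right hc (by positivity : 0 ≤ s * (q + 1))]
    have hz0 : max 0 (q / (q + 1) - 2 / n) < (1 + s * q - p * q) / ((q + 1) * s) := by
      refine max_lt (div_pos (by nlinarith) (by positivity)) ?_
      have : (1 + s * q - p * q) / ((q + 1) * s) = q / (q + 1) - (p * q - 1) / (s * (q + 1)) := by
        field_simp; ring
      linarith
    obtain ⟨z, hz1, hz2⟩ := exists_between hz0
    obtain ⟨hz, hzn⟩ := max_lt_iff.mp hz1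
    rw [lt_div_iff₀ (by positivity)] at hz2
    have hz3 : z * (p + 1) < 1 := by
      have hx : (p + 1) * (1 + s * q - p * q) < (q + 1) * s := by
        nlinarith [mul_pos (sub_pos.mpr hpq) (sub_pos.mpr hsp)]
      have hy := mul_lt_mul_of_pos_left hz2 (by linarith : 0 < p + 1)
      by_contra! hc
      nlinarith [mul_le_mul_of_nonneg_right hc (by positivity : 0 ≤ (q + 1) * s)]
    have hsz : 0 < 1 - s * z := by nlinarith
    have hyz : z ≤ q / (q + 1) := by
      rw [le_div_iff₀ (by linarith)]
      by_contra! hc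
      nlinarith [mul_lt_mul_of_pos_left hc hz, mul_lt_mul_of_pos_left hc hp]
    have hyn : (n : ℝ) * (q / (q + 1) - z) < 2 := by
      have : q / (q + 1) - z < 2 / n := by linarith
      rwa [lt_div_iff₀ hn0, mul_comm] at this
    obtain ⟨d, hd, hd1, hd2, hd3, hd4⟩ := exists_d (hκn hκs.2) hyn
    have hps : 0 < p + 1 - s := by linarith
    have hpκ : p / (p / κ) = κ := by field_simp
    refine ⟨p / κ, (p / κ - s) / (p + 1 - s), z, (p + 1 - s) * z / (1 - s * z), d,
      by positivity, ?_, ?_, ?_, ?_, ?_, hd, hd1, by rwa [hpκ], by rwa [hpκ], hz, hyz, hd4, ?_, ?_,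
      ?_, ?_, ?_⟩
    · refine div_nonneg ?_ hps.le
      rw [sub_nonneg, le_div_iff₀ hκpos]; linarith
    · rw [div_le_one hps]
      have : p / κ < p + 1 := by rw [div_lt_iff₀ hκpos]; linarith
      linarith
    · rw [hpκ, div_le_iff₀ (by linarith)]
      by_contra! hc
      have := mul_lt_mul_of_pos_left hc hs0
      nlinarith [mul_pos (sub_pos.mpr hpq) hs0]
    · rw [hpκ]
      have : κ * s < p * 1 := by linarith
      by_contra! hc
      have := mul_lt_mul_of_pos_right hc hs0
      linarith
    · apply le_of_eq; field_simp; ring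
    · positivity
    · rw [div_le_one hsz]; nlinarith
    · apply le_of_eq; field_simp; ring
    · rw [hpκ]
      have : κ * ((p / κ - s) / (p + 1 - s)) * (q + 1) = (p - κ * s) * (q + 1) / (p + 1 - s) := by
        field_simp
      rw [this, div_lt_one hps]; nlinarith
    · have : (p + 1 - s) * z / (1 - s * z) * (q / (q + 1)) / z =
        (p + 1 - s) * q / ((1 - s * z) * (q + 1)) := by field_simp
      rw [this, div_lt_one (by positivity)]; nlinarith
  · have hq1 : 1 / (q + 1) < 1 := by rw [div_lt_one (by linarith)]; linarith
    have h2n : 0 < 2 / (n : ℝ) := by positivity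
    have h0 : max (p / s) (1 / (q + 1)) < min 1 (1 / (q + 1) + 2 / n) := by
      refine max_lt (lt_min ?_ ?_) (lt_min hq1 (by linarith))
      · rw [div_lt_one hs0]; linarith
      · have : p / s ≤ 1 / (q + 1) + (p * q - 1) / (s * (q + 1)) := by
          rw [div_add_div _ _ (by positivity) (by positivity), div_le_div_iff₀ hs0 (by positivity)]
          nlinarith [mul_nonneg (mul_nonneg hs0.le (by positivity : 0 ≤ q + 1))
            (sub_nonneg.mpr hsp)]
        linarith
    obtain ⟨κ, hκ0, hκ⟩ := exists_between h0
    obtain ⟨hκs, hκq⟩ := max_lt_iff.mp hκ0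
    obtain ⟨hκ1, hκ2⟩ := lt_min_iff.mp hκ
    have hκpos : 0 < κ := lt_trans (by positivity) hκs
    have hpκ : p / (p / κ) = κ := by field_simp
    obtain ⟨d, hd, hd1, hd2, hd3, hd4⟩ := exists_d (z := q / (q + 1)) (y := q / (q + 1))
      (hκn hκ2) (by simp)
    refine ⟨p / κ, 0, q / (q + 1), 0, d, by positivity, le_rfl, zero_le_one, by
      rw [hpκ]; exact hκq.le, by rw [hpκ]; exact hκ1.le, ?_, hd, hd1, by rwa [hpκ], by rwa [hpκ],
      by positivity, le_rfl, hd4, le_rfl, zero_le_one, by simpa using hsp, by simp, by simp⟩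
    rw [div_lt_iff₀ hs0] at hκs
    rw [div_le_iff₀ hκpos]; linarith

section Pointwise

variable {N : ℕ} {p q a b : ℝ} {u v : Euc N → ℝ}

/-- The Riesz-type potential of order `m` over the ball of radius `1/4`, evaluated at `x`. -/
def pot (m : ℝ) (f : Euc N → ℝ≥0∞) (x : Euc N) : ℝ≥0∞ :=
  ∫⁻ y in ball x (1 / 4), ‖y - x‖ₑ ^ (-m) * f y

lemma measurable_pot (m : ℝ) {f : Euc N → ℝ≥0∞} (hf : Measurable f) : Measurable (pot m f) := by
  have : pot m f = fun x => ∫⁻ y, sing (1 / 4) m (y - x) * f y :=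
    funext fun x => setLIntegral_ball_eq_sing x f
  rw [this]
  exact ((measurable_sing.comp (measurable_snd.sub measurable_fst)).mul
    (hf.comp measurable_snd)).lintegral_prod_right'

lemma pot_mono_order {m m' : ℝ} (h : m ≤ m') (f : Euc N → ℝ≥0∞) (x : Euc N) :
    pot m f x ≤ pot m' f x := by
  refine setLIntegral_mono' measurableSet_ball fun y hy => ?_
  gcongr ?_ * _
  refine ENNReal.rpow_le_rpow_of_exponent_ge ?_ (neg_le_neg h)
  rw [mem_ball, dist_eq_norm] at hy
  rw [← ofReal_norm]
  exact ENNReal.ofReal_le_one.mpr (by linarith)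

lemma mem_shell {Λ : ℝ} {x : Euc N} : x ∈ shell N Λ ↔ 1 / 2 ≤ ‖x‖ ∧ ‖x‖ ≤ Λ := by
  simp [shell, and_comm]

lemma measurableSet_shell (N : ℕ) (Λ : ℝ) : MeasurableSet (shell N Λ) :=
  measurableSet_closedBall.diff measurableSet_ball

lemma ball_subset_shell {Λ : ℝ} {x : Euc N} (h1 : 1 ≤ ‖x‖) (h2 : ‖x‖ ≤ Λ) :
    closedBall x (1 / 4) ⊆ shell N (Λ + 1) := fun y hy => by
  rw [mem_closedBall, dist_eq_norm] at hy
  have h := abs_le.mp (abs_norm_sub_norm_le y x)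
  exact mem_shell.mpr ⟨by linarith, by linarith⟩

lemma IsNNSol.enorm_lap_le (h : IsNNSol p q a b u v) (hp : 0 < p) {Λ : ℝ} {y : Euc N}
    (hy : y ∈ shell N Λ) :
    ‖lap u y‖ₑ ≤ (max ((1 / 2 : ℝ) ^ a) (Λ ^ a)).toNNReal * ‖v y‖ₑ ^ p := by
  obtain ⟨h1, h2⟩ := mem_shell.mp hy
  rw [h.enorm_lap_fst hp (norm_pos_iff.mp (by linarith))]
  gcongr
  exact ENNReal.ofReal_le_ofReal (rpow_mem_Icc_of_mem_Icc (by norm_num) ⟨h1, h2⟩ a).2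

theorem exists_pointwise_bound (hN : 3 ≤ N) (hp : 0 < p) (hq : 0 < q) (hpq : 1 < p * q)
    (a b Λ : ℝ) : ∃ C : ℝ≥0, ∀ u v : Euc N → ℝ, IsNNSol p q a b u v → ∀ x, 1 ≤ ‖x‖ → ‖x‖ ≤ Λ →
      ‖u x‖ₑ ≤ C * (pot (N - 2) ((shell N (Λ + 1)).indicator fun y => ‖v y‖ₑ ^ p) x + 1) ∧
      (∑ i, ‖pd i u x‖ₑ) + ‖u x‖ₑ ≤
        C * (pot (N - 1) ((shell N (Λ + 1)).indicator fun y => ‖v y‖ₑ ^ p) x + 1) := by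
  obtain ⟨C₁, h₁⟩ := exists_potential_upper hN (by norm_num : (0 : ℝ) < 1 / 4)
  obtain ⟨C₂, h₂⟩ := exists_apriori_bound hN hp hq hpq a b (Λ + 1)
  set κ := (max ((1 / 2 : ℝ) ^ a) ((Λ + 1) ^ a)).toNNReal with hκ
  set C := C₁ * (κ + C₂)
  refine ⟨C + (N + 1) * C, fun u v h x hx1 hx2 => ?_⟩
  set f := (shell N (Λ + 1)).indicator fun y => ‖v y‖ₑ ^ p
  have hsub := ball_subset_shell hx1 hx2
  have hpot : ∀ m : ℝ, (∫⁻ y in ball x (1 / 4), ‖y - x‖ₑ ^ (-m) * ‖lap u y‖ₑ) ≤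
      κ * pot m f x := fun m => by
    rw [pot, ← lintegral_const_mul' _ _ ENNReal.coe_ne_top]
    refine setLIntegral_mono' measurableSet_ball fun y hy => ?_
    have hy' := hsub (ball_subset_closedBall hy)
    rw [mul_left_comm, show f y = ‖v y‖ₑ ^ p from indicator_of_mem hy' _]
    gcongr
    exact h.enorm_lap_le hp hy'
  have hmass : ∫⁻ y in ball x (1 / 4), ‖u y‖ₑ ≤ C₂ :=
    (lintegral_mono_set (ball_subset_closedBall.trans hsub)).trans (h₂ u v h).1
  have key : ∀ m : ℝ, ∀ w : ℝ≥0∞, w ≤ C₁ * ((∫⁻ y in ball x (1 / 4), ‖y - x‖ₑ ^ (-m) *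
      ‖lap u y‖ₑ) + ∫⁻ y in ball x (1 / 4), ‖u y‖ₑ) → w ≤ C * (pot m f x + 1) := fun m w hw => by
    refine hw.trans ?_
    rw [show (C : ℝ≥0∞) = C₁ * (κ + C₂) by simp [C], mul_assoc, add_mul]
    gcongr
    · exact (hpot m).trans (mul_le_mul_right le_self_add _)
    · exact hmass.trans (le_mul_of_one_le_right' le_add_self)
  obtain ⟨g1, g2⟩ := h₁ x u fun y hy => h.contDiffAt_fst y (norm_pos_iff.mp (by
    linarith [(mem_shell.mp (hsub hy)).1]))
  have k1 := key _ _ g1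
  refine ⟨k1.trans (by gcongr; simp), ?_⟩
  calc (∑ i, ‖pd i u x‖ₑ) + ‖u x‖ₑ
      ≤ (∑ _i : Fin N, C * (pot (N - 1) f x + 1)) + C * (pot (N - 1) f x + 1) := by
        gcongr with i
        · exact key _ _ (g2 i)
        · exact k1.trans (by gcongr; exact pot_mono_order (by linarith) f x)
    _ = ((N + 1) * C) * (pot (N - 1) f x + 1) := by
        rw [Finset.sum_const, Finset.card_univ, Fintype.card_fin, nsmul_eq_mul]; ring
    _ ≤ _ := by
        gcongr
        push_cast
        exact le_add_self

end Pointwise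

section Aux

lemma ENNReal.rpow_le_one_add_rpow (a : ℝ≥0∞) {r e : ℝ} (hr : 0 ≤ r) (h : r ≤ e) :
    a ^ r ≤ 1 + a ^ e := by
  rcases le_total a 1 with ha | ha
  · exact (ENNReal.rpow_le_one ha hr).trans le_self_add
  · exact (ENNReal.rpow_le_rpow_of_exponent_le ha h).trans le_add_self

lemma ENNReal.add_rpow_le_two_rpow_mul (a b : ℝ≥0∞) {r : ℝ} (hr : 0 ≤ r) :
    (a + b) ^ r ≤ 2 ^ r * (a ^ r + b ^ r) := by
  have h : ∀ a b : ℝ≥0∞, a ≤ b → (a + b) ^ r ≤ 2 ^ r * (a ^ r + b ^ r) := fun a b hab => by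
    calc (a + b) ^ r ≤ (2 * b) ^ r := by rw [two_mul]; gcongr
      _ = 2 ^ r * b ^ r := ENNReal.mul_rpow_of_nonneg _ _ hr
      _ ≤ _ := by gcongr; exact le_add_self
  rcases le_total a b with hab | hab
  · exact h a b hab
  · rw [add_comm a, add_comm (a ^ r)]; exact h b a hab

variable {α : Type*} [MeasurableSpace α] {μ : Measure α}

lemma lintegral_rpow_le_interpolation {f : α → ℝ≥0∞} (hf : AEMeasurable f μ) {τ s e l : ℝ}
    (hτ : 0 ≤ τ) (hs : 0 ≤ s) (he : 0 ≤ e) (hl : 0 ≤ l) (hl1 : l ≤ 1)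
    (h : τ ≤ (1 - l) * s + l * e) :
    ∫⁻ x, f x ^ τ ∂μ ≤ μ univ + (∫⁻ x, f x ^ s ∂μ) ^ (1 - l) * (∫⁻ x, f x ^ e ∂μ) ^ l := by
  calc ∫⁻ x, f x ^ τ ∂μ ≤ ∫⁻ x, (1 + (f x ^ s) ^ (1 - l) * (f x ^ e) ^ l) ∂μ := by
        refine lintegral_mono fun x => ?_
        rw [← ENNReal.rpow_mul, ← ENNReal.rpow_mul, ← ENNReal.rpow_add_of_nonneg _ _
          (mul_nonneg hs (by linarith)) (mul_nonneg he hl)]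
        exact ENNReal.rpow_le_one_add_rpow _ hτ (by linarith)
    _ = μ univ + ∫⁻ x, (f x ^ s) ^ (1 - l) * (f x ^ e) ^ l ∂μ := by
        rw [lintegral_add_left measurable_const, lintegral_one]
    _ ≤ _ := by
        gcongr
        exact ENNReal.lintegral_mul_norm_pow_le (hf.pow_const _) (hf.pow_const _) (by linarith) hl
          (by linarith)

lemma exists_mem_le_of_setLIntegral_le {J : Set α} (hJ : μ J = 1) {f : Fin 3 → α → ℝ≥0∞}
    (hf : ∀ k, Measurable (f k)) {K : ℝ≥0∞} {M : Fin 3 → ℝ≥0∞} (hM : ∀ k, 1 ≤ M k)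
    (hMt : ∀ k, M k ≠ ⊤) (h : ∀ k, ∫⁻ x in J, f k x ∂μ ≤ K * M k) :
    ∃ x ∈ J, ∀ k, f k x ≤ 3 * K * M k := by
  have h0 : ∀ k, M k ≠ 0 := fun k => (zero_lt_one.trans_le (hM k)).ne'
  obtain ⟨x, hx, hle⟩ := exists_le_setLAverage (μ := μ) (s := J)
    (f := fun x => ∑ k, f k x * (M k)⁻¹) (by simp [hJ]) (by simp [hJ])
    (Finset.measurable_sum _ fun k _ => (hf k).mul_const _).aemeasurable
  rw [setLAverage_eq, hJ, div_one, lintegral_finsetSum _ fun k _ => (hf k).mul_const _] at hle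
  have hb : ∑ k, ∫⁻ x in J, f k x * (M k)⁻¹ ∂μ ≤ 3 * K := by
    calc ∑ k, ∫⁻ x in J, f k x * (M k)⁻¹ ∂μ ≤ ∑ _k : Fin 3, K := by
          refine Finset.sum_le_sum fun k _ => ?_
          rw [lintegral_mul_const _ (hf k), ← div_eq_mul_inv]
          exact ENNReal.div_le_of_le_mul (h k)
      _ = 3 * K := by simp
  refine ⟨x, hx, fun k => ?_⟩
  have := (Finset.single_le_sum (f := fun k => f k x * (M k)⁻¹) (fun _ _ => zero_le)
    (Finset.mem_univ k)).trans (hle.trans hb)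
  rwa [← div_eq_mul_inv, ENNReal.div_le_iff (h0 k) (hMt k)] at this

end Aux

section Face

variable {n : ℕ}

/-- The cube `[-2, 2]^n`. -/
def cube (n : ℕ) : Set (Fin n → ℝ) := Icc (fun _ => -2) (fun _ => 2)

lemma volume_cube_ne_top : volume (cube n) ≠ ⊤ := isCompact_Icc.measure_lt_top.ne

lemma measurableSet_cube : MeasurableSet (cube n) := measurableSet_Icc

lemma norm_ins_bounds (i : Fin (n + 1)) {t : ℝ} (h1 : 1 ≤ |t|) (h2 : |t| ≤ 2) {x : Fin n → ℝ}
    (hx : x ∈ cube n) : 1 ≤ ‖ins i t x‖ ∧ ‖ins i t x‖ ≤ 2 * (n + 1) := by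
  have hj : ∀ j, ‖ins i t x j‖ ≤ 2 := fun j => by
    rcases Fin.eq_self_or_eq_succAbove i j with rfl | ⟨k, rfl⟩
    · simpa using h2
    · rw [ins_succAbove, Real.norm_eq_abs, abs_le]; exact ⟨hx.1 k, hx.2 k⟩
  refine ⟨h1.trans (by simpa using PiLp.norm_apply_le (ins i t x) i), ?_⟩
  rw [EuclideanSpace.norm_eq, Real.sqrt_le_left (by positivity)]
  calc ∑ j, ‖ins i t x j‖ ^ 2 ≤ ∑ _j : Fin (n + 1), (2 : ℝ) ^ 2 :=
        Finset.sum_le_sum fun j _ => pow_le_pow_left₀ (norm_nonneg _) (hj j) 2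
    _ = 4 * (n + 1) := by simp; ring
    _ ≤ (2 * (n + 1)) ^ 2 := by nlinarith [Nat.cast_nonneg (α := ℝ) n]

lemma exists_setLIntegral_rpow_le (hn : 1 ≤ n) {m d κ z μ : ℝ} (hd : 0 < d) (hd1 : d ≤ 1)
    (hz : 0 < z) (hzκ : z ≤ κ) (hκ : κ ≤ 1) (hμ : 0 ≤ μ) (hm0 : 0 ≤ m - (1 - d))
    (hm : m - (1 - d) < n * (1 + z - κ)) (K K' : ℝ≥0) : ∃ C : ℝ≥0,
    ∀ X : ℝ≥0∞, 1 ≤ X → ∀ f : Euc (n + 1) → ℝ≥0∞, Measurable f → ∀ i t,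
      (∫⁻ y, sing (1 / 4) (1 - d) (y i - t) * f y) ≤ K' * X ^ μ → ∀ W : (Fin n → ℝ) → ℝ≥0∞,
      (∀ x ∈ cube n, W x ≤ K * (pot m (fun y => f y ^ κ) (ins i t x) + 1)) →
      ∫⁻ x in cube n, W x ^ (1 / z) ≤ C * X ^ (μ * κ / z) := by
  obtain ⟨C, hC⟩ := exists_slice_bound hn (1 / 4) hd hd1 hz hzκ hκ hm0 hm
  have hz' : 0 ≤ 1 / z := by positivity
  have hκz : 0 ≤ κ / z := div_nonneg (hz.le.trans hzκ) hz.le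
  have hC' : (K : ℝ≥0∞) ^ (1 / z) * 2 ^ (1 / z) * (C * K' ^ (κ / z) + volume (cube n)) ≠ ⊤ := by
    refine ENNReal.mul_ne_top (ENNReal.mul_ne_top ?_ ?_) (ENNReal.add_ne_top.mpr
      ⟨ENNReal.mul_ne_top ENNReal.coe_ne_top ?_, volume_cube_ne_top⟩)
    · exact ENNReal.rpow_ne_top_of_nonneg hz' ENNReal.coe_ne_top
    · exact ENNReal.rpow_ne_top_of_nonneg hz' (by simp)
    · exact ENNReal.rpow_ne_top_of_nonneg hκz ENNReal.coe_ne_top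
  refine ⟨((K : ℝ≥0∞) ^ (1 / z) * 2 ^ (1 / z) * (C * K' ^ (κ / z) + volume (cube n))).toNNReal,
    fun X hX f hf i t hA W hW => ?_⟩
  rw [ENNReal.coe_toNNReal hC']
  have hX1 : 1 ≤ X ^ (μ * κ / z) := by
    rw [← ENNReal.one_rpow (μ * κ / z)]
    exact ENNReal.rpow_le_rpow hX (by rw [mul_div_assoc]; positivity)
  calc ∫⁻ x in cube n, W x ^ (1 / z)
      ≤ ∫⁻ x in cube n, (K : ℝ≥0∞) ^ (1 / z) * 2 ^ (1 / z) *
          (pot m (fun y => f y ^ κ) (ins i t x) ^ (1 / z) + 1) := by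
        refine setLIntegral_mono' measurableSet_cube fun x hx => ?_
        refine (ENNReal.rpow_le_rpow (hW x hx) hz').trans ?_
        rw [ENNReal.mul_rpow_of_nonneg _ _ hz', mul_assoc]
        gcongr
        refine (ENNReal.add_rpow_le_two_rpow_mul _ _ hz').trans (le_of_eq ?_)
        rw [ENNReal.one_rpow]
    _ = (K : ℝ≥0∞) ^ (1 / z) * 2 ^ (1 / z) *
          ((∫⁻ x in cube n, pot m (fun y => f y ^ κ) (ins i t x) ^ (1 / z)) +
            volume (cube n)) := by
        rw [lintegral_const_mul', lintegral_add_right _ measurable_const]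
        · simp
        · exact ENNReal.mul_ne_top (ENNReal.rpow_ne_top_of_nonneg hz' ENNReal.coe_ne_top)
            (ENNReal.rpow_ne_top_of_nonneg hz' (by simp))
    _ ≤ (K : ℝ≥0∞) ^ (1 / z) * 2 ^ (1 / z) *
          (C * K' ^ (κ / z) * X ^ (μ * κ / z) + volume (cube n) * X ^ (μ * κ / z)) := by
        gcongr
        · refine (setLIntegral_le_lintegral _ _).trans ((hC f hf i t).trans ?_)
          rw [mul_assoc]
          gcongr
          refine (ENNReal.rpow_le_rpow hA hκz).trans (le_of_eq ?_)
          rw [ENNReal.mul_rpow_of_nonneg _ _ hκz, ← ENNReal.rpow_mul, mul_div_assoc]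
        · exact le_mul_of_one_le_right' hX1
    _ = _ := by ring

end Face

lemma setLIntegral_enorm_rpow_lt_top {N : ℕ} {w : Euc N → ℝ} (hw : Continuous w) {r : ℝ}
    (hr : 0 ≤ r) {D : Set (Euc N)} {Λ : ℝ} (hD : D ⊆ closedBall 0 Λ) :
    ∫⁻ y in D, ‖w y‖ₑ ^ r < ⊤ := by
  refine (lintegral_mono_set hD).trans_lt ?_
  have h := setLIntegral_lt_top_of_isCompact (μ := (volume : Measure (Euc N)))
    (isCompact_closedBall (0 : Euc N) Λ).measure_lt_top.ne
    (isCompact_closedBall (0 : Euc N) Λ) (f := fun y => ‖w y‖₊ ^ r)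
    ((NNReal.continuous_rpow_const hr).comp hw.nnnorm)
  simpa [ENNReal.coe_rpow_of_nonneg _ hr, enorm_eq_nnnorm] using h

/-- A pointwise majorant for the boundary terms in the Pohozaev identity. -/
def bdry {N : ℕ} (p q : ℝ) (u v : Euc N → ℝ) (x : Euc N) : ℝ≥0∞ :=
  ((∑ j, ‖pd j u x‖ₑ) + ‖u x‖ₑ) * ((∑ j, ‖pd j v x‖ₑ) + ‖v x‖ₑ) +
    (‖u x‖ₑ ^ (q + 1) + ‖v x‖ₑ ^ (p + 1))

section Face

variable {n : ℕ} {p q a b s : ℝ}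

lemma setLIntegral_slice_le {J : Set ℝ} (hJm : MeasurableSet J) (hJ : ∀ t ∈ J, 1 ≤ |t| ∧ |t| ≤ 2)
    (i : Fin (n + 1)) {g : Euc (n + 1) → ℝ≥0∞} (hg : Measurable g) :
    ∫⁻ t in J, ∫⁻ x in cube n, g (ins i t x) ≤ ∫⁻ y in shell (n + 1) (2 * (n + 1) + 1), g y := by
  have hgm := hg.comp (measurable_ins i)
  rw [← setLIntegral_prod (fun p : ℝ × (Fin n → ℝ) => g (ins i p.1 p.2)) hgm.aemeasurable,
    ← lintegral_indicator (measurableSet_shell _ _), lintegral_ins i, ← Measure.volume_eq_prod,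
    ← lintegral_indicator (hJm.prod measurableSet_cube)]
  refine lintegral_mono fun p => ?_
  by_cases hp : p ∈ J ×ˢ cube n
  · have hb := norm_ins_bounds i (hJ p.1 hp.1).1 (hJ p.1 hp.1).2 hp.2
    rw [indicator_of_mem hp, indicator_of_mem (mem_shell.mpr ⟨by linarith, by linarith⟩)]
  · rw [indicator_of_notMem hp]; exact zero_le

/-- The energy on the shell used in the feedback estimate. -/
def shellEnergy (n : ℕ) (p q : ℝ) (u v : Euc (n + 1) → ℝ) : ℝ≥0∞ :=
  1 + ((∫⁻ y in shell (n + 1) (2 * (n + 1) + 1), ‖u y‖ₑ ^ (q + 1)) +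
    ∫⁻ y in shell (n + 1) (2 * (n + 1) + 1), ‖v y‖ₑ ^ (p + 1))

lemma exists_good_level {σ μ d : ℝ} (hp : 0 < p) (hq : 0 < q) (hs : 0 < s) (hσ : 0 < σ)
    (hμ : 0 ≤ μ) (hμ1 : μ ≤ 1) (hσs : σ ≤ (1 - μ) * s + μ * (p + 1)) (hd : 0 < d) (C₁ : ℝ≥0) :
    ∃ K : ℝ≥0, ∀ u v : Euc (n + 1) → ℝ, Continuous u → Continuous v →
      (∫⁻ y in shell (n + 1) (2 * (n + 1) + 1), ‖v y‖ₑ ^ s ≤ C₁) →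
      ∀ i c, (c = 1 ∨ c = -2) → ∃ t ∈ Icc c (c + 1),
        (∫⁻ y, sing (1 / 4) (1 - d) (y i - t) *
          (shell (n + 1) (2 * (n + 1) + 1)).indicator (fun y => ‖v y‖ₑ ^ σ) y) ≤
            K * shellEnergy n p q u v ^ μ ∧
        (∫⁻ y, sing (1 / 4) (1 - d) (y i - t) *
          (shell (n + 1) (2 * (n + 1) + 1)).indicator (fun y => ‖u y‖ₑ ^ (q + 1)) y) ≤
            K * shellEnergy n p q u v ^ (1 : ℝ) ∧
        (∫⁻ x in cube n, ‖v (ins i t x)‖ₑ ^ s) ≤ K := by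
  set D := shell (n + 1) (2 * (n + 1) + 1) with hD
  have hDm : MeasurableSet D := measurableSet_shell _ _
  have hDv : volume D ≠ ⊤ := ((measure_mono sdiff_subset).trans_lt
    measure_closedBall_lt_top).ne
  set A := ∫⁻ t : ℝ, sing (1 / 4) (1 - d) t
  have hA : A ≠ ⊤ := (lintegral_sing_lt_top volume (by simp) (by simp; linarith)).ne
  set K : ℝ≥0 := (A * (volume D + C₁ ^ (1 - μ)) + A + C₁).toNNReal with hK
  have hKe : (K : ℝ≥0∞) = A * (volume D + C₁ ^ (1 - μ)) + A + C₁ := ENNReal.coe_toNNReal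
    (ENNReal.add_ne_top.mpr ⟨ENNReal.add_ne_top.mpr ⟨ENNReal.mul_ne_top hA (ENNReal.add_ne_top.mpr
      ⟨hDv, ENNReal.rpow_ne_top_of_nonneg (by linarith) ENNReal.coe_ne_top⟩), hA⟩,
      ENNReal.coe_ne_top⟩)
  refine ⟨3 * K, fun u v hu hv hvs i c hc => ?_⟩
  set X := shellEnergy n p q u v with hX
  have hX1 : 1 ≤ X := le_self_add
  have hXt : X ≠ ⊤ := by
    rw [hX, shellEnergy]
    refine ENNReal.add_ne_top.mpr ⟨ENNReal.one_ne_top, ENNReal.add_ne_top.mpr ⟨?_, ?_⟩⟩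
    · exact (setLIntegral_enorm_rpow_lt_top hu (by linarith) sdiff_subset).ne
    · exact (setLIntegral_enorm_rpow_lt_top hv (by linarith) sdiff_subset).ne
  have hXμ : 1 ≤ X ^ μ := by
    rw [← ENNReal.one_rpow μ]; exact ENNReal.rpow_le_rpow hX1 hμ
  have hfv : Measurable (D.indicator fun y => ‖v y‖ₑ ^ σ) :=
    (hv.measurable.enorm.pow_const _).indicator hDm
  have hfu : Measurable (D.indicator fun y => ‖u y‖ₑ ^ (q + 1)) :=
    (hu.measurable.enorm.pow_const _).indicator hDm
  have hvm : Measurable fun y => ‖v y‖ₑ ^ s := hv.measurable.enorm.pow_const _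
  have hsl : ∀ {f : Euc (n + 1) → ℝ≥0∞}, Measurable f →
      Measurable fun t : ℝ => ∫⁻ y, sing (1 / 4) (1 - d) (y i - t) * f y := fun {f} hf => by
    have hc : Measurable fun y : Euc (n + 1) => y i := by fun_prop
    exact ((measurable_sing.comp ((hc.comp measurable_snd).sub measurable_fst)).mul
      (hf.comp measurable_snd)).lintegral_prod_right'
  have hJ : ∀ t ∈ Icc c (c + 1), 1 ≤ |t| ∧ |t| ≤ 2 := by
    rintro t ⟨h1, h2⟩
    rcases hc with rfl | rfl
    · rw [abs_of_pos (by linarith)]; constructor <;> linarith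
    · rw [abs_of_neg (by linarith)]; constructor <;> linarith
  have hIv : ∫⁻ y in D, ‖v y‖ₑ ^ σ ≤ (volume D + C₁ ^ (1 - μ)) * X ^ μ := by
    refine (lintegral_rpow_le_interpolation hv.measurable.enorm.aemeasurable hσ.le hs.le
      (by linarith : 0 ≤ p + 1) hμ hμ1 hσs).trans ?_
    rw [Measure.restrict_apply_univ, add_mul]
    gcongr
    · exact le_mul_of_one_le_right' hXμ
    · exact le_add_self.trans le_add_self
  obtain ⟨t, ht, hle⟩ := exists_mem_le_of_setLIntegral_le (μ := (volume : Measure ℝ))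
    (J := Icc c (c + 1)) (by simp)
    (f := ![fun t => ∫⁻ y, sing (1 / 4) (1 - d) (y i - t) * D.indicator (fun y => ‖v y‖ₑ ^ σ) y,
      fun t => ∫⁻ y, sing (1 / 4) (1 - d) (y i - t) * D.indicator (fun y => ‖u y‖ₑ ^ (q + 1)) y,
      fun t => ∫⁻ x in cube n, ‖v (ins i t x)‖ₑ ^ s])
    (by
      intro k
      fin_cases k
      · exact hsl hfv
      · exact hsl hfu
      · exact (hvm.comp (measurable_ins i)).lintegral_prod_right')
    (K := K) (M := ![X ^ μ, X ^ (1 : ℝ), 1])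
    (by
      intro k
      fin_cases k
      · exact hXμ
      · simpa using hX1
      · exact le_rfl)
    (by
      intro k
      fin_cases k
      · exact ENNReal.rpow_ne_top_of_nonneg hμ hXt
      · simpa using hXt
      · exact ENNReal.one_ne_top)
    (by
      intro k
      fin_cases k
      · refine (setLIntegral_le_lintegral _ _).trans ?_
        change ∫⁻ t, ∫⁻ y, sing (1 / 4) (1 - d) (y i - t) *
          D.indicator (fun y => ‖v y‖ₑ ^ σ) y ≤ K * X ^ μ
        rw [lintegral_slice_weight hfv, lintegral_indicator hDm, hKe]
        calc A * ∫⁻ y in D, ‖v y‖ₑ ^ σ ≤ A * ((volume D + C₁ ^ (1 - μ)) * X ^ μ) := by gcongr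
          _ = (A * (volume D + C₁ ^ (1 - μ))) * X ^ μ := by ring
          _ ≤ _ := by gcongr; exact le_self_add.trans le_self_add
      · refine (setLIntegral_le_lintegral _ _).trans ?_
        change ∫⁻ t, ∫⁻ y, sing (1 / 4) (1 - d) (y i - t) *
          D.indicator (fun y => ‖u y‖ₑ ^ (q + 1)) y ≤ K * X ^ (1 : ℝ)
        rw [lintegral_slice_weight hfu, lintegral_indicator hDm, hKe, ENNReal.rpow_one]
        gcongr
        · exact le_add_self.trans le_self_add
        · exact le_self_add.trans le_add_self
      · change ∫⁻ t in Icc c (c + 1), ∫⁻ x in cube n, ‖v (ins i t x)‖ₑ ^ s ≤ K * 1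
        rw [mul_one, hKe]
        exact (setLIntegral_slice_le measurableSet_Icc hJ i hvm).trans (hvs.trans le_add_self))
  refine ⟨t, ht, ?_, ?_, ?_⟩
  · simpa using hle 0
  · simpa using hle 1
  · simpa using hle 2

end Face

section Face

variable {n : ℕ} {p q s : ℝ}

lemma indicator_rpow_eq {D : Set (Euc (n + 1))} {w : Euc (n + 1) → ℝ} {σ κ r : ℝ} (hκ : 0 < κ)
    (h : σ * κ = r) : (D.indicator fun y => ‖w y‖ₑ ^ r) =
      fun y => (D.indicator (fun y => ‖w y‖ₑ ^ σ) y) ^ κ := by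
  funext y
  by_cases hy : y ∈ D
  · rw [indicator_of_mem hy, indicator_of_mem hy, ← ENNReal.rpow_mul, h]
  · rw [indicator_of_notMem hy, indicator_of_notMem hy, ENNReal.zero_rpow_of_pos hκ]

theorem exists_bdry_bound (hn : 2 ≤ n) (hp : 0 < p) (hq : 0 < q) (hpq : 1 < p * q) (a b : ℝ)
    (hs : p ≤ s) (hns : n < s * (2 * (q + 1) / (p * q - 1))) (C₁ : ℝ≥0) :
    ∃ θ : ℝ, 0 ≤ θ ∧ θ < 1 ∧ ∃ C : ℝ≥0, ∀ u v : Euc (n + 1) → ℝ, IsNNSol p q a b u v →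
      (∫⁻ y in shell (n + 1) (2 * (n + 1) + 1), ‖v y‖ₑ ^ s ≤ C₁) →
      ∀ i c, (c = 1 ∨ c = -2) → ∃ t ∈ Icc c (c + 1),
        ∫⁻ x in cube n, bdry p q u v (ins i t x) ≤ C * shellEnergy n p q u v ^ θ := by
  obtain ⟨σ, μ, z, l, d, H⟩ := exists_isAdmissible hn hp hq hpq hs hns
  have hs0 := hp.trans_le hs
  have hN3 : 3 ≤ n + 1 := by omega
  have hn1 : 1 ≤ n := by omega
  have hn2 : (2 : ℝ) ≤ n := by exact_mod_cast hn
  set D := shell (n + 1) (2 * (n + 1) + 1) with hD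
  set κ := p / σ with hκ
  set y := q / (q + 1) with hy
  have hκ0 : 0 < κ := div_pos hp H.σ_pos
  have hy0 : 0 < y := by positivity
  have hy1 : 1 / (q + 1) = 1 - y := by rw [hy]; field_simp; ring
  have hyl : y < 1 := by have : 0 < 1 / (q + 1) := by positivity
                         linarith
  have hκy := H.le_κ
  have hκ1 := H.κ_le
  have hμ := H.μ_nonneg
  have hd := H.d_pos
  have hd1 := H.d_le
  have hz := H.z_pos
  have hl := H.l_nonneg
  have hl1 := H.l_le
  have hsf := H.slice_fst
  have hsg := H.slice_grad
  have hcf := H.cost_fst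
  rw [← hκ, hy1] at hκy hsf hsg
  rw [← hκ] at hκ1 hcf
  obtain ⟨Ku, hKu⟩ := exists_pointwise_bound hN3 hp hq hpq a b (2 * (n + 1))
  obtain ⟨Kv, hKv⟩ := exists_pointwise_bound hN3 hq hp (by linarith) b a (2 * (n + 1))
  obtain ⟨K, hK⟩ := exists_good_level (n := n) hp hq hs0 H.σ_pos hμ H.μ_le H.σ_le hd C₁
  obtain ⟨C₂, h₂⟩ := exists_setLIntegral_rpow_le (m := n - 1) (z := 1 / (q + 1)) hn1 hd hd1
    (by positivity) (by rw [hy1]; exact hκy) hκ1 hμ (by linarith) (by rw [hy1]; exact hsf) Ku K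
  obtain ⟨C₃, h₃⟩ := exists_setLIntegral_rpow_le (m := n) (z := (κ + 1 - y) / 2) hn1 hd hd1
    (by linarith) (by linarith) hκ1 hμ (by linarith) (hsg.trans_eq (by ring)) Ku K
  obtain ⟨C₄, h₄⟩ := exists_setLIntegral_rpow_le (m := n) (z := (y + 1 - κ) / 2) (κ := y) hn1 hd
    hd1 (by linarith) (by linarith) hyl.le zero_le_one (by linarith) (hsg.trans_eq (by ring)) Kv K
  obtain ⟨C₅, h₅⟩ := exists_setLIntegral_rpow_le (m := n - 1) (z := z) (κ := y) hn1 hd hd1 hz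
    H.z_le hyl.le zero_le_one (by linarith) H.slice_snd Kv K
  set θ := max (κ * μ * (q + 1)) (max (κ * μ + y) (l * y / z)) with hθ
  have hc2 : κ * μ + y < 1 := by
    have : κ * μ < 1 / (q + 1) := by rwa [lt_div_iff₀ (by linarith)]
    linarith
  have hθ0 : 0 ≤ θ := le_max_of_le_left (by positivity)
  refine ⟨θ, hθ0, max_lt hcf (max_lt hc2 H.cost_snd), ?_⟩
  set V := volume (cube n)
  have hCt : C₂ + C₃ ^ ((κ + 1 - y) / 2) * C₄ ^ ((y + 1 - κ) / 2) +
      (V + K ^ (1 - l) * C₅ ^ l) ≠ ⊤ := by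
    refine ENNReal.add_ne_top.mpr ⟨ENNReal.add_ne_top.mpr ⟨ENNReal.coe_ne_top,
      ENNReal.mul_ne_top ?_ ?_⟩, ENNReal.add_ne_top.mpr ⟨volume_cube_ne_top,
      ENNReal.mul_ne_top ?_ ?_⟩⟩
    all_goals exact ENNReal.rpow_ne_top_of_nonneg (by linarith) ENNReal.coe_ne_top
  refine ⟨ENNReal.toNNReal (C₂ + C₃ ^ ((κ + 1 - y) / 2) * C₄ ^ ((y + 1 - κ) / 2) +
      (V + K ^ (1 - l) * C₅ ^ l)), fun u v h hvs i c hc => ?_⟩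
  rw [ENNReal.coe_toNNReal hCt]
  obtain ⟨t, ht, hAv, hAu, hvt⟩ := hK u v h.continuous_fst h.continuous_snd hvs i c hc
  refine ⟨t, ht, ?_⟩
  set X := shellEnergy n p q u v with hX
  have hX1 : 1 ≤ X := le_self_add
  have ht12 : 1 ≤ |t| ∧ |t| ≤ 2 := by
    obtain ⟨h1, h2⟩ := ht
    rcases hc with rfl | rfl
    · rw [abs_of_pos (by linarith)]; constructor <;> linarith
    · rw [abs_of_neg (by linarith)]; constructor <;> linarith
  have hb := fun x (hx : x ∈ cube n) => norm_ins_bounds i ht12.1 ht12.2 hx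
  set fV := D.indicator fun y => ‖v y‖ₑ ^ σ with hfV
  set fU := D.indicator fun y => ‖u y‖ₑ ^ (q + 1) with hfU
  have hDm : MeasurableSet D := measurableSet_shell _ _
  have hfVm : Measurable fV :=
    (h.continuous_snd.measurable.enorm.pow_const _).indicator hDm
  have hfUm : Measurable fU :=
    (h.continuous_fst.measurable.enorm.pow_const _).indicator hDm
  have eV : (D.indicator fun y => ‖v y‖ₑ ^ p) = fun y => fV y ^ κ :=
    indicator_rpow_eq hκ0 (by rw [hκ]; field_simp [H.σ_pos.ne'])
  have eU : (D.indicator fun y => ‖u y‖ₑ ^ q) = fun x => fU x ^ y :=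
    indicator_rpow_eq hy0 (by rw [hy]; field_simp)
  have cast1 : ((n + 1 : ℕ) : ℝ) - 2 = n - 1 := by push_cast; ring
  have cast2 : ((n + 1 : ℕ) : ℝ) - 1 = n := by push_cast; ring
  have pU := fun x hx => hKu u v h (ins i t x) (hb x hx).1 (hb x hx).2
  have pV := fun x hx => hKv v u h.symm (ins i t x) (hb x hx).1 (hb x hx).2
  rw [cast1, cast2, ← hD] at pU pV
  rw [eV] at pU
  rw [eU] at pV
  have hins : Measurable fun x => ins i t x := (measurable_ins i).comp measurable_prodMk_left
  have mV : Measurable fun x => ‖v (ins i t x)‖ₑ := (h.continuous_snd.measurable.comp hins).enorm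
  have mU : Measurable fun x => ‖u (ins i t x)‖ₑ := (h.continuous_fst.measurable.comp hins).enorm
  set GU := fun x => (Ku : ℝ≥0∞) * (pot n (fun x => fV x ^ κ) (ins i t x) + 1) with hGU
  set GV := fun x => (Kv : ℝ≥0∞) * (pot n (fun x => fU x ^ y) (ins i t x) + 1) with hGV
  have mGU : Measurable GU :=
    (((measurable_pot _ (hfVm.pow_const _)).comp hins).add_const _).const_mul _
  have mGV : Measurable GV :=
    (((measurable_pot _ (hfUm.pow_const _)).comp hins).add_const _).const_mul _
  have I1 : ∫⁻ x in cube n, ‖u (ins i t x)‖ₑ ^ (q + 1) ≤ C₂ * X ^ θ := by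
    have := h₂ X hX1 fV hfVm i t hAv (fun x => ‖u (ins i t x)‖ₑ) fun x hx => (pU x hx).1
    rw [one_div_one_div] at this
    refine this.trans ?_
    gcongr
    refine le_trans (le_of_eq ?_) (le_max_left _ _)
    rw [div_div_eq_mul_div, div_one]; ring
  have I2 : ∫⁻ x in cube n, GU x * GV x ≤
      C₃ ^ ((κ + 1 - y) / 2) * C₄ ^ ((y + 1 - κ) / 2) * X ^ θ := by
    have z1 : 0 < (κ + 1 - y) / 2 := by linarith
    have z2 : 0 < (y + 1 - κ) / 2 := by linarith
    have k1 := h₃ X hX1 fV hfVm i t hAv GU fun x _ => le_rfl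
    have k2 := h₄ X hX1 fU hfUm i t hAu GV fun x _ => le_rfl
    have hol := ENNReal.lintegral_mul_norm_pow_le (μ := volume.restrict (cube n))
      (mGU.pow_const (1 / ((κ + 1 - y) / 2))).aemeasurable
      (mGV.pow_const (1 / ((y + 1 - κ) / 2))).aemeasurable z1.le z2.le (by ring)
    simp only [← ENNReal.rpow_mul, one_div_mul_cancel z1.ne', one_div_mul_cancel z2.ne',
      ENNReal.rpow_one] at hol
    refine hol.trans ((mul_le_mul' (ENNReal.rpow_le_rpow k1 z1.le)
      (ENNReal.rpow_le_rpow k2 z2.le)).trans ?_)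
    rw [ENNReal.mul_rpow_of_nonneg _ _ z1.le, ENNReal.mul_rpow_of_nonneg _ _ z2.le,
      ← ENNReal.rpow_mul, ← ENNReal.rpow_mul, div_mul_cancel₀ _ z1.ne', div_mul_cancel₀ _ z2.ne',
      mul_mul_mul_comm, ← ENNReal.rpow_add_of_nonneg _ _ (by positivity) (by positivity)]
    gcongr
    refine le_trans (le_of_eq ?_) ((le_max_left _ _).trans (le_max_right _ _))
    ring
  have I3 : ∫⁻ x in cube n, ‖v (ins i t x)‖ₑ ^ (p + 1) ≤ (V + K ^ (1 - l) * C₅ ^ l) * X ^ θ := by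
    have k := h₅ X hX1 fU hfUm i t hAu (fun x => ‖v (ins i t x)‖ₑ) fun x hx => (pV x hx).1
    refine (lintegral_rpow_le_interpolation (τ := p + 1) (s := s) (e := 1 / z)
      (μ := volume.restrict (cube n)) mV.aemeasurable (by linarith) hs0.le (by positivity) hl hl1
      (by rw [mul_one_div]; exact H.p_le)).trans ?_
    rw [Measure.restrict_apply_univ, add_mul]
    refine add_le_add ?_ ?_
    · refine le_mul_of_one_le_right' ?_
      rw [← ENNReal.one_rpow θ]; exact ENNReal.rpow_le_rpow hX1 hθ0
    · rw [mul_assoc]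
      refine mul_le_mul' (ENNReal.rpow_le_rpow hvt (by linarith)) ?_
      refine (ENNReal.rpow_le_rpow k hl).trans ?_
      rw [ENNReal.mul_rpow_of_nonneg _ _ hl, ← ENNReal.rpow_mul]
      gcongr
      refine le_trans (le_of_eq ?_) ((le_max_right _ _).trans (le_max_right _ _))
      ring
  calc ∫⁻ x in cube n, bdry p q u v (ins i t x)
      ≤ ∫⁻ x in cube n, (GU x * GV x +
          (‖u (ins i t x)‖ₑ ^ (q + 1) + ‖v (ins i t x)‖ₑ ^ (p + 1))) := by
        refine setLIntegral_mono' measurableSet_cube fun x hx => ?_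
        rw [bdry]
        gcongr
        · exact (pU x hx).2
        · exact (pV x hx).2
    _ = (∫⁻ x in cube n, GU x * GV x) + ((∫⁻ x in cube n, ‖u (ins i t x)‖ₑ ^ (q + 1)) +
          ∫⁻ x in cube n, ‖v (ins i t x)‖ₑ ^ (p + 1)) := by
        have m : Measurable fun x => GU x * GV x := mGU.mul mGV
        rw [lintegral_add_left m, lintegral_add_left (mU.pow_const _)]
    _ ≤ C₃ ^ ((κ + 1 - y) / 2) * C₄ ^ ((y + 1 - κ) / 2) * X ^ θ + (C₂ * X ^ θ +
          (V + K ^ (1 - l) * C₅ ^ l) * X ^ θ) := by gcongr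
    _ = _ := by ring

end Face

section Pohozaev

variable {N : ℕ} {f g : Euc N → ℝ} {x : Euc N}

/-- The radial derivative `x · ∇f`. -/
def radial (f : Euc N → ℝ) (x : Euc N) : ℝ := ∑ j, x j * pd j f x

/-- The product `∇f · ∇g`. -/
def gdot (f g : Euc N → ℝ) (x : Euc N) : ℝ := ∑ j, pd j f x * pd j g x

lemma gdot_comm : gdot f g x = gdot g f x :=
  Finset.sum_congr rfl fun _ _ => mul_comm _ _

lemma contDiff_coord (i : Fin N) : ContDiff ℝ ω (fun y : Euc N => y i) :=
  (EuclideanSpace.proj i : Euc N →L[ℝ] ℝ).contDiff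

lemma differentiableAt_coord (i : Fin N) : DifferentiableAt ℝ (fun y : Euc N => y i) x :=
  (contDiff_coord i).differentiable (by simp) x

lemma ContDiffAt.radial {m n : WithTop ℕ∞} (hf : ContDiffAt ℝ n f x) (hmn : m + 1 ≤ n) :
    ContDiffAt ℝ m (radial f) x :=
  ContDiffAt.sum fun j _ => ((contDiff_coord j).contDiffAt.of_le (by simp)).mul (hf.pd_left hmn j)

lemma ContDiffAt.gdot {m n : WithTop ℕ∞} (hf : ContDiffAt ℝ n f x) (hg : ContDiffAt ℝ n g x)
    (hmn : m + 1 ≤ n) : ContDiffAt ℝ m (gdot f g) x :=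
  ContDiffAt.sum fun j _ => (hf.pd_left hmn j).mul (hg.pd_left hmn j)

lemma ContDiffAt.differentiableAt_pd (hf : ContDiffAt ℝ 2 f x) (i : Fin N) :
    DifferentiableAt ℝ (pd i f) x :=
  (hf.pd_left (m := 1) (by norm_num) i).differentiableAt (by norm_num)

lemma pd_radial (hf : ContDiffAt ℝ 2 f x) (i : Fin N) :
    pd i (radial f) x = pd i f x + ∑ j, x j * pd i (pd j f) x := by
  unfold radial
  rw [pd_sum _ (fun j _ => (differentiableAt_coord j).fun_mul (hf.differentiableAt_pd j))]
  simp_rw [pd_mul (differentiableAt_coord _) (hf.differentiableAt_pd _), pd_coord]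
  rw [Finset.sum_add_distrib]
  simp [add_comm]

lemma pd_gdot (hf : ContDiffAt ℝ 2 f x) (hg : ContDiffAt ℝ 2 g x) (i : Fin N) :
    pd i (gdot f g) x = ∑ j, (pd j f x * pd i (pd j g) x + pd j g x * pd i (pd j f) x) := by
  unfold gdot
  rw [pd_sum _ (fun j _ => (hf.differentiableAt_pd j).fun_mul (hg.differentiableAt_pd j))]
  exact Finset.sum_congr rfl fun j _ => pd_mul (hf.differentiableAt_pd j) (hg.differentiableAt_pd j) i

lemma sum_pd_mul_pd (hf : DifferentiableAt ℝ f x) (hg : ContDiffAt ℝ 2 g x) :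
    ∑ i, pd i (fun y => f y * pd i g y) x = f x * lap g x + gdot f g x := by
  rw [lap_eq_sum_pd hg, gdot, Finset.mul_sum, ← Finset.sum_add_distrib]
  exact Finset.sum_congr rfl fun i _ => by
    rw [pd_mul hf (hg.differentiableAt_pd i)]; ring

lemma sum_pd_coord_mul (hf : DifferentiableAt ℝ f x) :
    ∑ i, pd i (fun y => y i * f y) x = N * f x + radial f x := by
  simp_rw [pd_mul (differentiableAt_coord _) hf, pd_coord]
  rw [Finset.sum_add_distrib, radial]
  simp [add_comm]

lemma gdot_radial (hf : ContDiffAt ℝ 2 f x) :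
    gdot (radial f) g x = gdot f g x + ∑ i, ∑ j, x j * (pd i g x * pd i (pd j f) x) := by
  simp only [gdot, pd_radial hf, ← Finset.sum_add_distrib, add_mul, Finset.sum_mul]
  exact Finset.sum_congr rfl fun i _ => by
    congr 1; exact Finset.sum_congr rfl fun j _ => by ring

lemma radial_gdot (hf : ContDiffAt ℝ 2 f x) (hg : ContDiffAt ℝ 2 g x) :
    radial (gdot f g) x = (∑ i, ∑ j, x j * (pd i f x * pd i (pd j g) x)) +
      ∑ i, ∑ j, x j * (pd i g x * pd i (pd j f) x) := by
  simp only [radial, pd_gdot hf hg, Finset.mul_sum, mul_add, Finset.sum_add_distrib]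
  rw [Finset.sum_comm, Finset.sum_comm (f := fun i j => x i * (pd j g x * pd i (pd j f) x))]
  simp_rw [pd_comm hf, pd_comm hg]

lemma radial_norm_rpow (hx : x ≠ 0) (a : ℝ) :
    DifferentiableAt ℝ (fun y : Euc N => ‖y‖ ^ a) x ∧
      radial (fun y : Euc N => ‖y‖ ^ a) x = a * ‖x‖ ^ a := by
  have hd : DifferentiableAt ℝ (fun y : Euc N => ‖y‖) x := (contDiffAt_norm ℝ hx).differentiableAt
    (n := 1) (by norm_num)
  have hx0 : 0 < ‖x‖ := norm_pos_iff.mpr hx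
  refine ⟨hd.rpow_const (Or.inl hx0.ne'), ?_⟩
  have h1 : radial (fun y : Euc N => ‖y‖) x = ‖x‖ := by
    have e : ∀ h : Euc N → ℝ, radial h x = fderiv ℝ h x x := fun h => by
      conv_rhs => arg 2; rw [← (EuclideanSpace.basisFun (Fin N) ℝ).sum_repr x]
      simp [radial, pd]
    rw [e]
    exact hd.fderiv_norm_self
  simp only [radial, pd_comp_of_hasDerivAt (φ := fun t => t ^ a)
    (Real.hasDerivAt_rpow_const (p := a) (Or.inl hx0.ne')) hd]
  simp only [mul_left_comm _ (a * _), ← Finset.mul_sum]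
  rw [show ∑ j, x j * pd j (fun y : Euc N => ‖y‖) x = ‖x‖ from h1, mul_assoc,
    ← Real.rpow_add_one hx0.ne']
  simp

lemma radial_norm_rpow_mul (hx : x ≠ 0) (hf : DifferentiableAt ℝ f x) {p : ℝ} (hp : 0 < p)
    (a : ℝ) :
    DifferentiableAt ℝ (fun y : Euc N => ‖y‖ ^ a * f y ^ (p + 1)) x ∧
      radial (fun y : Euc N => ‖y‖ ^ a * f y ^ (p + 1)) x =
        a * ‖x‖ ^ a * f x ^ (p + 1) + (p + 1) * (‖x‖ ^ a * f x ^ p) * radial f x := by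
  obtain ⟨h1, h2⟩ := radial_norm_rpow hx a
  have hd : HasDerivAt (fun t : ℝ => t ^ (p + 1)) ((p + 1) * f x ^ p) (f x) := by
    simpa using Real.hasDerivAt_rpow_const (x := f x) (p := p + 1) (Or.inr (by linarith))
  have h3 : DifferentiableAt ℝ (fun y => f y ^ (p + 1)) x :=
    hf.rpow_const (Or.inr (by linarith))
  refine ⟨h1.mul h3, ?_⟩
  rw [← h2]
  simp only [radial, pd_mul h1 h3, pd_comp_of_hasDerivAt hd hf, Finset.mul_sum, Finset.sum_mul,
    ← Finset.sum_add_distrib]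
  exact Finset.sum_congr rfl fun j _ => by ring

/-- The Rellich–Pohozaev vector field of the system. -/
def pohField (p q a b a₁ a₂ : ℝ) (u v : Euc N → ℝ) (i : Fin N) (x : Euc N) : ℝ :=
  radial v x * pd i u x + radial u x * pd i v x - x i * gdot u v x +
    x i * (‖x‖ ^ a * v x ^ (p + 1) / (p + 1) + ‖x‖ ^ b * u x ^ (q + 1) / (q + 1)) +
    (a₁ * (v x * pd i u x) + a₂ * (u x * pd i v x))

variable {p q a b a₁ a₂ : ℝ} {u v : Euc N → ℝ}

lemma IsNNSol.contDiffAt_pohField (hp : 0 < p) (hq : 0 < q) (h : IsNNSol p q a b u v)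
    (hx : x ≠ 0) (i : Fin N) : ContDiffAt ℝ 1 (pohField p q a b a₁ a₂ u v i) x := by
  have hu := h.contDiffAt_fst x hx
  have hv := h.contDiffAt_snd x hx
  have e : (1 : WithTop ℕ∞) + 1 ≤ 2 := by norm_num
  have hu1 := hu.of_le (show (1 : WithTop ℕ∞) ≤ 2 by norm_num)
  have hv1 := hv.of_le (show (1 : WithTop ℕ∞) ≤ 2 by norm_num)
  have hr : ∀ c : ℝ, ContDiffAt ℝ 1 (fun y : Euc N => ‖y‖ ^ c) x := fun c =>
    (contDiffAt_norm ℝ hx).rpow_const_of_ne (norm_ne_zero_iff.mpr hx)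
  have hpow : ∀ {w : Euc N → ℝ} {r : ℝ}, 0 < r → ContDiffAt ℝ 1 w x →
      ContDiffAt ℝ 1 (fun y => w y ^ (r + 1)) x := fun hr hw =>
    hw.rpow_const_of_le (by simpa using hr.le)
  have hc : ContDiffAt ℝ 1 (fun y : Euc N => y i) x := (contDiff_coord i).contDiffAt.of_le (by simp)
  exact (((((hv.radial e).mul (hu.pd_left e i)).add ((hu.radial e).mul (hv.pd_left e i))).sub
    (hc.mul (hu.gdot hv e))).add (hc.mul ((((hr a).mul (hpow hp hv1)).div_const _).add
    (((hr b).mul (hpow hq hu1)).div_const _)))).add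
    ((contDiffAt_const.mul (hv1.mul (hu.pd_left e i))).add
    (contDiffAt_const.mul (hu1.mul (hv.pd_left e i))))

lemma IsNNSol.sum_pd_pohField (hp : 0 < p) (hq : 0 < q) (h : IsNNSol p q a b u v)
    (ha : a₁ + a₂ = N - 2) (hx : x ≠ 0) :
    ∑ i, pd i (pohField p q a b a₁ a₂ u v i) x =
      ((N + a) / (p + 1) - a₁) * (‖x‖ ^ a * v x ^ (p + 1)) +
        ((N + b) / (q + 1) - a₂) * (‖x‖ ^ b * u x ^ (q + 1)) := by
  have hu := h.contDiffAt_fst x hx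
  have hv := h.contDiffAt_snd x hx
  have hud := hu.differentiableAt (by norm_num)
  have hvd := hv.differentiableAt (by norm_num)
  have hp1 : p + 1 ≠ 0 := by linarith
  have hq1 : q + 1 ≠ 0 := by linarith
  have e : (1 : WithTop ℕ∞) + 1 ≤ 2 := by norm_num
  have hru := (hu.radial e).differentiableAt (by norm_num)
  have hrv := (hv.radial e).differentiableAt (by norm_num)
  have hg := (hu.gdot hv e).differentiableAt (by norm_num)
  obtain ⟨dA, rA⟩ := radial_norm_rpow_mul hx hvd hp a
  obtain ⟨dB, rB⟩ := radial_norm_rpow_mul hx hud hq b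
  have du := hu.differentiableAt_pd
  have dv := hv.differentiableAt_pd
  have split : ∀ i, pd i (pohField p q a b a₁ a₂ u v i) x =
      pd i (fun y => radial v y * pd i u y) x + pd i (fun y => radial u y * pd i v y) x
      - pd i (fun y => y i * gdot u v y) x
      + ((p + 1)⁻¹ * pd i (fun y => y i * (‖y‖ ^ a * v y ^ (p + 1))) x +
        (q + 1)⁻¹ * pd i (fun y => y i * (‖y‖ ^ b * u y ^ (q + 1))) x)
      + (a₁ * pd i (fun y => v y * pd i u y) x + a₂ * pd i (fun y => u y * pd i v y) x) := by
    intro i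
    have c := differentiableAt_coord (x := x) i
    have t1 := hrv.fun_mul (du i)
    have t2 := hru.fun_mul (dv i)
    have t3 := c.fun_mul hg
    have t4 := c.fun_mul dA
    have t5 := c.fun_mul dB
    have t6 := hvd.fun_mul (du i)
    have t7 := hud.fun_mul (dv i)
    rw [← pd_add t1 t2, ← pd_sub (t1.fun_add t2) t3, ← pd_const_mul _ t4, ← pd_const_mul _ t5,
      ← pd_add (t4.const_mul _) (t5.const_mul _), ← pd_add ((t1.fun_add t2).fun_sub t3)
      ((t4.const_mul _).fun_add (t5.const_mul _)), ← pd_const_mul _ t6, ← pd_const_mul _ t7,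
      ← pd_add (t6.const_mul _) (t7.const_mul _),
      ← pd_add (((t1.fun_add t2).fun_sub t3).fun_add ((t4.const_mul _).fun_add (t5.const_mul _)))
        ((t6.const_mul _).fun_add (t7.const_mul _))]
    congr 1
    funext y
    simp only [pohField]
    ring
  simp_rw [split]
  simp only [Finset.sum_add_distrib, Finset.sum_sub_distrib, ← Finset.mul_sum]
  rw [sum_pd_mul_pd hrv hu, sum_pd_mul_pd hru hv, sum_pd_coord_mul hg, sum_pd_coord_mul dA,
    sum_pd_coord_mul dB, sum_pd_mul_pd hvd hu, sum_pd_mul_pd hud hv, rA, rB, gdot_radial hv,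
    gdot_radial hu, radial_gdot hu hv, h.lap_fst x hx, h.lap_snd x hx, gdot_comm (f := v)]
  have e1 : ∀ {w : ℝ} {r : ℝ}, 0 < r → 0 ≤ w → w ^ (r + 1) = w * w ^ r := fun hr hw => by
    rw [Real.rpow_add_one' hw (by linarith), mul_comm]
  rw [e1 hp (h.nonneg_snd x), e1 hq (h.nonneg_fst x), show (N : ℝ) = a₁ + a₂ + 2 by linarith]
  field_simp
  ring

end Pohozaev

section Divergence

variable {n : ℕ}

/-- The closed box with corners `lo` and `hi`. -/
def box (lo hi : Fin (n + 1) → ℝ) : Set (Euc (n + 1)) := WithLp.ofLp ⁻¹' Icc lo hi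

lemma isCompact_box (lo hi : Fin (n + 1) → ℝ) : IsCompact (box lo hi) :=
  (PiLp.homeomorph 2 (fun _ : Fin (n + 1) => ℝ)).isCompact_preimage.mpr isCompact_Icc

lemma integral_sum_pd_box {lo hi : Fin (n + 1) → ℝ} (hle : lo ≤ hi)
    {F : Fin (n + 1) → Euc (n + 1) → ℝ} (hF : ∀ i, ContDiff ℝ 1 (F i)) :
    ∫ y in box lo hi, ∑ i, pd i (F i) y =
      ∑ i : Fin (n + 1), ((∫ x in Icc (lo ∘ i.succAbove) (hi ∘ i.succAbove), F i (ins i (hi i) x)) -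
        ∫ x in Icc (lo ∘ i.succAbove) (hi ∘ i.succAbove), F i (ins i (lo i) x)) := by
  set L : (Fin (n + 1) → ℝ) →L[ℝ] Euc (n + 1) :=
    (PiLp.continuousLinearEquiv 2 ℝ (fun _ : Fin (n + 1) => ℝ)).symm.toContinuousLinearMap with hL
  have hLv : ∀ x, L x = WithLp.toLp 2 x := fun x => rfl
  have hd : ∀ i x, HasFDerivAt (fun x => F i (WithLp.toLp 2 x))
      ((fderiv ℝ (F i) (WithLp.toLp 2 x)).comp L) x := fun i x =>
    HasFDerivAt.comp x ((hF i).differentiable (by norm_num) _).hasFDerivAt L.hasFDerivAt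
  have hpd : ∀ i x, ((fderiv ℝ (F i) (WithLp.toLp 2 x)).comp L) (Pi.single i 1) =
      pd i (F i) (WithLp.toLp 2 x) := fun i x => rfl
  have hc : ∀ i, Continuous (pd i (F i)) := fun i =>
    ((hF i).continuous_fderiv (by norm_num)).clm_apply continuous_const
  have hcl : Continuous fun x : Fin (n + 1) → ℝ => (WithLp.toLp 2 x : Euc (n + 1)) :=
    L.continuous
  have key := integral_divergence_of_hasFDerivAt_off_countable' lo hi hle
    (fun i x => F i (WithLp.toLp 2 x)) (fun i x => (fderiv ℝ (F i) (WithLp.toLp 2 x)).comp L) ∅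
    countable_empty (fun i => ((hF i).continuous.comp hcl).continuousOn) (fun x _ i => hd i x)
    (by
      simp_rw [hpd]
      exact (continuous_finsetSum _ fun i _ => (hc i).comp hcl).continuousOn.integrableOn_compact
        isCompact_Icc)
  simp_rw [hpd] at key
  rw [← (PiLp.volume_preserving_toLp (Fin (n + 1))).setIntegral_preimage_emb
    (MeasurableEquiv.toLp 2 (Fin (n + 1) → ℝ)).measurableEmbedding]
  exact key

end Divergence

section Puncture

variable {n : ℕ}

lemma ball_subset_box {lo hi : Fin (n + 1) → ℝ} (hlo : ∀ i, lo i ∈ Icc (-2 : ℝ) (-1))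
    (hhi : ∀ i, hi i ∈ Icc (1 : ℝ) 2) : closedBall 0 1 ⊆ box lo hi := by
  intro y hy
  have h := fun i => abs_le.mp ((PiLp.norm_apply_le y i).trans (mem_closedBall_zero_iff.mp hy))
  exact ⟨fun i => (hlo i).2.trans (h i).1, fun i => (h i).2.trans (hhi i).1⟩

lemma face_subset_cube {lo hi : Fin (n + 1) → ℝ} (hlo : ∀ i, lo i ∈ Icc (-2 : ℝ) (-1))
    (hhi : ∀ i, hi i ∈ Icc (1 : ℝ) 2) (i : Fin (n + 1)) :
    Icc (lo ∘ i.succAbove) (hi ∘ i.succAbove) ⊆ cube n :=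
  Icc_subset_Icc (fun _ => (hlo _).1) (fun _ => (hhi _).2)

variable {W : Fin (n + 1) → Euc (n + 1) → ℝ} {D : Euc (n + 1) → ℝ} {K δ : ℝ}

lemma contDiff_cutoff_mul (hW : ∀ i x, x ≠ 0 → ContDiffAt ℝ 1 (W i) x) (hδ : 0 < δ)
    (i : Fin (n + 1)) : ContDiff ℝ 1 fun y => cutoff (n + 1) δ y * W i y := by
  refine contDiff_of_contDiffAt_tsupport fun x hx => ?_
  have hx' : δ ≤ ‖x‖ := tsupport_cutoff_subset hδ (tsupport_mul_subset_left hx)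
  exact ((contDiff_cutoff δ).contDiffAt.of_le (by simp)).mul
    (hW i x (norm_pos_iff.mp (hδ.trans_le hx')))

lemma continuous_pd_cutoff_mul (hW : ∀ i x, x ≠ 0 → ContDiffAt ℝ 1 (W i) x) (hδ : 0 < δ)
    (i : Fin (n + 1)) : Continuous fun y => pd i (cutoff (n + 1) δ) y * W i y := by
  refine continuous_of_contDiffAt_tsupport fun x hx => ?_
  have hx' : δ ≤ ‖x‖ :=
    tsupport_cutoff_subset hδ (tsupport_pd_subset i (tsupport_mul_subset_left hx))
  have h2 : ContDiffAt ℝ 2 (cutoff (n + 1) δ) x :=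
    (contDiff_cutoff δ).contDiffAt.of_le (by norm_cast)
  exact (h2.pd_left (m := 1) (by norm_num) i).continuousAt.mul
    (hW i x (norm_pos_iff.mp (hδ.trans_le hx'))).continuousAt

lemma cutoff_mul_div_eq (hW : ∀ i x, x ≠ 0 → ContDiffAt ℝ 1 (W i) x)
    (hD : ∀ x, x ≠ 0 → ∑ i, pd i (W i) x = D x) (hδ : 0 < δ) (y : Euc (n + 1)) :
    cutoff (n + 1) δ y * D y = (∑ i, pd i (fun y => cutoff (n + 1) δ y * W i y) y) -
      ∑ i, pd i (cutoff (n + 1) δ) y * W i y := by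
  rw [← Finset.sum_sub_distrib]
  rcases eq_or_ne y 0 with rfl | hy
  · have h0 : cutoff (n + 1) δ =ᶠ[nhds 0] fun _ => 0 := by
      filter_upwards [ball_mem_nhds (0 : Euc (n + 1)) hδ] with z hz
        using cutoff_eq_zero hδ (mem_ball_zero_iff.mp hz).le
    have h1 : ∀ i, pd i (fun y => cutoff (n + 1) δ y * W i y) 0 = 0 := fun i => by
      rw [Filter.EventuallyEq.pd_eq (g := fun _ => 0) (by
        filter_upwards [h0] with z hz; rw [hz, zero_mul]) i, pd_zero]
    simp_rw [h1, h0.pd_eq, pd_zero]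
    rw [h0.eq_of_nhds]; simp
  · rw [← hD y hy, Finset.mul_sum]
    refine Finset.sum_congr rfl fun i _ => ?_
    rw [pd_mul ((contDiff_cutoff δ).differentiable (by simp) y)
      ((hW i y hy).differentiableAt (by norm_num))]
    ring

lemma exists_puncture_error (n : ℕ) (hn : 2 ≤ n) (K : ℝ) :
    ∃ C : ℝ≥0, ∀ W : Fin (n + 1) → Euc (n + 1) → ℝ,
      (∀ i x, x ≠ 0 → ‖x‖ ≤ 1 → |W i x| ≤ K / ‖x‖) → ∀ δ, 0 < δ → δ ≤ 1 / 2 →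
      ∫⁻ y, ‖∑ i, pd i (cutoff (n + 1) δ) y * W i y‖ₑ ≤ C * ENNReal.ofReal δ := by
  obtain ⟨c, hc, hcut⟩ := exists_bound_cutoff (n + 1)
  set V := volume (ball (0 : Euc (n + 1)) 1) with hV
  have hVt : V ≠ ⊤ := measure_ball_lt_top.ne
  refine ⟨ENNReal.toNNReal (ENNReal.ofReal ((n + 1) * (c * |K|) * 2 ^ (n + 1)) * V),
    fun W hW δ hδ hδ2 => ?_⟩
  rw [ENNReal.coe_toNNReal (ENNReal.mul_ne_top ENNReal.ofReal_ne_top hVt)]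
  set M := (n + 1) * (c * |K|) * δ⁻¹ ^ 2 with hM
  have hpt : ∀ y, ‖∑ i, pd i (cutoff (n + 1) δ) y * W i y‖ₑ ≤
      (closedBall (0 : Euc (n + 1)) (2 * δ)).indicator (fun _ => ENNReal.ofReal M) y := by
    intro y
    by_cases h1 : y ∈ closedBall (0 : Euc (n + 1)) (2 * δ)
    · rw [indicator_of_mem h1, ← ofReal_norm]
      refine ENNReal.ofReal_le_ofReal ((norm_sum_le _ _).trans ?_)
      have : ∀ i, ‖pd i (cutoff (n + 1) δ) y * W i y‖ ≤ c * |K| * δ⁻¹ ^ 2 := by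
        intro i
        by_cases h2 : δ ≤ ‖y‖
        · have hy0 : 0 < ‖y‖ := hδ.trans_le h2
          rw [norm_mul, Real.norm_eq_abs, Real.norm_eq_abs]
          have k2 : |W i y| ≤ |K| * δ⁻¹ := by
            refine (hW i y (norm_pos_iff.mp hy0)
              ((mem_closedBall_zero_iff.mp h1).trans (by linarith))).trans ?_
            rw [div_eq_mul_inv]
            gcongr
            exact le_abs_self K
          calc _ ≤ (c * δ⁻¹) * (|K| * δ⁻¹) :=
                mul_le_mul ((hcut δ hδ y).1 i) k2 (abs_nonneg _) (by positivity)
            _ = _ := by ring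
        · have : y ∉ tsupport (pd i (cutoff (n + 1) δ)) := fun hy =>
            h2 (tsupport_cutoff_subset hδ (tsupport_pd_subset i hy))
          rw [image_eq_zero_of_notMem_tsupport this, zero_mul, norm_zero]
          positivity
      refine (Finset.sum_le_sum fun i _ => this i).trans_eq ?_
      rw [Finset.sum_const, Finset.card_univ, Fintype.card_fin, nsmul_eq_mul, hM]
      push_cast; ring
    · have : ∀ i, pd i (cutoff (n + 1) δ) y = 0 := pd_cutoff_eq_zero hδ (by
        rw [mem_closedBall_zero_iff] at h1; linarith)
      simp [this]
  refine (lintegral_mono hpt).trans ?_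
  rw [lintegral_indicator measurableSet_closedBall, setLIntegral_const,
    Measure.addHaar_closedBall _ _ (by positivity), ← hV, ← mul_assoc,
    ← ENNReal.ofReal_mul (by positivity), mul_right_comm (ENNReal.ofReal _) V,
    ← ENNReal.ofReal_mul (by positivity)]
  refine mul_le_mul' (ENNReal.ofReal_le_ofReal ?_) le_rfl
  rw [finrank_euclideanSpace_fin, hM, mul_pow, mul_assoc (_ * (c * |K|)),
    mul_assoc ((n : ℝ) + 1), mul_assoc ((n : ℝ) + 1), mul_assoc]
  obtain ⟨m, rfl⟩ := Nat.exists_eq_add_of_le hn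
  have e : δ⁻¹ ^ 2 * δ ^ (2 + m + 1) ≤ δ := by
    rw [show 2 + m + 1 = 2 + (m + 1) by ring, pow_add, ← mul_assoc, ← mul_pow,
      inv_mul_cancel₀ hδ.ne', one_pow, one_mul, pow_succ]
    exact mul_le_of_le_one_left hδ.le (pow_le_one₀ hδ.le (by linarith))
  calc _ = ((2 + m : ℕ) + 1) * (c * |K|) * 2 ^ (2 + m + 1) * (δ⁻¹ ^ 2 * δ ^ (2 + m + 1)) := by ring
    _ ≤ ((2 + m : ℕ) + 1) * (c * |K|) * 2 ^ (2 + m + 1) * δ := by gcongr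
    _ = _ := by push_cast; ring

/-- The divergence inequality on a box for a vector field with nonnegative divergence and a weak
singularity at the origin. -/
theorem lintegral_ball_le_faces (hn : 2 ≤ n) (hW : ∀ i x, x ≠ 0 → ContDiffAt ℝ 1 (W i) x)
    (hD0 : ∀ x, 0 ≤ D x) (hD : ∀ x, x ≠ 0 → ∑ i, pd i (W i) x = D x)
    (hK : ∀ i x, x ≠ 0 → ‖x‖ ≤ 1 → |W i x| ≤ K / ‖x‖) {lo hi : Fin (n + 1) → ℝ}
    (hlo : ∀ i, lo i ∈ Icc (-2 : ℝ) (-1)) (hhi : ∀ i, hi i ∈ Icc (1 : ℝ) 2) :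
    ∫⁻ y in ball 0 1, ENNReal.ofReal (D y) ≤
      ∑ i, ((∫⁻ x in cube n, ‖W i (ins i (hi i) x)‖ₑ) +
        ∫⁻ x in cube n, ‖W i (ins i (lo i) x)‖ₑ) := by
  obtain ⟨C, hC⟩ := exists_puncture_error n hn K
  set S := ∑ i, ((∫⁻ x in cube n, ‖W i (ins i (hi i) x)‖ₑ) +
        ∫⁻ x in cube n, ‖W i (ins i (lo i) x)‖ₑ) with hS
  have hle : lo ≤ hi := fun i => by have := (hlo i).2; have := (hhi i).1; linarith
  have hcont : ∀ δ, 0 < δ → Continuous fun y => cutoff (n + 1) δ y * D y := fun δ hδ => by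
    simp_rw [cutoff_mul_div_eq hW hD hδ]
    exact (continuous_finsetSum _ fun i _ =>
      ((contDiff_cutoff_mul hW hδ i).continuous_fderiv (by norm_num)).clm_apply
        continuous_const).sub (continuous_finsetSum _ fun i _ => continuous_pd_cutoff_mul hW hδ i)
  have step : ∀ δ, 0 < δ → δ ≤ 1 / 2 →
      ∫⁻ y in ball 0 1, ENNReal.ofReal (cutoff (n + 1) δ y * D y) ≤
        S + C * ENNReal.ofReal δ := by
    intro δ hδ hδ2
    have hcI : ∀ {f : Euc (n + 1) → ℝ}, Continuous f → IntegrableOn f (box lo hi) := fun hf =>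
      hf.continuousOn.integrableOn_compact (isCompact_box lo hi)
    have hce : Continuous fun y => ∑ i, pd i (cutoff (n + 1) δ) y * W i y :=
      continuous_finsetSum _ fun i _ => continuous_pd_cutoff_mul hW hδ i
    have hcE : Continuous fun y => ∑ i, pd i (fun y => cutoff (n + 1) δ y * W i y) y :=
      continuous_finsetSum _ fun i _ =>
        ((contDiff_cutoff_mul hW hδ i).continuous_fderiv (by norm_num)).clm_apply continuous_const
    have hint : ∫ y in box lo hi, cutoff (n + 1) δ y * D y =
        (∫ y in box lo hi, ∑ i, pd i (fun y => cutoff (n + 1) δ y * W i y) y) -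
          ∫ y in box lo hi, ∑ i, pd i (cutoff (n + 1) δ) y * W i y := by
      rw [← integral_sub (hcI hcE) (hcI hce)]
      exact integral_congr_ae (.of_forall fun y => cutoff_mul_div_eq hW hD hδ y)
    have hface : ∀ i t, 1 ≤ |t| → |t| ≤ 2 →
        ‖∫ x in Icc (lo ∘ i.succAbove) (hi ∘ i.succAbove),
          cutoff (n + 1) δ (ins i t x) * W i (ins i t x)‖ₑ ≤
        ∫⁻ x in cube n, ‖W i (ins i t x)‖ₑ := by
      intro i t h1 h2
      refine (enorm_integral_le_lintegral_enorm _).trans ?_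
      refine (lintegral_mono_set (face_subset_cube hlo hhi i)).trans ?_
      refine setLIntegral_mono' measurableSet_cube fun x hx => ?_
      rw [cutoff_eq_one hδ (by have := (norm_ins_bounds i h1 h2 hx).1; linarith), one_mul]
    calc ∫⁻ y in ball 0 1, ENNReal.ofReal (cutoff (n + 1) δ y * D y)
        ≤ ∫⁻ y in box lo hi, ENNReal.ofReal (cutoff (n + 1) δ y * D y) :=
          lintegral_mono_set (ball_subset_closedBall.trans (ball_subset_box hlo hhi))
      _ = ENNReal.ofReal (∫ y in box lo hi, cutoff (n + 1) δ y * D y) :=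
          (ofReal_integral_eq_lintegral_ofReal (hcI (hcont δ hδ))
            (.of_forall fun y => mul_nonneg cutoff_nonneg (hD0 y))).symm
      _ ≤ ‖∫ y in box lo hi, cutoff (n + 1) δ y * D y‖ₑ := by
          rw [← ofReal_norm]; exact ENNReal.ofReal_le_ofReal (Real.le_norm_self _)
      _ ≤ S + C * ENNReal.ofReal δ := by
          rw [hint]
          refine enorm_sub_le.trans (add_le_add ?_ ?_)
          · rw [integral_sum_pd_box hle fun i => contDiff_cutoff_mul hW hδ i]
            refine (enorm_sum_le _ _).trans (Finset.sum_le_sum fun i _ => ?_)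
            have h1 := hlo i
            have h2 := hhi i
            refine enorm_sub_le.trans (add_le_add (hface i _ ?_ ?_) (hface i _ ?_ ?_))
            · rw [abs_of_pos (by linarith [h2.1])]; exact h2.1
            · rw [abs_of_pos (by linarith [h2.1])]; exact h2.2
            · rw [abs_of_neg (by linarith [h1.2])]; linarith [h1.2]
            · rw [abs_of_neg (by linarith [h1.2])]; linarith [h1.1]
          · exact (enorm_integral_le_lintegral_enorm _).trans
              ((setLIntegral_le_lintegral _ _).trans (hC W hK δ hδ hδ2))
  set d : ℕ → ℝ := fun k => 1 / ((k : ℝ) + 2) with hd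
  have hd0 : ∀ k, 0 < d k := fun k => by positivity
  have hd2 : ∀ k, d k ≤ 1 / 2 := fun k => by
    simp only [hd]
    gcongr
    have : (0 : ℝ) ≤ k := k.cast_nonneg
    linarith
  have hdl : Filter.Tendsto d Filter.atTop (nhds 0) := by
    have := (tendsto_one_div_add_atTop_nhds_zero_nat (𝕜 := ℝ)).comp (Filter.tendsto_add_atTop_nat 1)
    refine this.congr fun k => ?_
    simp only [hd, Function.comp]; push_cast; ring
  have hlim : Filter.Tendsto (fun k => S + C * ENNReal.ofReal (d k)) Filter.atTop (nhds S) := by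
    have := (ENNReal.Tendsto.const_mul (a := (C : ℝ≥0∞)) (ENNReal.tendsto_ofReal hdl)
      (Or.inr ENNReal.coe_ne_top)).const_add S
    simpa using this
  calc ∫⁻ y in ball 0 1, ENNReal.ofReal (D y)
      ≤ ∫⁻ y in ball 0 1, Filter.liminf
          (fun k => ENNReal.ofReal (cutoff (n + 1) (d k) y * D y)) Filter.atTop := by
        refine lintegral_mono_ae (ae_restrict_of_ae ?_)
        filter_upwards [compl_mem_ae_iff.mpr (measure_singleton (0 : Euc (n + 1)))] with y hy
        have hy0 : 0 < ‖y‖ := norm_pos_iff.mpr hy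
        refine (Filter.Tendsto.liminf_eq (tendsto_const_nhds.congr' ?_)).ge
        filter_upwards [hdl.eventually (gt_mem_nhds (half_pos hy0))] with k hk
        rw [cutoff_eq_one (hd0 k) (by linarith), one_mul]
    _ ≤ Filter.liminf (fun k => ∫⁻ y in ball 0 1,
          ENNReal.ofReal (cutoff (n + 1) (d k) y * D y)) Filter.atTop :=
        lintegral_liminf_le fun k => (hcont _ (hd0 k)).measurable.ennreal_ofReal
    _ ≤ Filter.liminf (fun k => S + C * ENNReal.ofReal (d k)) Filter.atTop :=
        Filter.liminf_le_liminf (.of_forall fun k => step _ (hd0 k) (hd2 k))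
    _ = S := hlim.liminf_eq

end Puncture

section FieldBounds

variable {N : ℕ} {p q a b : ℝ} {u v : Euc N → ℝ} {x : Euc N}

/-- Gradient estimate near the origin, obtained by rescaling the potential estimate. -/
lemma IsNNSol.exists_grad_bound (hN : 3 ≤ N) (hp : 0 < p) (ha : -2 < a)
    (h : IsNNSol p q a b u v) :
    ∃ K : ℝ, 0 ≤ K ∧ ∀ x, x ≠ 0 → ‖x‖ ≤ 1 → ∑ j, |pd j u x| ≤ K / ‖x‖ := by
  obtain ⟨C, hC⟩ := exists_potential_upper hN (by norm_num : (0 : ℝ) < 1 / 4)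
  obtain ⟨Mu, hMu⟩ := (isCompact_closedBall (0 : Euc N) 2).exists_bound_of_continuousOn
    h.continuous_fst.continuousOn
  obtain ⟨Mv, hMv⟩ := (isCompact_closedBall (0 : Euc N) 2).exists_bound_of_continuousOn
    h.continuous_snd.continuousOn
  have hMv0 : 0 ≤ Mv := (norm_nonneg _).trans (hMv 0 (by simp))
  set c := max ((1 / 2 : ℝ) ^ a) (2 ^ a) with hc
  have hc0 : 0 ≤ c := le_max_of_le_left (by positivity)
  set m : ℝ := (N : ℝ) - 1 with hm
  set T : ℝ≥0∞ := ∫⁻ y : Euc N, sing (1 / 4) m y with hT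
  have hTt : T < ⊤ := by
    exact lintegral_sing_lt_top volume (by rw [finrank_euclideanSpace_fin]; omega)
      (by rw [finrank_euclideanSpace_fin, hm]; linarith)
  set V := volume (ball (0 : Euc N) (1 / 4)) with hV
  have hVt : V < ⊤ := measure_ball_lt_top
  set Q : ℝ≥0∞ := C * (ENNReal.ofReal (c * Mv ^ p) * T + ENNReal.ofReal Mu * V) with hQ
  have hQt : Q ≠ ⊤ := ENNReal.mul_ne_top ENNReal.coe_ne_top (ENNReal.add_ne_top.mpr
    ⟨ENNReal.mul_ne_top ENNReal.ofReal_ne_top hTt.ne,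
      ENNReal.mul_ne_top ENNReal.ofReal_ne_top hVt.ne⟩)
  refine ⟨N * Q.toReal, by positivity, fun x hx hx1 => ?_⟩
  set R := ‖x‖ with hR
  have hR0 : 0 < R := norm_pos_iff.mpr hx
  set z := R⁻¹ • x with hz
  have hRz : R • z = x := by rw [hz, smul_inv_smul₀ hR0.ne']
  have hz1 : ‖z‖ = 1 := by rw [hz, norm_smul, norm_inv, Real.norm_of_nonneg hR0.le,
    inv_mul_cancel₀ hR0.ne']
  have hball : ∀ y ∈ closedBall z (1 / 4), 1 / 2 ≤ ‖y‖ ∧ ‖y‖ ≤ 2 := fun y hy => by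
    rw [mem_closedBall, dist_eq_norm] at hy
    have h := abs_le.mp (abs_norm_sub_norm_le y z)
    constructor <;> linarith
  have hb2 : ∀ y ∈ closedBall z (1 / 4), R • y ∈ closedBall (0 : Euc N) 2 ∧ R • y ≠ 0 :=
    fun y hy => by
      obtain ⟨k1, k2⟩ := hball y hy
      refine ⟨?_, smul_ne_zero hR0.ne' (norm_pos_iff.mp (by linarith))⟩
      rw [mem_closedBall_zero_iff, norm_smul, Real.norm_of_nonneg hR0.le]
      nlinarith
  have hlap : ∀ y ∈ closedBall z (1 / 4), ‖lap (fun y => u (R • y)) y‖ₑ ≤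
      ENNReal.ofReal (c * Mv ^ p) := fun y hy => by
    obtain ⟨k1, k2⟩ := hball y hy
    obtain ⟨k3, k4⟩ := hb2 y hy
    rw [lap_comp_smul R (h.contDiffAt_fst _ k4), h.lap_fst _ k4, ← ofReal_norm]
    refine ENNReal.ofReal_le_ofReal ?_
    have hv0 := h.nonneg_snd (R • y)
    have hv1 : v (R • y) ≤ Mv := (Real.le_norm_self _).trans (hMv _ k3)
    rw [norm_mul, norm_neg, norm_mul, Real.norm_of_nonneg (by positivity),
      Real.norm_of_nonneg (by positivity), Real.norm_of_nonneg (by positivity), norm_smul,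
      Real.norm_of_nonneg hR0.le, Real.mul_rpow hR0.le (norm_nonneg _)]
    have e1 : R ^ 2 * R ^ a ≤ 1 := by
      rw [← Real.rpow_natCast, ← Real.rpow_add hR0]
      exact Real.rpow_le_one hR0.le hx1 (by push_cast; linarith)
    have e2 : ‖y‖ ^ a ≤ c := (rpow_mem_Icc_of_mem_Icc (by norm_num) ⟨k1, k2⟩ a).2
    calc R ^ 2 * (R ^ a * ‖y‖ ^ a * v (R • y) ^ p)
        = R ^ 2 * R ^ a * (‖y‖ ^ a * v (R • y) ^ p) := by ring
      _ ≤ 1 * (c * Mv ^ p) := by gcongr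
      _ = _ := one_mul _
  have hpd : ∀ i, |pd i u x| ≤ Q.toReal / R := fun i => by
    have k := (hC z (fun y => u (R • y)) fun y hy =>
      contDiffAt_comp_smul (h.contDiffAt_fst _ (hb2 y hy).2)).2 i
    rw [pd_comp_smul, hRz] at k
    have k2 : ‖R * pd i u x‖ₑ ≤ Q := by
      refine k.trans ?_
      rw [hQ]
      gcongr
      · calc ∫⁻ y in ball z (1 / 4), ‖y - z‖ₑ ^ (-m) * ‖lap (fun y => u (R • y)) y‖ₑ
            ≤ ∫⁻ y in ball z (1 / 4), ‖y - z‖ₑ ^ (-m) * ENNReal.ofReal (c * Mv ^ p) :=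
              setLIntegral_mono' measurableSet_ball fun y hy => by
                gcongr; exact hlap y (ball_subset_closedBall hy)
          _ = ∫⁻ y, sing (1 / 4) m (y - z) * ENNReal.ofReal (c * Mv ^ p) :=
              setLIntegral_ball_eq_sing z _
          _ = ENNReal.ofReal (c * Mv ^ p) * T := by
              rw [lintegral_mul_const' _ _ ENNReal.ofReal_ne_top,
                lintegral_sub_right_eq_self (fun y => sing (1 / 4) m y), mul_comm]
      · calc ∫⁻ y in ball z (1 / 4), ‖u (R • y)‖ₑ
            ≤ ∫⁻ _y in ball z (1 / 4), ENNReal.ofReal Mu :=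
              setLIntegral_mono' measurableSet_ball fun y hy => by
                rw [← ofReal_norm]
                exact ENNReal.ofReal_le_ofReal (hMu _ (hb2 y (ball_subset_closedBall hy)).1)
          _ = ENNReal.ofReal Mu * V := by
              rw [setLIntegral_const, hV, Measure.addHaar_ball_center]
    rw [le_div_iff₀ hR0, mul_comm]
    have := ENNReal.toReal_mono hQt k2
    rwa [toReal_enorm, norm_mul, Real.norm_of_nonneg hR0.le] at this
  calc ∑ j, |pd j u x| ≤ ∑ _j : Fin N, Q.toReal / R := Finset.sum_le_sum fun j _ => hpd j
    _ = _ := by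
      rw [Finset.sum_const, Finset.card_univ, Fintype.card_fin, nsmul_eq_mul]; ring

lemma abs_radial_le (f : Euc N → ℝ) : |radial f x| ≤ ‖x‖ * ∑ j, |pd j f x| := by
  rw [radial, Finset.mul_sum]
  refine (Finset.abs_sum_le_sum_abs _ _).trans (Finset.sum_le_sum fun j _ => ?_)
  rw [abs_mul]
  gcongr
  exact PiLp.norm_apply_le x j

lemma abs_pd_le_sum (f : Euc N → ℝ) (i : Fin N) : |pd i f x| ≤ ∑ j, |pd j f x| :=
  Finset.single_le_sum (f := fun j => |pd j f x|) (fun _ _ => abs_nonneg _) (Finset.mem_univ i)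

lemma abs_gdot_le (f g : Euc N → ℝ) :
    |gdot f g x| ≤ (∑ j, |pd j f x|) * ∑ j, |pd j g x| := by
  rw [gdot, Finset.sum_mul]
  refine (Finset.abs_sum_le_sum_abs _ _).trans (Finset.sum_le_sum fun j _ => ?_)
  rw [abs_mul]
  gcongr
  exact abs_pd_le_sum g j

lemma IsNNSol.abs_pohField_le (hp : 0 < p) (hq : 0 < q) (h : IsNNSol p q a b u v) {a₁ a₂ : ℝ}
    (i : Fin N) : |pohField p q a b a₁ a₂ u v i x| ≤
      3 * (‖x‖ * ((∑ j, |pd j u x|) * ∑ j, |pd j v x|)) +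
        ‖x‖ * (‖x‖ ^ a * v x ^ (p + 1) + ‖x‖ ^ b * u x ^ (q + 1)) +
        (|a₁| * (v x * ∑ j, |pd j u x|) + |a₂| * (u x * ∑ j, |pd j v x|)) := by
  have hu := h.nonneg_fst x
  have hv := h.nonneg_snd x
  have r1 := abs_radial_le (x := x) u
  have r2 := abs_radial_le (x := x) v
  have g1 := abs_gdot_le (x := x) u v
  have d1 := abs_pd_le_sum (x := x) u i
  have d2 := abs_pd_le_sum (x := x) v i
  have hxi : |x i| ≤ ‖x‖ := PiLp.norm_apply_le x i
  set A := ∑ j, |pd j u x|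
  set B := ∑ j, |pd j v x|
  have hA : 0 ≤ A := (abs_nonneg _).trans d1
  have hB : 0 ≤ B := (abs_nonneg _).trans d2
  have t1 : |radial v x * pd i u x| ≤ ‖x‖ * B * A := by rw [abs_mul]; gcongr
  have t2 : |radial u x * pd i v x| ≤ ‖x‖ * A * B := by rw [abs_mul]; gcongr
  have t3 : |x i * gdot u v x| ≤ ‖x‖ * (A * B) := by rw [abs_mul]; gcongr
  have t4 : |x i * (‖x‖ ^ a * v x ^ (p + 1) / (p + 1) + ‖x‖ ^ b * u x ^ (q + 1) / (q + 1))| ≤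
      ‖x‖ * (‖x‖ ^ a * v x ^ (p + 1) + ‖x‖ ^ b * u x ^ (q + 1)) := by
    rw [abs_mul, abs_of_nonneg (a := _ + _) (by positivity)]
    gcongr
    · exact div_le_self (by positivity) (by linarith)
    · exact div_le_self (by positivity) (by linarith)
  have t5 : |a₁ * (v x * pd i u x)| ≤ |a₁| * (v x * A) := by
    rw [abs_mul, abs_mul, abs_of_nonneg hv]; gcongr
  have t6 : |a₂ * (u x * pd i v x)| ≤ |a₂| * (u x * B) := by
    rw [abs_mul, abs_mul, abs_of_nonneg hu]; gcongr
  rw [pohField]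
  refine (abs_add_le _ _).trans (add_le_add ((abs_add_le _ _).trans (add_le_add ?_ t4))
    ((abs_add_le _ _).trans (add_le_add t5 t6)))
  refine (abs_sub _ _).trans ?_
  linarith [abs_add_le (radial v x * pd i u x) (radial u x * pd i v x)]

end FieldBounds

section Feedback

variable {N : ℕ} {p q a b a₁ a₂ s : ℝ}

lemma IsNNSol.exists_pohField_origin_bound (hN : 3 ≤ N) (hp : 0 < p) (hq : 0 < q) (ha : -2 < a)
    (hb : -2 < b) {u v : Euc N → ℝ} (h : IsNNSol p q a b u v) (a₁ a₂ : ℝ) :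
    ∃ K : ℝ, ∀ i x, x ≠ 0 → ‖x‖ ≤ 1 → |pohField p q a b a₁ a₂ u v i x| ≤ K / ‖x‖ := by
  obtain ⟨K₁, hK₁, h₁⟩ := h.exists_grad_bound hN hp ha
  obtain ⟨K₂, hK₂, h₂⟩ := h.symm.exists_grad_bound hN hq hb
  obtain ⟨M₁, hM₁⟩ := (isCompact_closedBall (0 : Euc N) 1).exists_bound_of_continuousOn
    h.continuous_fst.continuousOn
  obtain ⟨M₂, hM₂⟩ := (isCompact_closedBall (0 : Euc N) 1).exists_bound_of_continuousOn
    h.continuous_snd.continuousOn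
  refine ⟨3 * (K₁ * K₂) + (M₂ ^ (p + 1) + M₁ ^ (q + 1)) + (|a₁| * (M₂ * K₁) + |a₂| * (M₁ * K₂)),
    fun i x hx hx1 => (h.abs_pohField_le hp hq i).trans ?_⟩
  have hR : 0 < ‖x‖ := norm_pos_iff.mpr hx
  have hxb : x ∈ closedBall (0 : Euc N) 1 := by simpa using hx1
  have hu0 := h.nonneg_fst x
  have hv0 := h.nonneg_snd x
  have hu : u x ≤ M₁ := (Real.le_norm_self _).trans (hM₁ x hxb)
  have hv : v x ≤ M₂ := (Real.le_norm_self _).trans (hM₂ x hxb)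
  have hA := h₁ x hx hx1
  have hB := h₂ x hx hx1
  set A := ∑ j, |pd j u x|
  set B := ∑ j, |pd j v x|
  have hA0 : 0 ≤ A := Finset.sum_nonneg fun _ _ => abs_nonneg _
  have hB0 : 0 ≤ B := Finset.sum_nonneg fun _ _ => abs_nonneg _
  have key : ∀ c : ℝ, -2 < c → ‖x‖ * ‖x‖ ^ c ≤ 1 / ‖x‖ := fun c hc => by
    rw [le_div_iff₀ hR]
    calc ‖x‖ * ‖x‖ ^ c * ‖x‖ = ‖x‖ ^ (c + 2) := by
          rw [Real.rpow_add hR, Real.rpow_two]; ring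
      _ ≤ 1 := Real.rpow_le_one hR.le hx1 (by linarith)
  have hM₁0 := hu0.trans hu
  have hM₂0 := hv0.trans hv
  calc 3 * (‖x‖ * (A * B)) + ‖x‖ * (‖x‖ ^ a * v x ^ (p + 1) + ‖x‖ ^ b * u x ^ (q + 1)) +
        (|a₁| * (v x * A) + |a₂| * (u x * B))
      = 3 * (‖x‖ * (A * B)) +
        ((‖x‖ * ‖x‖ ^ a) * v x ^ (p + 1) + (‖x‖ * ‖x‖ ^ b) * u x ^ (q + 1)) +
        (|a₁| * (v x * A) + |a₂| * (u x * B)) := by ring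
    _ ≤ 3 * (‖x‖ * (K₁ / ‖x‖ * (K₂ / ‖x‖))) +
        ((1 / ‖x‖) * M₂ ^ (p + 1) + (1 / ‖x‖) * M₁ ^ (q + 1)) +
        (|a₁| * (M₂ * (K₁ / ‖x‖)) + |a₂| * (M₁ * (K₂ / ‖x‖))) := by
        gcongr
        · exact key a ha
        · exact key b hb
    _ = _ := by field_simp

lemma bdry_eq_ofReal {u v : Euc N → ℝ} (hp : 0 < p) (hq : 0 < q) (hu : ∀ x, 0 ≤ u x)
    (hv : ∀ x, 0 ≤ v x) (x : Euc N) : bdry p q u v x = ENNReal.ofReal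
      (((∑ j, |pd j u x|) + u x) * ((∑ j, |pd j v x|) + v x) +
        (u x ^ (q + 1) + v x ^ (p + 1))) := by
  have hu0 := hu x
  have hv0 := hv x
  have hsum : ∀ w : Euc N → ℝ, 0 ≤ w x → (∑ j, ‖pd j w x‖ₑ) + ‖w x‖ₑ =
      ENNReal.ofReal ((∑ j, |pd j w x|) + w x) := fun w hw => by
    rw [ENNReal.ofReal_add (Finset.sum_nonneg fun _ _ => abs_nonneg _) hw,
      ENNReal.ofReal_sum_of_nonneg fun _ _ => abs_nonneg _]
    simp_rw [← Real.enorm_of_nonneg hw, ← ofReal_norm, Real.norm_eq_abs]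
  rw [bdry, hsum u hu0, hsum v hv0, ← ENNReal.ofReal_mul (by positivity),
    Real.enorm_of_nonneg hu0, Real.enorm_of_nonneg hv0,
    ENNReal.ofReal_rpow_of_nonneg hu0 (by linarith), ENNReal.ofReal_rpow_of_nonneg hv0 (by linarith),
    ← ENNReal.ofReal_add (by positivity) (by positivity),
    ← ENNReal.ofReal_add (by positivity) (by positivity)]

lemma exists_pohField_le_bdry (hp : 0 < p) (hq : 0 < q) (a b a₁ a₂ Λ : ℝ) :
    ∃ C : ℝ≥0, ∀ u v : Euc N → ℝ, IsNNSol p q a b u v → ∀ i x, 1 ≤ ‖x‖ → ‖x‖ ≤ Λ →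
      ‖pohField p q a b a₁ a₂ u v i x‖ₑ ≤ C * bdry p q u v x := by
  set c₁ := max ((1 : ℝ) ^ a) (Λ ^ a) with hc₁
  set c₂ := max ((1 : ℝ) ^ b) (Λ ^ b) with hc₂
  have hc₁0 : 0 ≤ c₁ := le_max_of_le_left (by positivity)
  have hc₂0 : 0 ≤ c₂ := le_max_of_le_left (by positivity)
  set C := 3 * |Λ| + |Λ| * (c₁ + c₂) + (|a₁| + |a₂|) with hC
  refine ⟨C.toNNReal, fun u v h i x hx1 hxΛ => ?_⟩
  have hC0 : 0 ≤ C := by positivity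
  have hu0 := h.nonneg_fst x
  have hv0 := h.nonneg_snd x
  change _ ≤ ENNReal.ofReal C * _
  rw [bdry_eq_ofReal hp hq h.nonneg_fst h.nonneg_snd, ← ENNReal.ofReal_mul hC0, ← ofReal_norm,
    Real.norm_eq_abs]
  refine ENNReal.ofReal_le_ofReal ((h.abs_pohField_le hp hq i).trans ?_)
  set A := ∑ j, |pd j u x|
  set B := ∑ j, |pd j v x|
  have hA0 : 0 ≤ A := Finset.sum_nonneg fun _ _ => abs_nonneg _
  have hB0 : 0 ≤ B := Finset.sum_nonneg fun _ _ => abs_nonneg _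
  have e₁ : ‖x‖ ^ a ≤ c₁ := (rpow_mem_Icc_of_mem_Icc one_pos ⟨hx1, hxΛ⟩ a).2
  have e₂ : ‖x‖ ^ b ≤ c₂ := (rpow_mem_Icc_of_mem_Icc one_pos ⟨hx1, hxΛ⟩ b).2
  have e₃ : ‖x‖ ≤ |Λ| := hxΛ.trans (le_abs_self _)
  set S := (A + u x) * (B + v x) + (u x ^ (q + 1) + v x ^ (p + 1)) with hS
  have hup : 0 ≤ u x ^ (q + 1) := by positivity
  have hvp : 0 ≤ v x ^ (p + 1) := by positivity
  have k₁ : A * B ≤ S := by nlinarith [mul_nonneg hA0 hv0, mul_nonneg hu0 hB0, mul_nonneg hu0 hv0]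
  have k₂ : v x * A ≤ S := by
    nlinarith [mul_nonneg hA0 hB0, mul_nonneg hu0 hB0, mul_nonneg hu0 hv0]
  have k₃ : u x * B ≤ S := by
    nlinarith [mul_nonneg hA0 hB0, mul_nonneg hA0 hv0, mul_nonneg hu0 hv0]
  have hS0 : 0 ≤ (A + u x) * (B + v x) := by positivity
  have k₄ : v x ^ (p + 1) ≤ S := by linarith
  have k₅ : u x ^ (q + 1) ≤ S := by linarith
  calc _ ≤ 3 * (|Λ| * S) + |Λ| * (c₁ * S + c₂ * S) + (|a₁| * S + |a₂| * S) := by gcongr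
    _ = C * S := by rw [hC]; ring

/-- The feedback estimate: the energy in the unit ball is controlled by a power less than one of
the energy on a larger shell. -/
theorem exists_energy_feedback {n : ℕ} (hn : 2 ≤ n) (hp : 0 < p) (hq : 0 < q) (hpq : 1 < p * q)
    (ha : -2 < a) (hb : -2 < b)
    (hsub : ((n + 1 : ℕ) + a) / (p + 1) + ((n + 1 : ℕ) + b) / (q + 1) > ((n + 1 : ℕ) : ℝ) - 2)
    (hs : p ≤ s) (hns : n < s * (2 * (q + 1) / (p * q - 1))) (C₁ : ℝ≥0) :
    ∃ θ : ℝ, 0 ≤ θ ∧ θ < 1 ∧ ∃ C : ℝ≥0, ∀ u v : Euc (n + 1) → ℝ, IsNNSol p q a b u v →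
      (∫⁻ y in shell (n + 1) (2 * (n + 1) + 1), ‖v y‖ₑ ^ s ≤ C₁) →
      ∫⁻ y in ball 0 1, ENNReal.ofReal (‖y‖ ^ b * u y ^ (q + 1) + ‖y‖ ^ a * v y ^ (p + 1)) ≤
        C * shellEnergy n p q u v ^ θ := by
  obtain ⟨θ, hθ, hθ1, C₀, hC₀⟩ := exists_bdry_bound hn hp hq hpq a b hs hns C₁
  set ε : ℝ := (((n + 1 : ℕ) + a) / (p + 1) + ((n + 1 : ℕ) + b) / (q + 1) -
    (((n + 1 : ℕ) : ℝ) - 2)) / 2 with hε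
  have hε0 : 0 < ε := by rw [hε]; linarith
  set a₁ : ℝ := ((n + 1 : ℕ) + a) / (p + 1) - ε with ha₁
  set a₂ : ℝ := ((n + 1 : ℕ) + b) / (q + 1) - ε with ha₂
  obtain ⟨C₂, hC₂⟩ := exists_pohField_le_bdry (N := n + 1) hp hq a b a₁ a₂ (2 * (n + 1))
  refine ⟨θ, hθ, hθ1, (1 / ε).toNNReal * ((n + 1) * (2 * (C₂ * C₀))), fun u v h hv => ?_⟩
  choose t ht htb using hC₀ u v h hv
  obtain ⟨K, hK⟩ := h.exists_pohField_origin_bound (by omega) hp hq ha hb a₁ a₂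
  set E : Euc (n + 1) → ℝ := fun y => ‖y‖ ^ b * u y ^ (q + 1) + ‖y‖ ^ a * v y ^ (p + 1) with hE
  have hE0 : ∀ y, 0 ≤ E y := fun y => by
    have := h.nonneg_fst y
    have := h.nonneg_snd y
    positivity
  have hi : ∀ i, t i 1 (Or.inl rfl) ∈ Icc (1 : ℝ) 2 := fun i => by
    simpa [one_add_one_eq_two] using ht i 1 (Or.inl rfl)
  have lo : ∀ i, t i (-2) (Or.inr rfl) ∈ Icc (-2 : ℝ) (-1) := fun i => by
    have := ht i (-2) (Or.inr rfl)
    norm_num at this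
    exact this
  have key := lintegral_ball_le_faces (K := K) (D := fun y => ε * E y) hn
    (W := pohField p q a b a₁ a₂ u v)
    (fun i x hx => h.contDiffAt_pohField hp hq hx i) (fun x => mul_nonneg hε0.le (hE0 x))
    (fun x hx => by
      rw [h.sum_pd_pohField hp hq (by rw [ha₁, ha₂, hε]; ring) hx, ha₁, ha₂, hE]; ring)
    hK lo hi
  have face : ∀ i c hc, (∀ r ∈ Icc c (c + 1), 1 ≤ |r| ∧ |r| ≤ 2) →
      ∫⁻ x in cube n, ‖pohField p q a b a₁ a₂ u v i (ins i (t i c hc) x)‖ₑ ≤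
        C₂ * (C₀ * shellEnergy n p q u v ^ θ) := fun i c hc hr => by
    calc _ ≤ ∫⁻ x in cube n, C₂ * bdry p q u v (ins i (t i c hc) x) :=
          setLIntegral_mono' measurableSet_cube fun x hx => by
            obtain ⟨r1, r2⟩ := hr _ (ht i c hc)
            obtain ⟨b1, b2⟩ := norm_ins_bounds i r1 r2 hx
            exact hC₂ u v h i _ b1 b2
      _ = C₂ * ∫⁻ x in cube n, bdry p q u v (ins i (t i c hc) x) :=
          lintegral_const_mul' _ _ ENNReal.coe_ne_top
      _ ≤ _ := by gcongr; exact htb i c hc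
  set G := shellEnergy n p q u v ^ θ
  have tot : ∫⁻ y in ball (0 : Euc (n + 1)) 1, ENNReal.ofReal (ε * E y) ≤
      (n + 1) * (2 * (C₂ * (C₀ * G))) := by
    refine key.trans ((Finset.sum_le_sum (g := fun _ => 2 * (C₂ * (C₀ * G))) fun i _ => ?_).trans ?_)
    · rw [two_mul]
      refine add_le_add (face i 1 _ fun r hr => ?_) (face i (-2) _ fun r hr => ?_)
      · rw [abs_of_nonneg (by linarith [hr.1])]
        exact ⟨hr.1, by linarith [hr.2]⟩
      · rw [abs_of_nonpos (by linarith [hr.2])]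
        exact ⟨by linarith [hr.2], by linarith [hr.1]⟩
    · rw [Finset.sum_const, Finset.card_univ, Fintype.card_fin, nsmul_eq_mul]
      push_cast; exact le_rfl
  calc ∫⁻ y in ball (0 : Euc (n + 1)) 1, ENNReal.ofReal (E y)
      = ENNReal.ofReal (1 / ε) * ∫⁻ y in ball (0 : Euc (n + 1)) 1, ENNReal.ofReal (ε * E y) := by
        rw [← lintegral_const_mul' _ _ ENNReal.ofReal_ne_top]
        refine lintegral_congr fun y => ?_
        rw [← ENNReal.ofReal_mul (by positivity), ← mul_assoc, one_div_mul_cancel hε0.ne', one_mul]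
    _ ≤ ENNReal.ofReal (1 / ε) * ((n + 1) * (2 * (C₂ * (C₀ * G)))) := by gcongr
    _ = _ := by
        rw [ENNReal.ofReal]
        push_cast
        ring

end Feedback

section Rescale

variable {N : ℕ} {p q a b : ℝ} {u v : Euc N → ℝ}

lemma setLIntegral_eq_comp_smul {r : ℝ} (hr : 0 < r) (S : Set (Euc N))
    (f : Euc N → ℝ≥0∞) :
    ∫⁻ x in S, f x = ENNReal.ofReal (r ^ (N : ℝ)) * ∫⁻ z in (r • ·) ⁻¹' S, f (r • z) := by
  have hm : MeasurableEmbedding (fun z : Euc N => r • z) := measurableEmbedding_const_smul₀ hr.ne'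
  have h1 : ∫⁻ z in (r • ·) ⁻¹' S, f (r • z) =
      ENNReal.ofReal ((r ^ (N : ℝ))⁻¹) * ∫⁻ x in S, f x := by
    rw [← hm.lintegral_map (μ := volume.restrict ((r • ·) ⁻¹' S)), ← hm.restrict_map,
      Measure.map_addHaar_smul _ hr.ne', finrank_euclideanSpace_fin, Measure.restrict_smul,
      lintegral_smul_measure, abs_of_nonneg (by positivity), Real.rpow_natCast, smul_eq_mul]
  rw [h1, ← mul_assoc, ← ENNReal.ofReal_mul (by positivity),
    mul_inv_cancel₀ (by positivity), ENNReal.ofReal_one, one_mul]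

lemma IsNNSol.rescale (h : IsNNSol p q a b u v) {R A B : ℝ} (hR : 0 < R)
    (hA : A + 2 + a = p * B) (hB : B + 2 + b = q * A) :
    IsNNSol p q a b (fun x => R ^ A * u (R • x)) (fun x => R ^ B * v (R • x)) := by
  have hne : ∀ x : Euc N, x ≠ 0 → R • x ≠ 0 := fun x hx => smul_ne_zero hR.ne' hx
  have aux : ∀ (w : Euc N → ℝ) (A : ℝ), (∀ x, x ≠ 0 → ContDiffAt ℝ 2 w x) → ∀ x, x ≠ 0 →
      lap (fun x => R ^ A * w (R • x)) x = R ^ (A + 2) * lap w (R • x) := fun w A hw x hx => by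
    rw [lap_const_mul _ (contDiffAt_comp_smul (hw _ (hne x hx))), lap_comp_smul _ (hw _ (hne x hx)),
      Real.rpow_add hR, Real.rpow_two, mul_assoc]
  have rhs : ∀ (z : ℝ), 0 ≤ z → ∀ (A B a p : ℝ) (x : Euc N), A + 2 + a = p * B →
      R ^ (A + 2) * -(‖R • x‖ ^ a * z ^ p) = -(‖x‖ ^ a * (R ^ B * z) ^ p) :=
    fun z hz A B a p x hA => by
      rw [norm_smul, Real.norm_of_nonneg hR.le, Real.mul_rpow hR.le (norm_nonneg _),
        Real.mul_rpow (by positivity) hz, ← Real.rpow_mul hR.le, mul_comm B, ← hA,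
        Real.rpow_add hR (A + 2)]
      ring
  refine ⟨fun x hx => contDiffAt_const.mul (contDiffAt_comp_smul (h.contDiffAt_fst _ (hne x hx))),
    fun x hx => contDiffAt_const.mul (contDiffAt_comp_smul (h.contDiffAt_snd _ (hne x hx))),
    continuous_const.mul (h.continuous_fst.comp (continuous_const_smul R)),
    continuous_const.mul (h.continuous_snd.comp (continuous_const_smul R)),
    fun x => mul_nonneg (by positivity) (h.nonneg_fst _),
    fun x => mul_nonneg (by positivity) (h.nonneg_snd _), fun x hx => ?_, fun x hx => ?_⟩
  · rw [aux u A h.contDiffAt_fst x hx, h.lap_fst _ (hne x hx), rhs _ (h.nonneg_snd _) A B a p x hA]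
  · rw [aux v B h.contDiffAt_snd x hx, h.lap_snd _ (hne x hx), rhs _ (h.nonneg_fst _) B A b q x hB]

/-- The energy of `(u, v)` in a ball centred at the origin. -/
def ballEnergy {N : ℕ} (p q a b : ℝ) (u v : Euc N → ℝ) (r : ℝ) : ℝ≥0∞ :=
  ∫⁻ y in ball 0 r, ENNReal.ofReal (‖y‖ ^ b * u y ^ (q + 1) + ‖y‖ ^ a * v y ^ (p + 1))

lemma monotone_ballEnergy : Monotone (ballEnergy p q a b u v) := fun _ _ h =>
  lintegral_mono_set (ball_subset_ball h)

lemma IsNNSol.ballEnergy_rescale (h : IsNNSol p q a b u v) {R A B : ℝ} (hR : 0 < R)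
    (hA : A + 2 + a = p * B) (hB : B + 2 + b = q * A) (r : ℝ) :
    ballEnergy p q a b (fun x => R ^ A * u (R • x)) (fun x => R ^ B * v (R • x)) r =
      ENNReal.ofReal (R ^ (A + B + 2 - N)) * ballEnergy p q a b u v (R * r) := by
  have hpre : (R • ·) ⁻¹' ball (0 : Euc N) (R * r) = ball 0 r := by
    ext x
    simp [norm_smul, abs_of_pos hR, hR]
  have e1 : ∀ (z : ℝ), 0 ≤ z → ∀ (A B b q : ℝ) (y : Euc N), B + 2 + b = q * A →
      ‖y‖ ^ b * (R ^ A * z) ^ (q + 1) = R ^ (A + B + 2) * (‖R • y‖ ^ b * z ^ (q + 1)) :=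
    fun z hz A B b q y hB => by
      rw [norm_smul, Real.norm_of_nonneg hR.le, Real.mul_rpow hR.le (norm_nonneg _),
        Real.mul_rpow (by positivity) hz, ← Real.rpow_mul hR.le,
        show A * (q + 1) = A + B + 2 + b by linarith, Real.rpow_add hR (A + B + 2) b]
      ring
  rw [ballEnergy, ballEnergy, setLIntegral_eq_comp_smul hR (ball 0 (R * r)), hpre, ← mul_assoc,
    ← ENNReal.ofReal_mul (by positivity), ← Real.rpow_add hR, sub_add_cancel,
    ← lintegral_const_mul' _ _ ENNReal.ofReal_ne_top]
  refine lintegral_congr fun y => ?_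
  rw [← ENNReal.ofReal_mul (by positivity), e1 _ (h.nonneg_fst _) A B b q y hB,
    e1 _ (h.nonneg_snd _) B A a p y hA, show B + A = A + B from add_comm _ _, ← mul_add]

lemma exists_shellEnergy_le {n : ℕ} (hp : 0 < p) (hq : 0 < q) (a b : ℝ) :
    ∃ C : ℝ≥0, ∀ u v : Euc (n + 1) → ℝ, (∀ x, 0 ≤ u x) → (∀ x, 0 ≤ v x) →
      shellEnergy n p q u v ≤ C * (1 + ballEnergy p q a b u v (2 * (n + 1) + 2)) := by
  set Λ : ℝ := 2 * (n + 1) + 1 with hΛ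
  have hΛ0 : 0 < Λ := by positivity
  set c := min (min ((1 / 2 : ℝ) ^ a) (Λ ^ a)) (min ((1 / 2 : ℝ) ^ b) (Λ ^ b)) with hc
  have hc0 : 0 < c := by
    refine lt_min (lt_min ?_ ?_) (lt_min ?_ ?_) <;> positivity
  refine ⟨1 + 2 * c⁻¹.toNNReal, fun u v hu hv => ?_⟩
  set E : Euc (n + 1) → ℝ := fun y => ‖y‖ ^ b * u y ^ (q + 1) + ‖y‖ ^ a * v y ^ (p + 1) with hE
  have main : ∀ (w : Euc (n + 1) → ℝ) (r : ℝ), 0 ≤ r → (∀ x, 0 ≤ w x) →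
      (∀ y ∈ shell (n + 1) Λ, c * w y ^ r ≤ E y) →
      ∫⁻ y in shell (n + 1) Λ, ‖w y‖ₑ ^ r ≤
        ENNReal.ofReal c⁻¹ * ballEnergy p q a b u v (2 * (n + 1) + 2) := fun w r hr hw hle => by
    rw [ballEnergy, ← lintegral_const_mul' _ _ ENNReal.ofReal_ne_top]
    refine (setLIntegral_mono' (measurableSet_shell _ _) fun y hy => ?_).trans
      (lintegral_mono_set (sdiff_subset.trans (closedBall_subset_ball (by linarith))))
    rw [Real.enorm_of_nonneg (hw y), ENNReal.ofReal_rpow_of_nonneg (hw y) hr,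
      ← ENNReal.ofReal_mul (by positivity)]
    refine ENNReal.ofReal_le_ofReal ?_
    rw [inv_mul_eq_div, le_div_iff₀ hc0, mul_comm]
    exact hle y hy
  have h1 := main u (q + 1) (by linarith) hu fun y hy => by
    have := hu y
    have := hv y
    have k := (rpow_mem_Icc_of_mem_Icc (by norm_num) (mem_shell.mp hy) b).1
    have k2 : c ≤ ‖y‖ ^ b := (min_le_right _ _).trans k
    calc c * u y ^ (q + 1) ≤ ‖y‖ ^ b * u y ^ (q + 1) := by gcongr
      _ ≤ E y := le_add_of_nonneg_right (by positivity)
  have h2 := main v (p + 1) (by linarith) hv fun y hy => by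
    have := hu y
    have := hv y
    have k := (rpow_mem_Icc_of_mem_Icc (by norm_num) (mem_shell.mp hy) a).1
    have k2 : c ≤ ‖y‖ ^ a := (min_le_left _ _).trans k
    calc c * v y ^ (p + 1) ≤ ‖y‖ ^ a * v y ^ (p + 1) := by gcongr
      _ ≤ E y := le_add_of_nonneg_left (by positivity)
  set I := ballEnergy p q a b u v (2 * (n + 1) + 2)
  calc shellEnergy n p q u v ≤ 1 + (ENNReal.ofReal c⁻¹ * I + ENNReal.ofReal c⁻¹ * I) := by
        rw [shellEnergy]; gcongr
    _ ≤ (1 + 2 * ENNReal.ofReal c⁻¹) * (1 + I) := by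
        rw [← two_mul, mul_add, add_mul, add_mul, one_mul, one_mul, mul_one, ← mul_assoc]
        exact add_le_add (le_self_add) (le_add_self)
    _ = _ := by rw [ENNReal.ofReal]; push_cast; rfl

end Rescale

section Iteration

open Filter Topology

/-- A sublinear feedback inequality along a geometric sequence, together with at most linear
growth along that sequence, forces an absolute bound. -/
lemma le_of_sublinear_feedback {g : ℝ → ℝ} {c θ l R₀ A B : ℝ} (hl : 1 ≤ l)
    (hθ : 0 ≤ θ) (hθ1 : θ < 1) (hR₀ : 0 ≤ R₀) (hg : ∀ R, R₀ ≤ R → g R ≤ c + θ * g (l * R))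
    (hgrow : ∀ R, R₀ ≤ R → ∀ k : ℕ, g (l ^ k * R) ≤ A + B * Real.log R + B * k)
    {R : ℝ} (hR : R₀ ≤ R) : g R ≤ c / (1 - θ) := by
  have h1θ : 0 < 1 - θ := by linarith
  have iter : ∀ k : ℕ, ∀ R, R₀ ≤ R → g R ≤ c / (1 - θ) + θ ^ k * (g (l ^ k * R) - c / (1 - θ)) := by
    intro k
    induction k with
    | zero => intro R _; simp
    | succ k ih =>
      intro R hR
      have hlR : R₀ ≤ l * R := hR.trans (le_mul_of_one_le_left (hR₀.trans hR) hl)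
      have h1 := hg R hR
      have h2 := mul_le_mul_of_nonneg_left (ih (l * R) hlR) hθ
      have h3 : c + θ * (c / (1 - θ)) = c / (1 - θ) := by field_simp; ring
      have h4 : l ^ k * (l * R) = l ^ (k + 1) * R := by ring
      rw [h4] at h2
      calc g R ≤ c + θ * (c / (1 - θ) + θ ^ k * (g (l ^ (k + 1) * R) - c / (1 - θ))) := by linarith
        _ = (c + θ * (c / (1 - θ))) + θ ^ (k + 1) * (g (l ^ (k + 1) * R) - c / (1 - θ)) := by ring
        _ = _ := by rw [h3]
  set Q := A + B * Real.log R - c / (1 - θ) with hQ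
  have lim : Tendsto (fun k : ℕ => c / (1 - θ) + (Q * θ ^ k + B * (k * θ ^ k))) atTop
      (𝓝 (c / (1 - θ) + (Q * 0 + B * 0))) :=
    tendsto_const_nhds.add (((tendsto_pow_atTop_nhds_zero_of_lt_one hθ hθ1).const_mul Q).add
      ((tendsto_self_mul_const_pow_of_lt_one hθ hθ1).const_mul B))
  rw [mul_zero, mul_zero, add_zero, add_zero] at lim
  refine ge_of_tendsto' lim fun k => (iter k R hR).trans ?_
  have := mul_le_mul_of_nonneg_left (hgrow R hR k) (pow_nonneg hθ k)
  rw [hQ]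
  linarith

lemma eq_zero_of_energy_feedback {F : ℝ → ℝ≥0∞} (hF : Monotone F) {σ l θ m R₀ : ℝ} (hσ : 0 < σ)
    (hl : 1 ≤ l) (hθ : 0 ≤ θ) (hθ1 : θ < 1) (C K : ℝ≥0) (hm : 0 ≤ m)
    (hfb : ∀ R, R₀ ≤ R → ENNReal.ofReal (R ^ σ) * F R ≤
      C * (1 + ENNReal.ofReal (R ^ σ) * F (R * l)) ^ θ)
    (hgrow : ∀ R, R₀ ≤ R → F R ≤ K * ENNReal.ofReal (R ^ m)) (r : ℝ) : F r = 0 := by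
  set R₁ := max R₀ 1 with hR₁
  have hR₁0 : ∀ R, R₁ ≤ R → R₀ ≤ R ∧ 1 ≤ R := fun R hR => max_le_iff.mp hR
  have hfin : ∀ R, R₁ ≤ R → F R ≠ ⊤ := fun R hR =>
    ((hgrow R (hR₁0 R hR).1).trans_lt (ENNReal.mul_lt_top ENNReal.coe_lt_top
      ENNReal.ofReal_lt_top)).ne
  set f : ℝ → ℝ := fun R => R ^ σ * (F R).toReal with hf
  have hf0 : ∀ R, R₁ ≤ R → 0 ≤ f R := fun R hR => by
    have := (hR₁0 R hR).2
    positivity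
  have hfb' : ∀ R, R₁ ≤ R → f R ≤ C * (1 + f (l * R)) ^ θ := fun R hR => by
    obtain ⟨h0, h1⟩ := hR₁0 R hR
    have hlR : R₁ ≤ l * R := hR.trans (le_mul_of_one_le_left (by linarith) hl)
    have hle : R ≤ l * R := le_mul_of_one_le_left (by linarith) hl
    have k := hfb R h0
    rw [mul_comm R l] at k
    have k2 : ENNReal.ofReal (R ^ σ) * F R ≤
        C * (1 + ENNReal.ofReal ((l * R) ^ σ) * F (l * R)) ^ θ := by
      refine k.trans ?_
      gcongr
    have hne : C * (1 + ENNReal.ofReal ((l * R) ^ σ) * F (l * R)) ^ θ ≠ ⊤ :=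
      ENNReal.mul_ne_top ENNReal.coe_ne_top (ENNReal.rpow_ne_top_of_nonneg hθ
        (ENNReal.add_ne_top.mpr ⟨ENNReal.one_ne_top,
          ENNReal.mul_ne_top ENNReal.ofReal_ne_top (hfin _ hlR)⟩))
    have k3 := ENNReal.toReal_mono hne k2
    rw [ENNReal.toReal_mul, ENNReal.toReal_ofReal (by positivity), ENNReal.toReal_mul,
      ENNReal.coe_toReal, ← ENNReal.toReal_rpow, ENNReal.toReal_add ENNReal.one_ne_top
      (ENNReal.mul_ne_top ENNReal.ofReal_ne_top (hfin _ hlR)), ENNReal.toReal_one,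
      ENNReal.toReal_mul, ENNReal.toReal_ofReal (by positivity)] at k3
    exact k3
  have hgrow' : ∀ R, R₁ ≤ R → f R ≤ K * R ^ (m + σ) := fun R hR => by
    obtain ⟨h0, h1⟩ := hR₁0 R hR
    have k := ENNReal.toReal_mono (ENNReal.mul_ne_top ENNReal.coe_ne_top ENNReal.ofReal_ne_top)
      (hgrow R h0)
    rw [ENNReal.toReal_mul, ENNReal.toReal_ofReal (by positivity), ENNReal.coe_toReal] at k
    calc f R ≤ R ^ σ * (K * R ^ m) := 
          mul_le_mul_of_nonneg_left k (by positivity)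
      _ = _ := by rw [Real.rpow_add (by linarith)]; ring
  have hlog : ∀ R, R₁ ≤ R → 1 + f R ≤ Real.exp (Real.log (1 + C) / (1 - θ)) := fun R hR => by
    rw [← Real.log_le_iff_le_exp (by linarith [hf0 R hR])]
    refine le_of_sublinear_feedback (g := fun R => Real.log (1 + f R)) (l := l) (R₀ := R₁)
      (A := Real.log (1 + K)) (B := (m + σ) * (1 + Real.log l)) hl hθ hθ1
      (by rw [hR₁]; positivity) (fun R hR => ?_) (fun R hR k => ?_) hR
    · obtain ⟨h0, h1⟩ := hR₁0 R hR
      have hlR : R₁ ≤ l * R := hR.trans (le_mul_of_one_le_left (by linarith) hl)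
      have e1 : 1 ≤ (1 + f (l * R)) ^ θ := Real.one_le_rpow (by linarith [hf0 _ hlR]) hθ
      have e2 : 0 < 1 + f (l * R) := by linarith [hf0 _ hlR]
      rw [← Real.log_rpow e2, ← Real.log_mul (by positivity) (by positivity)]
      refine Real.log_le_log (by linarith [hf0 R hR]) ?_
      have := hfb' R hR
      linarith
    · obtain ⟨h0, h1⟩ := hR₁0 R hR
      have hl0 : 0 < l := by linarith
      have hlk : 1 ≤ l ^ k := one_le_pow₀ hl
      have hkR : R₁ ≤ l ^ k * R := hR.trans (le_mul_of_one_le_left (by linarith) hlk)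
      have e1 : 1 ≤ (l ^ k * R) ^ (m + σ) :=
        Real.one_le_rpow (hR₁0 _ hkR).2 (by linarith)
      have e2 : 1 + f (l ^ k * R) ≤ (1 + K) * (l ^ k * R) ^ (m + σ) := by
        linarith [hgrow' _ hkR]
      have hlogl : 0 ≤ Real.log l := Real.log_nonneg hl
      have hlogR : 0 ≤ Real.log R := Real.log_nonneg h1
      have hR0 : 0 < R := by linarith
      calc Real.log (1 + f (l ^ k * R)) ≤ Real.log ((1 + K) * (l ^ k * R) ^ (m + σ)) :=
            Real.log_le_log (by linarith [hf0 _ hkR]) e2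
        _ = Real.log (1 + K) + (m + σ) * (k * Real.log l + Real.log R) := by
            rw [Real.log_mul (by positivity) (by positivity), Real.log_rpow (by positivity),
              Real.log_mul (by positivity) (by positivity), Real.log_pow]
        _ ≤ Real.log (1 + K) + (m + σ) * (k * (1 + Real.log l) + (1 + Real.log l) * Real.log R) := by
            gcongr
            · linarith
            · exact le_mul_of_one_le_left hlogR (by linarith)
        _ = _ := by ring
  set M := Real.exp (Real.log (1 + C) / (1 - θ))
  have hbound : ∀ᶠ R in atTop, F r ≤ ENNReal.ofReal (M * R ^ (-σ)) := by
    filter_upwards [eventually_ge_atTop R₁, eventually_ge_atTop r] with R hR hr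
    have h1 := (hR₁0 R hR).2
    have hR0 : 0 < R := by linarith
    refine (hF hr).trans ?_
    rw [← ENNReal.ofReal_toReal (hfin R hR)]
    refine ENNReal.ofReal_le_ofReal ?_
    rw [Real.rpow_neg hR0.le, ← div_eq_mul_inv, le_div_iff₀ (by positivity), mul_comm]
    linarith [hlog R hR]
  have lim : Tendsto (fun R : ℝ => ENNReal.ofReal (M * R ^ (-σ))) atTop (𝓝 (ENNReal.ofReal (M * 0))) :=
    ENNReal.tendsto_ofReal ((tendsto_rpow_neg_atTop hσ).const_mul M)
  rw [mul_zero, ENNReal.ofReal_zero] at lim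
  exact le_antisymm (ge_of_tendsto lim hbound) zero_le

end Iteration

section Growth

variable {N : ℕ} {p q a b s : ℝ} {u v : Euc N → ℝ}

lemma PolyBounded.exists_ball_bound {w : Euc N → ℝ} (hw : PolyBounded w) (hc : Continuous w) :
    ∃ M L : ℝ, 0 ≤ M ∧ 0 ≤ L ∧ ∀ R, 1 ≤ R → ∀ x ∈ ball (0 : Euc N) R, w x ≤ M * R ^ L := by
  obtain ⟨K, L, R₀, hK, hL, h⟩ := hw
  obtain ⟨M, hM⟩ := (isCompact_closedBall (0 : Euc N) |R₀|).exists_bound_of_continuousOn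
    hc.continuousOn
  have hM0 : 0 ≤ M := (norm_nonneg _).trans (hM 0 (by simp))
  refine ⟨M + K, L, by positivity, hL.le, fun R hR x hx => ?_⟩
  rw [mem_ball_zero_iff] at hx
  have hRL : 1 ≤ R ^ L := Real.one_le_rpow hR hL.le
  by_cases hxR : ‖x‖ ≤ |R₀|
  · have := (Real.le_norm_self _).trans (hM x (by simpa using hxR))
    nlinarith
  · have h1 := (le_abs_self _).trans (h x ((le_abs_self _).trans (not_le.mp hxR).le))
    have h2 : K * ‖x‖ ^ L ≤ K * R ^ L := by gcongr
    nlinarith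

lemma ofReal_norm_rpow_le (hb : -2 < b) {R : ℝ} (hR : 1 ≤ R) {y : Euc N}
    (hy : y ∈ ball (0 : Euc N) R) :
    ENNReal.ofReal (‖y‖ ^ b) ≤ ENNReal.ofReal (R ^ (b + 2)) * (sing 1 2 y + 1) := by
  rw [mem_ball_zero_iff] at hy
  have hR0 : 0 < R := by linarith
  have hRb : 0 < R ^ (b + 2) := by positivity
  rcases eq_or_ne y 0 with rfl | hy0
  · have : sing 1 2 (0 : Euc N) = ⊤ := by
      rw [sing, indicator_of_mem (by simp)]
      simp
    rw [this, top_add, ENNReal.mul_top (by simpa using hRb)]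
    exact le_top
  · have hy0 := norm_pos_iff.mpr hy0
    have h1 : ‖y‖ ^ b ≤ R ^ (b + 2) * ‖y‖ ^ (-2 : ℝ) := by
      calc ‖y‖ ^ b = ‖y‖ ^ (b + 2) * ‖y‖ ^ (-2 : ℝ) := by
            rw [← Real.rpow_add hy0]; congr 1; ring
        _ ≤ _ := by
          gcongr
          linarith
    refine (ENNReal.ofReal_le_ofReal h1).trans ?_
    rw [ENNReal.ofReal_mul hRb.le]
    gcongr
    by_cases hy1 : ‖y‖ < 1
    · rw [sing, indicator_of_mem (by simpa using hy1), ← ofReal_norm,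
        ENNReal.ofReal_rpow_of_pos hy0]
      exact le_self_add
    · refine le_add_left ?_
      rw [← ENNReal.ofReal_one]
      exact ENNReal.ofReal_le_ofReal
        (Real.rpow_le_one_of_one_le_of_nonpos (not_lt.mp hy1) (by norm_num))

lemma PolyBounded.exists_energy_growth (hN : 3 ≤ N) (hb : -2 < b) {w : Euc N → ℝ}
    (hw : PolyBounded w) (hc : Continuous w) (hw0 : ∀ x, 0 ≤ w x) {r : ℝ} (hr : 0 ≤ r) :
    ∃ K : ℝ≥0, ∃ m : ℝ, 0 ≤ m ∧ ∀ R, 1 ≤ R →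
      ∫⁻ y in ball (0 : Euc N) R, ENNReal.ofReal (‖y‖ ^ b * w y ^ r) ≤
        K * ENNReal.ofReal (R ^ m) := by
  obtain ⟨M, L, hM, hL, h⟩ := hw.exists_ball_bound hc
  have hT : ∫⁻ y : Euc N, sing 1 2 y < ⊤ :=
    lintegral_sing_lt_top volume (by rw [finrank_euclideanSpace_fin]; omega)
      (by rw [finrank_euclideanSpace_fin]; exact_mod_cast hN)
  set T := ∫⁻ y : Euc N, sing 1 2 y
  set V := volume (ball (0 : Euc N) 1)
  have hVt : V < ⊤ := measure_ball_lt_top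
  set K : ℝ≥0∞ := ENNReal.ofReal (M ^ r) * (T + V) with hK
  have hKt : K ≠ ⊤ := ENNReal.mul_ne_top ENNReal.ofReal_ne_top
    (ENNReal.add_ne_top.mpr ⟨hT.ne, hVt.ne⟩)
  refine ⟨K.toNNReal, b + 2 + L * r + N, 
    add_nonneg (add_nonneg (by linarith) (by positivity)) (by positivity), fun R hR => ?_⟩
  rw [ENNReal.coe_toNNReal hKt]
  have hR0 : 0 < R := by linarith
  calc ∫⁻ y in ball (0 : Euc N) R, ENNReal.ofReal (‖y‖ ^ b * w y ^ r)
      ≤ ∫⁻ y in ball (0 : Euc N) R, ENNReal.ofReal (R ^ (b + 2)) *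
          ENNReal.ofReal (M ^ r * R ^ (L * r)) * (sing 1 2 y + 1) :=
        setLIntegral_mono' measurableSet_ball fun y hy => by
          have hwy := hw0 y
          have hwR : w y ^ r ≤ M ^ r * R ^ (L * r) := by
            rw [Real.rpow_mul hR0.le, ← Real.mul_rpow hM (by positivity)]
            exact Real.rpow_le_rpow hwy (h R hR y hy) hr
          rw [ENNReal.ofReal_mul (by positivity), mul_right_comm]
          exact mul_le_mul' (ofReal_norm_rpow_le hb hR hy) (ENNReal.ofReal_le_ofReal hwR)
    _ = ENNReal.ofReal (R ^ (b + 2)) * ENNReal.ofReal (M ^ r * R ^ (L * r)) *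
          ((∫⁻ y in ball (0 : Euc N) R, sing 1 2 y) + volume (ball (0 : Euc N) R)) := by
        rw [lintegral_const_mul' _ _ (ENNReal.mul_ne_top ENNReal.ofReal_ne_top
          ENNReal.ofReal_ne_top), lintegral_add_right _ measurable_const, setLIntegral_one]
    _ ≤ ENNReal.ofReal (R ^ (b + 2)) * ENNReal.ofReal (M ^ r * R ^ (L * r)) *
          (ENNReal.ofReal (R ^ (N : ℝ)) * T + ENNReal.ofReal (R ^ (N : ℝ)) * V) := by
        gcongr
        · refine (setLIntegral_le_lintegral _ _).trans (le_mul_of_one_le_left zero_le ?_)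
          rw [← ENNReal.ofReal_one]
          exact ENNReal.ofReal_le_ofReal (Real.one_le_rpow hR (by positivity))
        · rw [Measure.addHaar_ball_of_pos _ _ hR0, finrank_euclideanSpace_fin, Real.rpow_natCast]
    _ = K * ENNReal.ofReal (R ^ (b + 2 + L * r + N)) := by
        rw [hK, Real.rpow_add hR0 (b + 2 + L * r), Real.rpow_add hR0 (b + 2), ENNReal.ofReal_mul (by positivity),
          ENNReal.ofReal_mul (by positivity), ENNReal.ofReal_mul (by positivity)]
        ring

lemma IsNNSol.exists_ballEnergy_growth (hN : 3 ≤ N) (hp : 0 < p) (hq : 0 < q) (ha : -2 < a)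
    (hb : -2 < b) (h : IsNNSol p q a b u v)
    (hbd : (PolyBounded u ∧ PolyBounded v) ∨
      (∫⁻ x : Euc N, ENNReal.ofReal (‖x‖ ^ b * u x ^ (q + 1) + ‖x‖ ^ a * v x ^ (p + 1))) < ⊤) :
    ∃ K : ℝ≥0, ∃ m : ℝ, 0 ≤ m ∧ ∀ R, 1 ≤ R →
      ballEnergy p q a b u v R ≤ K * ENNReal.ofReal (R ^ m) := by
  rcases hbd with ⟨hu, hv⟩ | hfin
  · obtain ⟨K₁, m₁, hm₁, h₁⟩ := hu.exists_energy_growth hN hb h.continuous_fst h.nonneg_fst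
      (by linarith : 0 ≤ q + 1)
    obtain ⟨K₂, m₂, hm₂, h₂⟩ := hv.exists_energy_growth hN ha h.continuous_snd h.nonneg_snd
      (by linarith : 0 ≤ p + 1)
    refine ⟨K₁ + K₂, max m₁ m₂, le_max_of_le_left hm₁, fun R hR => ?_⟩
    have hu0 := h.nonneg_fst
    have hv0 := h.nonneg_snd
    have hmeas : Measurable fun y : Euc N => ENNReal.ofReal (‖y‖ ^ b * u y ^ (q + 1)) :=
      ((measurable_norm.pow_const b).mul
        (h.continuous_fst.measurable.pow_const (q + 1))).ennreal_ofReal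
    calc ballEnergy p q a b u v R
        = (∫⁻ y in ball (0 : Euc N) R, ENNReal.ofReal (‖y‖ ^ b * u y ^ (q + 1))) +
          ∫⁻ y in ball (0 : Euc N) R, ENNReal.ofReal (‖y‖ ^ a * v y ^ (p + 1)) := by
          rw [ballEnergy, ← lintegral_add_left hmeas]
          refine lintegral_congr fun y => ?_
          have := hu0 y
          have := hv0 y
          rw [ENNReal.ofReal_add (by positivity) (by positivity)]
      _ ≤ K₁ * ENNReal.ofReal (R ^ max m₁ m₂) + K₂ * ENNReal.ofReal (R ^ max m₁ m₂) := by
          refine add_le_add ((h₁ R hR).trans ?_) ((h₂ R hR).trans ?_)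
          · gcongr
            exact le_max_left _ _
          · gcongr
            exact le_max_right _ _
      _ = _ := by push_cast; ring
  · refine ⟨(∫⁻ x : Euc N, ENNReal.ofReal
      (‖x‖ ^ b * u x ^ (q + 1) + ‖x‖ ^ a * v x ^ (p + 1))).toNNReal, 0, le_rfl, fun R _ => ?_⟩
    rw [ENNReal.coe_toNNReal hfin.ne, Real.rpow_zero, ENNReal.ofReal_one, mul_one]
    exact setLIntegral_le_lintegral _ _

end Growth

section Annulus

variable {N : ℕ} {s B : ℝ} {v : Euc N → ℝ}

/-- A bound for the rescaled functions on one annulus gives a bound on every compact set avoiding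
the origin. -/
lemma exists_lintegral_rescale_le {R₁ R₄ R₀ : ℝ} (hR₁ : 0 < R₁) (hR₁₄ : R₁ < R₄) (hs : 0 ≤ s)
    (hR₀ : 0 < R₀) {C₀ : ℝ≥0}
    (h : ∀ R, R₀ ≤ R → ∫⁻ y in ball (0 : Euc N) R₄ \ ball 0 R₁, ‖R ^ B * v (R • y)‖ₑ ^ s ≤ C₀)
    {D : Set (Euc N)} (hD : IsCompact D) (hD0 : (0 : Euc N) ∉ D) :
    ∃ C : ℝ≥0, ∃ R', ∀ R, R' ≤ R → ∫⁻ y in D, ‖R ^ B * v (R • y)‖ₑ ^ s ≤ C := by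
  refine hD.induction_on (p := fun S => ∃ C : ℝ≥0, ∃ R', ∀ R, R' ≤ R →
    ∫⁻ y in S, ‖R ^ B * v (R • y)‖ₑ ^ s ≤ C) ⟨0, 0, fun R _ => by simp⟩
    (fun S T hST ⟨C, R', hC⟩ => ⟨C, R', fun R hR => (lintegral_mono_set hST).trans (hC R hR)⟩)
    (fun S T ⟨C, R', hC⟩ ⟨C', R'', hC'⟩ => ⟨C + C', max R' R'', fun R hR =>
      (lintegral_union_le _ _ _).trans ?_⟩) fun y hy => ?_
  · push_cast
    exact add_le_add (hC R ((le_max_left _ _).trans hR)) (hC' R ((le_max_right _ _).trans hR))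
  · have hy0 : 0 < ‖y‖ := norm_pos_iff.mpr fun h0 => hD0 (h0 ▸ hy)
    set c := ‖y‖ / ((R₁ + R₄) / 2) with hc
    have hρ : 0 < (R₁ + R₄) / 2 := by linarith
    have hc0 : 0 < c := by positivity
    have hcy : c * ((R₁ + R₄) / 2) = ‖y‖ := by rw [hc, div_mul_cancel₀ _ hρ.ne']
    set t : Set (Euc N) := {x | c * R₁ < ‖x‖ ∧ ‖x‖ < c * R₄} with ht
    have hto : IsOpen t := (isOpen_lt continuous_const continuous_norm).inter
      (isOpen_lt continuous_norm continuous_const)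
    have hyt : y ∈ t := by
      refine ⟨?_, ?_⟩ <;> rw [← hcy] <;> gcongr <;> linarith
    refine ⟨t, mem_nhdsWithin_of_mem_nhds (hto.mem_nhds hyt), ?_⟩
    set Q : ℝ≥0∞ := ENNReal.ofReal (c ^ (N : ℝ)) * (‖c ^ (-B)‖ₑ ^ s * C₀) with hQ
    have hQt : Q ≠ ⊤ := ENNReal.mul_ne_top ENNReal.ofReal_ne_top (ENNReal.mul_ne_top
      (ENNReal.rpow_ne_top_of_nonneg hs enorm_ne_top) ENNReal.coe_ne_top)
    refine ⟨Q.toNNReal, R₀ / c, fun R hR => ?_⟩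
    rw [ENNReal.coe_toNNReal hQt, setLIntegral_eq_comp_smul hc0]
    have hRc : R₀ ≤ R * c := (div_le_iff₀ hc0).mp hR
    have hR0 : 0 < R := (div_pos hR₀ hc0).trans_le hR
    have hsub : (c • ·) ⁻¹' t ⊆ ball (0 : Euc N) R₄ \ ball 0 R₁ := fun z hz => by
      obtain ⟨h1, h2⟩ := hz
      rw [norm_smul, Real.norm_of_nonneg hc0.le] at h1 h2
      simp only [mem_sdiff, mem_ball_zero_iff, not_lt]
      exact ⟨lt_of_mul_lt_mul_left h2 hc0.le, (lt_of_mul_lt_mul_left h1 hc0.le).le⟩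
    refine mul_le_mul_right ((lintegral_mono_set hsub).trans ?_) _
    refine le_trans (le_of_eq ?_) (mul_le_mul_right (h (R * c) hRc) _)
    rw [← lintegral_const_mul' _ _ (ENNReal.rpow_ne_top_of_nonneg hs enorm_ne_top)]
    refine lintegral_congr fun z => ?_
    rw [← ENNReal.mul_rpow_of_nonneg _ _ hs, ← enorm_mul, ← mul_assoc,
      Real.mul_rpow hR0.le hc0.le, mul_left_comm, ← Real.rpow_add hc0, neg_add_cancel,
      Real.rpow_zero, mul_one, smul_smul]

lemma lintegral_enorm_rpow_le_of_integral_le {w : Euc N → ℝ} (hw : Continuous w)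
    (hw0 : ∀ x, 0 ≤ w x) (hs : 0 ≤ s) {S : Set (Euc N)} {r C : ℝ} (hS : S ⊆ closedBall 0 r)
    (h : ∫ x in S, w x ^ s ≤ C) : ∫⁻ x in S, ‖w x‖ₑ ^ s ≤ ENNReal.ofReal C := by
  have hi : IntegrableOn (fun x => w x ^ s) S :=
    (((hw.rpow_const fun _ => Or.inr hs).continuousOn).integrableOn_compact
      (isCompact_closedBall 0 r)).mono_set hS
  calc ∫⁻ x in S, ‖w x‖ₑ ^ s = ∫⁻ x in S, ENNReal.ofReal (w x ^ s) :=
        lintegral_congr fun x => by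
          rw [Real.enorm_of_nonneg (hw0 x), ENNReal.ofReal_rpow_of_nonneg (hw0 x) hs]
    _ = ENNReal.ofReal (∫ x in S, w x ^ s) :=
        (ofReal_integral_eq_lintegral_ofReal hi
          (Filter.Eventually.of_forall fun x => Real.rpow_nonneg (hw0 x) s)).symm
    _ ≤ _ := ENNReal.ofReal_le_ofReal h

end Annulus

section Liouville

variable {N : ℕ} {p q a b s : ℝ} {u v : Euc N → ℝ}

lemma IsNNSol.eq_zero_of_ballEnergy_eq_zero (hp : 0 < p) (hq : 0 < q)
    (h : IsNNSol p q a b u v) (hN : 1 ≤ N) (h0 : ∀ r, ballEnergy p q a b u v r = 0) :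
    u = 0 ∧ v = 0 := by
  have : Nontrivial (Euc N) := by
    have := Fin.pos_iff_nonempty.mp hN
    infer_instance
  have hu0 := h.nonneg_fst
  have hv0 := h.nonneg_snd
  have hmeas : Measurable fun y : Euc N =>
      ENNReal.ofReal (‖y‖ ^ b * u y ^ (q + 1) + ‖y‖ ^ a * v y ^ (p + 1)) :=
    (((measurable_norm.pow_const b).mul (h.continuous_fst.measurable.pow_const (q + 1))).add
      ((measurable_norm.pow_const a).mul
        (h.continuous_snd.measurable.pow_const (p + 1)))).ennreal_ofReal
  have hball : ∀ᵐ y : Euc N, ∀ k : ℕ, y ∈ ball (0 : Euc N) k →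
      ENNReal.ofReal (‖y‖ ^ b * u y ^ (q + 1) + ‖y‖ ^ a * v y ^ (p + 1)) = 0 :=
    ae_all_iff.mpr fun k => (setLIntegral_eq_zero_iff measurableSet_ball hmeas).mp (h0 k)
  have hae : ∀ᵐ y : Euc N, u y = 0 ∧ v y = 0 := by
    filter_upwards [hball, volume.ae_ne (0 : Euc N)] with y hy hy0
    obtain ⟨k, hk⟩ := exists_nat_gt ‖y‖
    have h1 := ENNReal.ofReal_eq_zero.mp (hy k (by simpa using hk))
    have hn := norm_pos_iff.mpr hy0
    have hu := hu0 y
    have hv := hv0 y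
    have h2 : 0 ≤ ‖y‖ ^ b * u y ^ (q + 1) := by positivity
    have h3 : 0 ≤ ‖y‖ ^ a * v y ^ (p + 1) := by positivity
    have h4 : u y ^ (q + 1) = 0 :=
      (mul_eq_zero.mp (le_antisymm (by linarith) h2)).resolve_left (by positivity)
    have h5 : v y ^ (p + 1) = 0 :=
      (mul_eq_zero.mp (le_antisymm (by linarith) h3)).resolve_left (by positivity)
    exact ⟨(Real.rpow_eq_zero hu (by linarith)).mp h4, (Real.rpow_eq_zero hv (by linarith)).mp h5⟩
  exact ⟨(Continuous.ae_eq_iff_eq volume h.continuous_fst continuous_const).mp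
      (hae.mono fun y hy => hy.1),
    (Continuous.ae_eq_iff_eq volume h.continuous_snd continuous_const).mp
      (hae.mono fun y hy => hy.2)⟩

/-- Bounds on an annulus at all large scales self-improve to an exponent at least `p` on the
reference shell. -/
lemma IsNNSol.exists_shell_bound (hN : 3 ≤ N) (hp : 0 < p) (hq : 0 < q) (hpq : 1 < p * q)
    (h : IsNNSol p q a b u v) {A B : ℝ} (hA : A + 2 + a = p * B) (hB : B + 2 + b = q * A)
    {R₁ R₄ R₀ : ℝ} (hR₁ : 0 < R₁) (hR₁₄ : R₁ < R₄) (hs : 0 < s) (hR₀ : 0 < R₀) {C₀ : ℝ≥0}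
    (hv : ∀ R, R₀ ≤ R → ∫⁻ y in ball (0 : Euc N) R₄ \ ball 0 R₁, ‖R ^ B * v (R • y)‖ₑ ^ s ≤ C₀)
    (Λ : ℝ) : ∃ C : ℝ≥0, ∃ R', ∀ R, R' ≤ R →
      ∫⁻ y in shell N Λ, ‖R ^ B * v (R • y)‖ₑ ^ max s p ≤ C := by
  rcases le_total p s with hps | hsp
  · rw [max_eq_left hps]
    refine exists_lintegral_rescale_le hR₁ hR₁₄ hs.le hR₀ hv
      ((isCompact_closedBall 0 Λ).diff isOpen_ball) fun h0 => ?_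
    have := (mem_shell.mp h0).1
    norm_num at this
  · rw [max_eq_right hsp]
    obtain ⟨C, hC⟩ := exists_apriori_bound hN hp hq hpq a b Λ
    exact ⟨C, 1, fun R hR => (hC _ _ (h.rescale (by linarith) hA hB)).2⟩

end Liouville

/-- Theorem 1.9: Liouville theorem for nonnegative solutions of the subcritical
Hénon–Lane–Emden system under an annulus bound on `v_R^s` with `N - sβ < 1`. -/
theorem stmt_7 (N : ℕ) (hN : 3 ≤ N) (p q a b : ℝ)
    (hq : 0 < q) (hqp : q ≤ p) (hpq : 1 < p * q)
    (ha : -2 < a) (hb : -2 < b)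
    (hsub : ((N : ℝ) + a) / (p + 1) + ((N : ℝ) + b) / (q + 1) > (N : ℝ) - 2)
    (hab : 4 ≤ N → 0 ≤ a - b ∧ a - b ≤ ((N : ℝ) - 2) * (p - q))
    (u v : Euc N → ℝ)
    (hsol : IsHLESol p q a b u v) (hu : ∀ x, 0 ≤ u x) (hv : ∀ x, 0 ≤ v x)
    (hbd : (PolyBounded u ∧ PolyBounded v) ∨
      (∫⁻ x : Euc N, ENNReal.ofReal (‖x‖ ^ b * u x ^ (q + 1) + ‖x‖ ^ a * v x ^ (p + 1))) < ⊤)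
    (R₁ R₄ s C₀ Rstar : ℝ)
    (hR1 : 0 < R₁) (hR14 : R₁ < R₄) (hs : 0 < s) (hC₀ : 0 < C₀) (hRstar : 0 < Rstar)
    (hsβ : (N : ℝ) - s * (2 * (q + 1) / (p * q - 1)) < 1)
    (hint : ∀ R : ℝ, Rstar ≤ R →
      (∫ x in ball (0 : Euc N) R₄ \ ball 0 R₁,
        (R ^ ((2 * (q + 1) + b + q * a) / (p * q - 1)) * v (R • x)) ^ s) ≤ C₀) :
    ∀ x, u x = 0 ∧ v x = 0 := by
  have hp : 0 < p := hq.trans_le hqp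
  have hpq1 : 0 < p * q - 1 := by linarith
  have hpq0 := hpq1.ne'
  have h := hsol.isNNSol hp hq hu hv
  obtain ⟨n, rfl⟩ : ∃ n, N = n + 1 := ⟨N - 1, by omega⟩
  set A := (2 * (p + 1) + a + p * b) / (p * q - 1) with hA
  set B := (2 * (q + 1) + b + q * a) / (p * q - 1) with hB
  have eA : A * (p * q - 1) = 2 * (p + 1) + a + p * b := div_mul_cancel₀ _ hpq0
  have eB : B * (p * q - 1) = 2 * (q + 1) + b + q * a := div_mul_cancel₀ _ hpq0
  have hAB : A + 2 + a = p * B := mul_right_cancel₀ hpq0 (by linear_combination eA - p * eB)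
  have hBA : B + 2 + b = q * A := mul_right_cancel₀ hpq0 (by linear_combination eB - q * eA)
  have hσ : 0 < A + B + 2 - (n + 1 : ℕ) := by
    have e : A + B + 2 - (n + 1 : ℕ) = (p + 1) * (q + 1) / (p * q - 1) *
        (((n + 1 : ℕ) + a) / (p + 1) + ((n + 1 : ℕ) + b) / (q + 1) - ((n + 1 : ℕ) - 2)) := by
      rw [hA, hB]; field_simp; ring
    rw [e]
    exact mul_pos (by positivity) (by linarith)
  have hann : ∀ R, Rstar ≤ R → ∫⁻ y in ball (0 : Euc (n + 1)) R₄ \ ball 0 R₁,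
      ‖R ^ B * v (R • y)‖ₑ ^ s ≤ (C₀.toNNReal : ℝ≥0) := fun R hR =>
    lintegral_enorm_rpow_le_of_integral_le
      (continuous_const.mul (h.continuous_snd.comp (continuous_const_smul R)))
      (fun x => mul_nonneg (Real.rpow_nonneg (hRstar.le.trans hR) _) (hv _)) hs.le
      (sdiff_subset.trans ball_subset_closedBall) (hint R hR)
  obtain ⟨C₁, R', hC₁⟩ := h.exists_shell_bound hN hp hq hpq hAB hBA hR1 hR14 hs hRstar hann
    (2 * (n + 1) + 1)
  have hns : (n : ℝ) < max s p * (2 * (q + 1) / (p * q - 1)) := by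
    have h1 : s * (2 * (q + 1) / (p * q - 1)) ≤ max s p * (2 * (q + 1) / (p * q - 1)) :=
      mul_le_mul_of_nonneg_right (le_max_left _ _) (by positivity)
    push_cast at hsβ
    linarith
  obtain ⟨θ, hθ, hθ1, C₂, hC₂⟩ := exists_energy_feedback (n := n) (by omega) hp hq hpq ha hb hsub
    (le_max_right s p) hns C₁
  obtain ⟨C₃, hC₃⟩ := exists_shellEnergy_le (n := n) hp hq a b
  obtain ⟨K, m, hm, hK⟩ := h.exists_ballEnergy_growth hN hp hq ha hb hbd
  have hzero : ∀ r, ballEnergy p q a b u v r = 0 := fun r =>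
    eq_zero_of_energy_feedback monotone_ballEnergy (l := 2 * (n + 1) + 2) (R₀ := max R' 1) hσ
      (by linarith [(Nat.cast_nonneg n : (0 : ℝ) ≤ n)]) hθ hθ1 (C₂ * C₃ ^ θ) K hm
      (fun R hR => by
        obtain ⟨hR', hR1⟩ := max_le_iff.mp hR
        have hR0 : 0 < R := by linarith
        have hsc := h.rescale hR0 hAB hBA
        have e := h.ballEnergy_rescale hR0 hAB hBA
        have k := hC₂ _ _ hsc (hC₁ R hR')
        have k2 := ENNReal.rpow_le_rpow (hC₃ _ _ hsc.nonneg_fst hsc.nonneg_snd) hθ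
        rw [e, ENNReal.mul_rpow_of_nonneg _ _ hθ] at k2
        have k3 := e 1
        rw [mul_one] at k3
        rw [← k3, ENNReal.coe_mul, ENNReal.coe_rpow_of_nonneg _ hθ, mul_assoc]
        exact k.trans (mul_le_mul_right k2 _))
      (fun R hR => hK R (max_le_iff.mp hR).2) r
  obtain ⟨rfl, rfl⟩ := h.eq_zero_of_ballEnergy_eq_zero hp hq (by omega) hzero
  exact fun x => ⟨rfl, rfl⟩
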